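/- arXiv:2206.01511 — 4 statements merged into one kernel-verified Lean document; each statement's English description precedes it below -/
import Mathlib

section
/- For any finite outerplanar graph G with at least one edge, at least one of the following holds: (i) G has a vertex of degree 1; (ii) G has two adjacent vertices both of degree 2; (iii) G has a vertex of degree 2 whose two neighbors are adjacent to each other. Moreover, every 2-connected outerplanar graph satisfies (ii) or (iii). -/
open SimpleGraph

variable {V : Type*}

/-- `(v, e)` is an incidence of `G`: `e` is an edge of `G` and `v ∈ e`. -/
def SimpleGraph.IsIncidence (G : SimpleGraph V) (v : V) (e : Sym2 V) : Prop :=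
  e ∈ G.edgeSet ∧ v ∈ e

/-- A vi-simultaneous proper `k`-coloring of `G`, given by a coloring `cV` of the vertices
and a coloring `cI` of the incidences (the value of `cI v e` matters only when `(v, e)` is
an incidence of `G`). -/
structure SimpleGraph.IsViColoring (G : SimpleGraph V) (k : ℕ)
    (cV : V → Fin k) (cI : V → Sym2 V → Fin k) : Prop where
  /-- adjacent vertices receive distinct colors -/
  adj_ne : ∀ ⦃u v⦄, G.Adj u v → cV u ≠ cV v
  /-- a vertex `u` and an incidence `(w, f)` with `u ∈ f` receive distinct colors -/
  vertex_inc_ne : ∀ ⦃u w f⦄, G.IsIncidence w f → u ∈ f → cV u ≠ cI w f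
  /-- two distinct incidences `(v, e)` and `(w, f)` receive distinct colors whenever
  `v = w`, or `e = f`, or the edge `{v, w}` equals `e` or `f` -/
  inc_ne : ∀ ⦃v e w f⦄, G.IsIncidence v e → G.IsIncidence w f → (v, e) ≠ (w, f) →
    (v = w ∨ e = f ∨ s(v, w) = e ∨ s(v, w) = f) → cI v e ≠ cI w f

/-- The set of colors appearing on the second incidences
`I_2(u) = {(v, {u, v}) : v adjacent to u}` of a vertex `u`. -/
def SimpleGraph.secondIncColors (G : SimpleGraph V) {k : ℕ}
    (cI : V → Sym2 V → Fin k) (u : V) : Set (Fin k) :=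
  {a | ∃ v, G.Adj u v ∧ cI v s(u, v) = a}

/-- The vi-simultaneous chromatic number `χ_vi(G)`. -/
noncomputable def SimpleGraph.chiVi (G : SimpleGraph V) : ℕ :=
  sInf {k | ∃ cV cI, G.IsViColoring k cV cI}

/-- `χ_{vi,s}(G)`: the least `k` admitting a vi-simultaneous `(k, s)`-coloring, i.e. a
vi-simultaneous proper `k`-coloring using at most `s` colors on `I_2(v)` for each vertex `v`. -/
noncomputable def SimpleGraph.chiViS (G : SimpleGraph V) (s : ℕ) : ℕ :=
  sInf {k | ∃ cV cI, G.IsViColoring k cV cI ∧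
    ∀ u, (G.secondIncColors cI u).ncard ≤ s}

/-- `G` is outerplanar: there is a linear ordering of the vertices such that no two edges
`{a, b}` and `{c, d}` satisfy `a < c < b < d`. -/
def SimpleGraph.Outerplanar (G : SimpleGraph V) : Prop :=
  ∃ r : LinearOrder V, ∀ a b c d : V, G.Adj a b → G.Adj c d →
    ¬(r.lt a c ∧ r.lt c b ∧ r.lt b d)

/-- The maximum degree `Δ(G)` of a finite graph. -/
noncomputable def SimpleGraph.maxDeg (G : SimpleGraph V) [Fintype V] : ℕ :=
  Finset.univ.sup fun v => (G.neighborSet v).ncard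

/-- `G` is 2-connected: it has at least 3 vertices, is connected, and deleting any single
vertex leaves it connected. -/
def SimpleGraph.TwoConnected (G : SimpleGraph V) [Fintype V] : Prop :=
  3 ≤ Fintype.card V ∧ G.Connected ∧
    ∀ v : V, (((⊤ : G.Subgraph).deleteVerts {v}).coe).Connected

/-- If every neighbor `z` of `y` lies in `[a, b]`, the vertex `y` does not have degree one, and no
edge inside `[a, b]` other than `ab` spans a non-isolated vertex, then a non-isolated `y` strictly
between `a` and `b` has exactly two neighbors, one on each side. -/
theorem SimpleGraph.exists_neighborSet_eq_pair [LinearOrder V] {G : SimpleGraph V} {a b y z : V}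
    (hay : a < y) (hyb : y < b) (hyz : G.Adj y z) (hdeg : (G.neighborSet y).ncard ≠ 1)
    (hmem : ∀ t, G.Adj y t → a ≤ t ∧ t ≤ b)
    (hspan : ∀ c d x t, G.Adj c d → a ≤ c → d ≤ b → (c ≠ a ∨ d ≠ b) → c < x → x < d →
      ¬ G.Adj x t) :
    ∃ p q, a ≤ p ∧ p < y ∧ y < q ∧ q ≤ b ∧ G.Adj y p ∧ G.Adj y q ∧ G.neighborSet y = {p, q} := by
  have hleft : ∀ s t, G.Adj y s → G.Adj y t → s < t → y < t := by
    intro s t hs ht hst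
    by_contra hty
    have hty' : t < y := lt_of_le_of_ne (not_lt.mp hty) ht.ne'
    exact hspan s y t y hs.symm (hmem s hs).1 hyb.le (Or.inr hyb.ne) hst hty' ht.symm
  have hright : ∀ s t, G.Adj y s → G.Adj y t → s < t → s < y := by
    intro s t hs ht hst
    by_contra hys
    have hys' : y < s := lt_of_le_of_ne (not_lt.mp hys) hs.ne
    exact hspan y t s y ht hay.le (hmem t ht).2 (Or.inl hay.ne') hys' hst hs.symm
  have hpair : ∀ p q, G.Adj y p → G.Adj y q → p < q → G.neighborSet y = {p, q} := by
    intro p q hp hq hpq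
    ext t
    simp only [mem_neighborSet, Set.mem_insert_iff, Set.mem_singleton_iff]
    refine ⟨fun ht => ?_, by rintro (rfl | rfl) <;> assumption⟩
    have hpy := hright p q hp hq hpq
    have hyq := hleft p q hp hq hpq
    rcases lt_or_gt_of_ne ht.ne with h | h
    · rcases lt_trichotomy t q with h' | h' | h'
      · exact absurd (hright t q ht hq h') h.not_gt
      · exact Or.inr h'
      · exact absurd (hright q t hq ht h') hyq.not_gt
    · rcases lt_trichotomy t p with h' | h' | h'
      · exact absurd (hleft t p ht hp h') hpy.not_gt
      · exact Or.inl h'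
      · exact absurd (hleft p t hp ht h') h.not_gt
  obtain ⟨w, hw, hwz⟩ : ∃ w, G.Adj y w ∧ w ≠ z := by
    by_contra! h
    refine hdeg (Set.ncard_eq_one.mpr ⟨z, ?_⟩)
    ext t
    exact ⟨h t, by rintro rfl; exact hyz⟩
  have key : ∀ p q, G.Adj y p → G.Adj y q → p < q →
      ∃ p q, a ≤ p ∧ p < y ∧ y < q ∧ q ≤ b ∧ G.Adj y p ∧ G.Adj y q ∧
        G.neighborSet y = {p, q} := fun p q hp hq hpq =>
    ⟨p, q, (hmem p hp).1, hright p q hp hq hpq, hleft p q hp hq hpq, (hmem q hq).2, hp, hq,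
      hpair p q hp hq hpq⟩
  rcases lt_or_gt_of_ne hwz with h | h
  · exact key w z hw hyz h
  · exact key z w hyz hw h

/-- If `G` has an edge but no vertex of degree one, then in any linear ordering of the vertices
some edge spans a non-isolated vertex. -/
theorem SimpleGraph.exists_adj_spanning [Finite V] [LinearOrder V] {G : SimpleGraph V}
    (hE : ∃ u v, G.Adj u v) (hdeg : ∀ v, (G.neighborSet v).ncard ≠ 1) :
    ∃ a b x t, G.Adj a b ∧ a < x ∧ x < b ∧ G.Adj x t := by
  obtain ⟨a, ⟨z, haz⟩, hmin⟩ :=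
    Set.exists_min_image {v | ∃ w, G.Adj v w} id (Set.toFinite _) hE
  obtain ⟨w, hw, hwz⟩ : ∃ w, G.Adj a w ∧ w ≠ z := by
    by_contra! h
    refine hdeg a (Set.ncard_eq_one.mpr ⟨z, ?_⟩)
    ext t
    exact ⟨h t, by rintro rfl; exact haz⟩
  have hlt : ∀ t, G.Adj a t → a < t := fun t ht =>
    lt_of_le_of_ne (hmin t ⟨a, ht.symm⟩) ht.ne
  rcases lt_or_gt_of_ne hwz with h | h
  · exact ⟨a, z, w, a, haz, hlt w hw, h, hw.symm⟩
  · exact ⟨a, w, z, a, hw, hlt z haz, h, haz.symm⟩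

/-- A finite outerplanar graph with an edge and without vertices of degree one has two adjacent
vertices of degree two, or a vertex of degree two whose neighbors are adjacent. -/
theorem SimpleGraph.Outerplanar.exists_degree_two_configuration [Finite V] {G : SimpleGraph V}
    (hG : G.Outerplanar) (hE : ∃ u v, G.Adj u v) (hdeg : ∀ v, (G.neighborSet v).ncard ≠ 1) :
    (∃ u v, G.Adj u v ∧ (G.neighborSet u).ncard = 2 ∧ (G.neighborSet v).ncard = 2) ∨
    (∃ v u w, (G.neighborSet v).ncard = 2 ∧ G.Adj v u ∧ G.Adj v w ∧ G.Adj u w) := by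
  obtain ⟨r, hr⟩ := hG
  let _ : LinearOrder V := r
  replace hr : ∀ a b c d : V, G.Adj a b → G.Adj c d → a < c → c < b → b < d → False :=
    fun a b c d h₁ h₂ h₃ h₄ h₅ => hr a b c d h₁ h₂ ⟨h₃, h₄, h₅⟩
  obtain ⟨a₀, b₀, hab₀⟩ := exists_adj_spanning hE hdeg
  obtain ⟨⟨a, b⟩, ⟨x₀, t₀, hab, hax₀, hx₀b, hx₀⟩, hmin⟩ :=
    Set.exists_min_image {p : V × V | ∃ x t, G.Adj p.1 p.2 ∧ p.1 < x ∧ x < p.2 ∧ G.Adj x t}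
      (fun p => (Set.Icc p.1 p.2).ncard) (Set.toFinite _) ⟨(a₀, b₀), hab₀⟩
  dsimp only at hab hax₀ hx₀b hmin
  have hlt : a < b := hax₀.trans hx₀b
  have hspan : ∀ c d x t, G.Adj c d → a ≤ c → d ≤ b → (c ≠ a ∨ d ≠ b) → c < x → x < d →
      ¬ G.Adj x t := by
    intro c d x t hcd hac hdb hne hcx hxd hxt
    refine (hmin (c, d) ⟨x, t, hcd, hcx, hxd, hxt⟩).not_gt (Set.ncard_lt_ncard ?_ (Set.toFinite _))
    refine (Set.ssubset_iff_of_subset (Set.Icc_subset_Icc hac hdb)).mpr ?_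
    rcases hne with h | h
    · exact ⟨a, ⟨le_rfl, hlt.le⟩, fun hm => h (le_antisymm hm.1 hac)⟩
    · exact ⟨b, ⟨hlt.le, le_rfl⟩, fun hm => h (le_antisymm hdb hm.2)⟩
  have hmem : ∀ y, a < y → y < b → ∀ t, G.Adj y t → a ≤ t ∧ t ≤ b := by
    refine fun y hay hyb t hyt => ⟨?_, ?_⟩
    · exact not_lt.mp fun h => hr t y a b hyt.symm hab h hay hyb
    · exact not_lt.mp fun h => hr a b y t hab hyt hay hyb h
  obtain ⟨x, ⟨hax, hxb, t, hxt⟩, hxmin⟩ :=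
    Set.exists_min_image {y | a < y ∧ y < b ∧ ∃ t, G.Adj y t} id (Set.toFinite _)
      ⟨x₀, hax₀, hx₀b, t₀, hx₀⟩
  obtain ⟨p, q, hap, hpx, hxq, hqb, hp, hq, hN⟩ :=
    exists_neighborSet_eq_pair hax hxb hxt (hdeg x) (hmem x hax hxb) hspan
  have hx2 : (G.neighborSet x).ncard = 2 := hN ▸ Set.ncard_pair (hpx.trans hxq).ne
  have hpa : a = p := by
    by_contra hne
    exact (hxmin p ⟨lt_of_le_of_ne hap hne, hpx.trans hxb, x, hp.symm⟩).not_gt hpx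
  subst hpa
  rcases eq_or_lt_of_le hqb with rfl | hqb
  · exact Or.inr ⟨x, a, q, hx2, hp, hq, hab⟩
  · obtain ⟨p', q', -, hp'q, hqq', -, -, -, hN'⟩ := exists_neighborSet_eq_pair (hax.trans hxq) hqb
      hq.symm (hdeg q) (hmem q (hax.trans hxq) hqb) hspan
    exact Or.inl ⟨x, q, hq, hx2, hN' ▸ Set.ncard_pair (hp'q.trans hqq').ne⟩

/-- A 2-connected graph has no vertex of degree one. -/
theorem SimpleGraph.TwoConnected.ncard_neighborSet_ne_one [Fintype V] {G : SimpleGraph V}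
    (hG : G.TwoConnected) (v : V) : (G.neighborSet v).ncard ≠ 1 := by
  intro hv
  obtain ⟨w, hw⟩ := Set.ncard_eq_one.mp hv
  have hvw : G.Adj v w := by
    rw [← mem_neighborSet, hw]
    rfl
  obtain ⟨u, huv, huw⟩ : ∃ u, u ≠ v ∧ u ≠ w := by
    classical
    have hcard : ({v, w} : Finset V).card < Fintype.card V :=
      (Finset.card_le_two).trans_lt hG.1
    obtain ⟨u, hu⟩ := Finset.exists_mem_notMem_of_card_lt_card
      (s := {v, w}) (t := Finset.univ) hcard
    exact ⟨u, by simpa using hu⟩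
  obtain ⟨walk⟩ := (hG.2.2 w).preconnected ⟨v, by simp [hvw.ne]⟩ ⟨u, by simp [huw]⟩
  cases walk with
  | nil => exact huv rfl
  | @cons _ t _ hadj _ =>
    have hvt : (t : V) ∈ G.neighborSet v := by
      exact (Subgraph.coe_adj _ _ _ ▸ hadj :).adj_sub
    rw [hw] at hvt
    have htw := t.2
    simp at htw
    exact htw hvt

/-- A 2-connected graph has an edge. -/
theorem SimpleGraph.TwoConnected.exists_adj [Fintype V] {G : SimpleGraph V}
    (hG : G.TwoConnected) : ∃ u v, G.Adj u v := by
  have : Nontrivial V := Fintype.one_lt_card_iff_nontrivial.mp (by have := hG.1; omega)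
  obtain ⟨u⟩ := hG.2.1.nonempty
  exact ⟨u, hG.2.1.preconnected.exists_adj_of_nontrivial u⟩

/-- Every finite outerplanar graph with at least one edge has (i) a vertex of degree 1, or
(ii) two adjacent vertices of degree 2, or (iii) a vertex of degree 2 whose two neighbors
are adjacent; moreover, every 2-connected outerplanar graph satisfies (ii) or (iii). -/
theorem outerplanar_structure [Fintype V] (G : SimpleGraph V) (hG : G.Outerplanar) :
    (G.edgeSet.Nonempty →
      ((∃ v, (G.neighborSet v).ncard = 1) ∨
       (∃ u v, G.Adj u v ∧ (G.neighborSet u).ncard = 2 ∧ (G.neighborSet v).ncard = 2) ∨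
       (∃ v u w, (G.neighborSet v).ncard = 2 ∧ G.Adj v u ∧ G.Adj v w ∧ G.Adj u w))) ∧
    (G.TwoConnected →
      ((∃ u v, G.Adj u v ∧ (G.neighborSet u).ncard = 2 ∧ (G.neighborSet v).ncard = 2) ∨
       (∃ v u w, (G.neighborSet v).ncard = 2 ∧ G.Adj v u ∧ G.Adj v w ∧ G.Adj u w))) := by
  refine ⟨fun hE => ?_, fun h2 => hG.exists_degree_two_configuration h2.exists_adj
    h2.ncard_neighborSet_ne_one⟩
  by_cases hdeg : ∃ v, (G.neighborSet v).ncard = 1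
  · exact Or.inl hdeg
  · obtain ⟨⟨u, v⟩, huv⟩ := hE
    exact Or.inr (hG.exists_degree_two_configuration ⟨u, v, huv⟩ (not_exists.mp hdeg))
end

section
/- If G is a finite 2-connected outerplanar graph with Δ(G) = 3, then χ_{vi,2}(G) ≤ 6. Moreover, this bound is tight: there exists a 2-connected outerplanar graph with maximum degree 3 whose vi-simultaneous chromatic number equals 6. -/
open SimpleGraph

variable {V : Type*}

namespace ViColoring

/-- Four consecutive cells of a path carry pairwise distinct colors. -/
def Distinct4 (a b c d : Fin 6) : Prop :=
  a ≠ b ∧ a ≠ c ∧ a ≠ d ∧ b ≠ c ∧ b ≠ d ∧ c ≠ d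

instance (a b c d : Fin 6) : Decidable (Distinct4 a b c d) := by
  unfold Distinct4; infer_instance

/-- The colors around a vertex of degree at most three: `c` is the color of the vertex, `o₁ o₂ o₃`
are the colors of its incidences and `i₁ i₂ i₃` those of its second incidences. -/
def Around (c o₁ i₁ o₂ i₂ o₃ i₃ : Fin 6) : Prop :=
  (c ≠ o₁ ∧ c ≠ o₂ ∧ c ≠ o₃ ∧ o₁ ≠ o₂ ∧ o₁ ≠ o₃ ∧ o₂ ≠ o₃) ∧
  (i₁ ≠ c ∧ i₁ ≠ o₁ ∧ i₁ ≠ o₂ ∧ i₁ ≠ o₃) ∧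
  (i₂ ≠ c ∧ i₂ ≠ o₁ ∧ i₂ ≠ o₂ ∧ i₂ ≠ o₃) ∧
  (i₃ ≠ c ∧ i₃ ≠ o₁ ∧ i₃ ≠ o₂ ∧ i₃ ≠ o₃)

instance (c o₁ i₁ o₂ i₂ o₃ i₃ : Fin 6) : Decidable (Around c o₁ i₁ o₂ i₂ o₃ i₃) := by
  unfold Around; infer_instance

/-- The boundary colors that can be extended over a segment: `p q c` are the last three colored
cells before the segment (`c` is the color of its first vertex), and `c' q' p'` are the first
three colored cells after it (`c'` is the color of its last vertex). -/
def Extendable (p q c c' q' p' : Fin 6) : Prop :=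
  (p ≠ q ∧ p ≠ c ∧ q ≠ c) ∧ (c' ≠ q' ∧ c' ≠ p' ∧ q' ≠ p') ∧ c ≠ c' ∧
  ¬ (p = p' ∧ c' ≠ p ∧ c' ≠ q ∧ q' ≠ q ∧ q' ≠ c)

instance (p q c c' q' p' : Fin 6) : Decidable (Extendable p q c c' q' p') := by
  unfold Extendable; infer_instance

theorem exists_perm_normalize (p q c : Fin 6) (h : p ≠ q ∧ p ≠ c ∧ q ≠ c) :
    ∃ σ : Equiv.Perm (Fin 6), σ p = 0 ∧ σ q = 1 ∧ σ c = 2 := by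
  refine ⟨(Equiv.swap p 0).trans ((Equiv.swap (Equiv.swap p 0 q) 1).trans
    (Equiv.swap (Equiv.swap (Equiv.swap p 0 q) 1 (Equiv.swap p 0 c)) 2)), ?_⟩
  revert p q c
  decide +kernel

theorem Extendable.exists_normalize {p q c c' q' p' : Fin 6} (h : Extendable p q c c' q' p') :
    ∃ σ : Equiv.Perm (Fin 6), σ p = 0 ∧ σ q = 1 ∧ σ c = 2 ∧
      Extendable 0 1 2 (σ c') (σ q') (σ p') := by
  obtain ⟨σ, hp, hq, hc⟩ := exists_perm_normalize p q c h.1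
  refine ⟨σ, hp, hq, hc, ?_⟩
  rw [← hp, ← hq, ← hc]
  simpa only [Extendable, σ.injective.ne_iff, σ.injective.eq_iff] using h

/-- A plain edge joining the two ends. -/
theorem Extendable.exists_edge {p q c c' q' p' : Fin 6} (h : Extendable p q c c' q' p') :
    ∃ m, Distinct4 p q c m ∧ (m ≠ c' ∧ m ≠ q') ∧
      ∃ n, Distinct4 q c m n ∧ Distinct4 c m n c' ∧ Distinct4 m n c' q' ∧ Distinct4 n c' q' p' := by
  have key : ∀ c' q' p', Extendable 0 1 2 c' q' p' →
    ∃ m, Distinct4 0 1 2 m ∧ (m ≠ c' ∧ m ≠ q') ∧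
      ∃ n, Distinct4 1 2 m n ∧ Distinct4 2 m n c' ∧ Distinct4 m n c' q' ∧
        Distinct4 n c' q' p' := by
    decide +kernel
  obtain ⟨σ, hp, hq, hc, hσ⟩ := h.exists_normalize
  have := key _ _ _ hσ
  rw [← hp, ← hq, ← hc] at this
  obtain ⟨m, h₁, h₂, n, h₃⟩ := this
  obtain ⟨m, rfl⟩ := σ.surjective m
  obtain ⟨n, rfl⟩ := σ.surjective n
  simp only [Distinct4, σ.injective.ne_iff] at h₁ h₂ h₃
  exact ⟨m, h₁, h₂, n, h₃⟩

/-- A plain edge joining the first vertex to the next one. -/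
theorem Extendable.exists_step {p q c c' q' p' : Fin 6} (h : Extendable p q c c' q' p') :
    ∃ m, Distinct4 p q c m ∧ ∃ n, Distinct4 q c m n ∧
      ∃ d, Distinct4 c m n d ∧ Extendable m n d c' q' p' := by
  have key : ∀ c' q' p', Extendable 0 1 2 c' q' p' →
    ∃ m, Distinct4 0 1 2 m ∧ ∃ n, Distinct4 1 2 m n ∧
      ∃ d, Distinct4 2 m n d ∧ Extendable m n d c' q' p' := by
    decide +kernel
  obtain ⟨σ, hp, hq, hc, hσ⟩ := h.exists_normalize
  have := key _ _ _ hσ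
  rw [← hp, ← hq, ← hc] at this
  obtain ⟨m, h₁, n, h₂, d, h₃, h₄⟩ := this
  obtain ⟨m, rfl⟩ := σ.surjective m
  obtain ⟨n, rfl⟩ := σ.surjective n
  obtain ⟨d, rfl⟩ := σ.surjective d
  simp only [Distinct4, Extendable, σ.injective.ne_iff, σ.injective.eq_iff] at h₁ h₂ h₃ h₄
  exact ⟨m, h₁, n, h₂, d, h₃, h₄⟩

/-- A chord joining the two ends, over a single inner vertex. -/
theorem Extendable.exists_triangle {p q c c' q' p' : Fin 6} (h : Extendable p q c c' q' p') :
    ∃ m, Distinct4 p q c m ∧ (m ≠ c' ∧ m ≠ q') ∧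
      ∃ n a i, Around c q p m n a i ∧ ∃ a' i', Around c' q' p' n m a' i' ∧
      ∃ d, Distinct4 c a i d ∧ Distinct4 a i d i' ∧ Distinct4 i d i' a' ∧ Distinct4 d i' a' c' := by
  have key : ∀ c' q' p', Extendable 0 1 2 c' q' p' →
    ∃ m, Distinct4 0 1 2 m ∧ (m ≠ c' ∧ m ≠ q') ∧
      ∃ n, (n ≠ 1 ∧ n ≠ 2 ∧ n ≠ m ∧ n ≠ c' ∧ n ≠ q' ∧ n ≠ p') ∧
      ∃ a i, Around 2 1 0 m n a i ∧ ∃ a' i', Around c' q' p' n m a' i' ∧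
      ∃ d, Distinct4 2 a i d ∧ Distinct4 a i d i' ∧ Distinct4 i d i' a' ∧
        Distinct4 d i' a' c' := by
    decide +kernel
  obtain ⟨σ, hp, hq, hc, hσ⟩ := h.exists_normalize
  have := key _ _ _ hσ
  rw [← hp, ← hq, ← hc] at this
  obtain ⟨m, h₁, h₂, n, -, a, i, h₃, a', i', h₄, d, h₅⟩ := this
  obtain ⟨m, rfl⟩ := σ.surjective m
  obtain ⟨n, rfl⟩ := σ.surjective n
  obtain ⟨a, rfl⟩ := σ.surjective a
  obtain ⟨i, rfl⟩ := σ.surjective i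
  obtain ⟨a', rfl⟩ := σ.surjective a'
  obtain ⟨i', rfl⟩ := σ.surjective i'
  obtain ⟨d, rfl⟩ := σ.surjective d
  simp only [Distinct4, Around, σ.injective.ne_iff] at h₁ h₂ h₃ h₄ h₅
  exact ⟨m, h₁, h₂, n, a, i, h₃, a', i', h₄, d, h₅⟩

set_option synthInstance.maxSize 1000 in
/-- A chord joining the two ends, over at least two inner vertices. -/
theorem Extendable.exists_chord {p q c c' q' p' : Fin 6} (h : Extendable p q c c' q' p') :
    ∃ m, Distinct4 p q c m ∧ (m ≠ c' ∧ m ≠ q') ∧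
      ∃ n a i, Around c q p m n a i ∧ ∃ a' i', Around c' q' p' n m a' i' ∧
      ∃ d, Distinct4 c a i d ∧ ∃ d', Distinct4 d' i' a' c' ∧ Extendable a i d d' i' a' := by
  have key : ∀ c' q' p', Extendable 0 1 2 c' q' p' →
    ∃ m, Distinct4 0 1 2 m ∧ (m ≠ c' ∧ m ≠ q') ∧
      ∃ n, (n ≠ 1 ∧ n ≠ 2 ∧ n ≠ m ∧ n ≠ c' ∧ n ≠ q' ∧ n ≠ p') ∧
      ∃ a i, Around 2 1 0 m n a i ∧ ∃ a' i', Around c' q' p' n m a' i' ∧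
      ∃ d, Distinct4 2 a i d ∧ ∃ d', Distinct4 d' i' a' c' ∧ Extendable a i d d' i' a' := by
    decide +kernel
  obtain ⟨σ, hp, hq, hc, hσ⟩ := h.exists_normalize
  have := key _ _ _ hσ
  rw [← hp, ← hq, ← hc] at this
  obtain ⟨m, h₁, h₂, n, -, a, i, h₃, a', i', h₄, d, h₅, d', h₆, h₇⟩ := this
  obtain ⟨m, rfl⟩ := σ.surjective m
  obtain ⟨n, rfl⟩ := σ.surjective n
  obtain ⟨a, rfl⟩ := σ.surjective a
  obtain ⟨i, rfl⟩ := σ.surjective i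
  obtain ⟨a', rfl⟩ := σ.surjective a'
  obtain ⟨i', rfl⟩ := σ.surjective i'
  obtain ⟨d, rfl⟩ := σ.surjective d
  obtain ⟨d', rfl⟩ := σ.surjective d'
  simp only [Distinct4, Around, Extendable, σ.injective.ne_iff, σ.injective.eq_iff]
    at h₁ h₂ h₃ h₄ h₅ h₆ h₇
  exact ⟨m, h₁, h₂, n, a, i, h₃, a', i', h₄, d, h₅, d', h₆, h₇⟩

/-- A chord from the first vertex to the last but one. -/
theorem Extendable.exists_split_last {p q c c' q' p' : Fin 6} (h : Extendable p q c c' q' p') :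
    ∃ d m n, Extendable p q c d m n ∧
      Distinct4 d m n c' ∧ Distinct4 m n c' q' ∧ Distinct4 n c' q' p' := by
  have key : ∀ c' q' p', Extendable 0 1 2 c' q' p' → ∃ d m n, Extendable 0 1 2 d m n ∧
      Distinct4 d m n c' ∧ Distinct4 m n c' q' ∧ Distinct4 n c' q' p' := by
    decide +kernel
  obtain ⟨σ, hp, hq, hc, hσ⟩ := h.exists_normalize
  have := key _ _ _ hσ
  rw [← hp, ← hq, ← hc] at this
  obtain ⟨d, m, n, h₁, h₂⟩ := this
  obtain ⟨m, rfl⟩ := σ.surjective m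
  obtain ⟨n, rfl⟩ := σ.surjective n
  obtain ⟨d, rfl⟩ := σ.surjective d
  simp only [Distinct4, Extendable, σ.injective.ne_iff, σ.injective.eq_iff] at h₁ h₂
  exact ⟨d, m, n, h₁, h₂⟩

/-- A chord from the first vertex to an inner vertex that is not the last but one. -/
theorem Extendable.exists_split {p q c c' q' p' : Fin 6} (h : Extendable p q c c' q' p') :
    ∃ d m n, Extendable p q c d m n ∧ ∃ e, Distinct4 d m n e ∧ Extendable m n e c' q' p' := by
  have key : ∀ c' q' p', Extendable 0 1 2 c' q' p' → ∃ d m n, Extendable 0 1 2 d m n ∧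
      ∃ e, Distinct4 d m n e ∧ Extendable m n e c' q' p' := by
    decide +kernel
  obtain ⟨σ, hp, hq, hc, hσ⟩ := h.exists_normalize
  have := key _ _ _ hσ
  rw [← hp, ← hq, ← hc] at this
  obtain ⟨d, m, n, h₁, e, h₂, h₃⟩ := this
  obtain ⟨m, rfl⟩ := σ.surjective m
  obtain ⟨n, rfl⟩ := σ.surjective n
  obtain ⟨d, rfl⟩ := σ.surjective d
  obtain ⟨e, rfl⟩ := σ.surjective e
  simp only [Distinct4, Extendable, σ.injective.ne_iff, σ.injective.eq_iff] at h₁ h₂ h₃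
  exact ⟨d, m, n, h₁, e, h₂, h₃⟩

/-- The constraints of a vi-simultaneous proper coloring around a vertex `u`, where `f u u` is the
color of the vertex `u` and `f u v` is the color of the incidence of `u` on the edge `uv`. -/
structure IsProperAt {α : Type*} (R : α → α → Prop) (f : α → α → Fin 6) (u : α) : Prop where
  vertex_ne : ∀ v, R u v → f u u ≠ f v v
  vertex_ne_inc : ∀ v, R u v → f u u ≠ f u v
  inc_ne_inc : ∀ v w, R u v → R u w → v ≠ w → f u v ≠ f u w
  second_ne_vertex : ∀ v, R u v → f v u ≠ f u u
  second_ne_inc : ∀ v w, R u v → R u w → f v u ≠ f u w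

section Segment

variable {R K : ℕ → ℕ → Prop} {f g : ℕ → ℕ → Fin 6}

theorem IsProperAt.congr {u : ℕ} (h : IsProperAt R f u) (hu : g u u = f u u)
    (hR : ∀ v, R u v → g v v = f v v ∧ g u v = f u v ∧ g v u = f v u) : IsProperAt R g u where
  vertex_ne v hv := by rw [hu, (hR v hv).1]; exact h.vertex_ne v hv
  vertex_ne_inc v hv := by rw [hu, (hR v hv).2.1]; exact h.vertex_ne_inc v hv
  inc_ne_inc v w hv hw := by rw [(hR v hv).2.1, (hR w hw).2.1]; exact h.inc_ne_inc v w hv hw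
  second_ne_vertex v hv := by rw [hu, (hR v hv).2.2]; exact h.second_ne_vertex v hv
  second_ne_inc v w hv hw := by rw [(hR v hv).2.2, (hR w hw).2.1]; exact h.second_ne_inc v w hv hw

theorem isProperAt_of_three {u a b c : ℕ} (hR : ∀ v, R u v → v = a ∨ v = b ∨ v = c)
    (ha : f u u ≠ f a a) (hb : f u u ≠ f b b) (hc : f u u ≠ f c c)
    (h : Around (f u u) (f u a) (f a u) (f u b) (f b u) (f u c) (f c u)) : IsProperAt R f u := by
  obtain ⟨⟨h₁, h₂, h₃, h₄, h₅, h₆⟩, ⟨h₇, h₈, h₉, h₁₀⟩, ⟨h₁₁, h₁₂, h₁₃, h₁₄⟩,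
    h₁₅, h₁₆, h₁₇, h₁₈⟩ := h
  constructor
  · intro v hv
    rcases hR v hv with rfl | rfl | rfl <;> assumption
  · intro v hv
    rcases hR v hv with rfl | rfl | rfl <;> assumption
  · intro v w hv hw hvw
    rcases hR v hv with rfl | rfl | rfl <;> rcases hR w hw with rfl | rfl | rfl <;>
      first | assumption | exact absurd rfl hvw | (symm; assumption)
  · intro v hv
    rcases hR v hv with rfl | rfl | rfl <;> assumption
  · intro v w hv hw
    rcases hR v hv with rfl | rfl | rfl <;> rcases hR w hw with rfl | rfl | rfl <;> assumption

theorem isProperAt_of_two {u a b : ℕ} (hR : ∀ v, R u v → v = a ∨ v = b)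
    (ha : f u u ≠ f a a) (hb : f u u ≠ f b b)
    (h₁ : Distinct4 (f a u) (f u a) (f u u) (f u b))
    (h₂ : Distinct4 (f u a) (f u u) (f u b) (f b u)) : IsProperAt R f u := by
  obtain ⟨h₁, h₃, h₄, h₅, h₆, h₇⟩ := h₁
  obtain ⟨-, -, h₈, -, h₉, h₁₀⟩ := h₂
  constructor
  · intro v hv
    rcases hR v hv with rfl | rfl <;> assumption
  · intro v hv
    rcases hR v hv with rfl | rfl <;> first | assumption | (symm; assumption)
  · intro v w hv hw hvw
    rcases hR v hv with rfl | rfl <;> rcases hR w hw with rfl | rfl <;>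
      first | assumption | exact absurd rfl hvw | (symm; assumption)
  · intro v hv
    rcases hR v hv with rfl | rfl <;> first | assumption | (symm; assumption)
  · intro v w hv hw
    rcases hR v hv with rfl | rfl <;> rcases hR w hw with rfl | rfl <;>
      first | assumption | (symm; assumption)

/-- The cells `(s, t)` outside the segment from `x` to `y`: those that involve no vertex strictly
between `x` and `y` and do not lie on an edge joining `x` and `y`. -/
def OutsideCell (x y s t : ℕ) : Prop :=
  (s ≤ x ∨ y ≤ s) ∧ (t ≤ x ∨ y ≤ t) ∧ ¬ (s = x ∧ t = y) ∧ ¬ (s = y ∧ t = x)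

/-- A relation of non-crossing chords in which every vertex lies on at most one chord. -/
structure IsChordMatching (K : ℕ → ℕ → Prop) : Prop where
  symm : ∀ s t, K s t → K t s
  ne : ∀ s t, K s t → s ≠ t ∧ s + 1 ≠ t ∧ t + 1 ≠ s
  unique : ∀ s t t', K s t → K s t' → t = t'
  noncrossing : ∀ a b c d, K a b → K c d → ¬ (a < c ∧ c < b ∧ b < d)

/-- The segment from `x` to `y` is closed under chords, its inner vertices are joined only to their
predecessors, successors and chord partners, and besides such edges its end vertices have only
one outer edge each, to `l` and `r` respectively. -/
structure IsSegment (R K : ℕ → ℕ → Prop) (l x y r : ℕ) : Prop where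
  lt : x < y
  left : l < x ∨ y < l
  right : r < x ∨ y < r
  closed : ∀ s t, K s t → x ≤ s → s ≤ y → x ≤ t ∧ t ≤ y
  adj_first : ∀ t, R x t → t = l ∨ t = x + 1 ∨ K x t
  adj_last : ∀ t, R y t → t = r ∨ t + 1 = y ∨ K y t
  adj_inner : ∀ s t, x < s → s < y → R s t → t + 1 = s ∨ t = s + 1 ∨ K s t
theorem IsSegment.tail {l x y r : ℕ} (hK : IsChordMatching K) (hS : IsSegment R K l x y r)
    (hx : ∀ z, ¬ K x z) (hxy : x + 1 < y) : IsSegment R K x (x + 1) y r where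
  lt := hxy
  left := by omega
  right := by have := hS.right; omega
  closed s t hst h₁ h₂ := by
    have := hS.closed s t hst (by omega) h₂
    have : t ≠ x := by rintro rfl; exact hx s (hK.symm _ _ hst)
    omega
  adj_first t ht := by
    rcases hS.adj_inner _ t (by omega) hxy ht with h | h | h
    · exact Or.inl (by omega)
    · exact Or.inr (Or.inl h)
    · exact Or.inr (Or.inr h)
  adj_last := hS.adj_last
  adj_inner s t h₁ h₂ := hS.adj_inner s t (by omega) h₂

theorem IsSegment.inner {l x y r : ℕ} (hK : IsChordMatching K) (hS : IsSegment R K l x y r)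
    (hx : K x y) (hxy : x + 1 < y - 1) : IsSegment R K x (x + 1) (y - 1) y where
  lt := hxy
  left := by omega
  right := by omega
  closed s t hst h₁ h₂ := by
    have := hS.closed s t hst (by omega) (by omega)
    have : t ≠ x := by
      rintro rfl
      have := hK.unique _ _ _ (hK.symm _ _ hst) hx
      omega
    have : t ≠ y := by
      rintro rfl
      have := hK.unique _ _ _ (hK.symm _ _ hst) (hK.symm _ _ hx)
      omega
    omega
  adj_first t ht := by
    rcases hS.adj_inner _ t (by omega) (by omega) ht with h | h | h
    · exact Or.inl (by omega)
    · exact Or.inr (Or.inl h)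
    · exact Or.inr (Or.inr h)
  adj_last t ht := by
    rcases hS.adj_inner _ t (by omega) (by omega) ht with h | h | h
    · exact Or.inr (Or.inl h)
    · exact Or.inl (by omega)
    · exact Or.inr (Or.inr h)
  adj_inner s t h₁ h₂ := hS.adj_inner s t (by omega) (by omega)

/-- The segment under the chord `xz`. -/
theorem IsSegment.under {l x y r z : ℕ} (hK : IsChordMatching K) (hS : IsSegment R K l x y r)
    (hz : K x z) (hxz : x < z) (hzy : z < y) : IsSegment R K l x z (z + 1) where
  lt := hxz
  left := by have := hS.left; omega
  right := by omega
  closed s t hst h₁ h₂ := by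
    have := hS.closed s t hst h₁ (by omega)
    refine ⟨this.1, ?_⟩
    by_contra! hzt
    rcases h₁.lt_or_eq with h₁ | rfl
    · rcases h₂.lt_or_eq with h₂ | rfl
      · exact hK.noncrossing _ _ _ _ hz hst ⟨h₁, h₂, hzt⟩
      · have := hK.unique _ _ _ hst (hK.symm _ _ hz)
        omega
    · have := hK.unique _ _ _ hst hz
      omega
  adj_first := hS.adj_first
  adj_last t ht := by
    rcases hS.adj_inner _ t hxz hzy ht with h | h | h
    · exact Or.inr (Or.inl h)
    · exact Or.inl h
    · exact Or.inr (Or.inr h)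
  adj_inner s t h₁ h₂ := hS.adj_inner s t h₁ (by omega)

/-- No chord joins the part after the chord `xz` to the part under it. -/
theorem IsSegment.lt_of_chord {l x y r z s t : ℕ} (hK : IsChordMatching K)
    (hS : IsSegment R K l x y r) (hz : K x z) (hxz : x < z) (hzy : z < y) (hst : K s t)
    (hs : z < s) (hsy : s ≤ y) : z < t := by
  by_contra! h
  have := (hS.under hK hz hxz hzy).closed t s (hK.symm _ _ hst)
    (hS.closed s t hst (by omega) hsy).1 h
  omega

/-- The segment after the chord `xz`. -/
theorem IsSegment.after {l x y r z : ℕ} (hK : IsChordMatching K) (hS : IsSegment R K l x y r)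
    (hz : K x z) (hxz : x < z) (hzy : z + 1 < y) : IsSegment R K z (z + 1) y r where
  lt := hzy
  left := by omega
  right := by have := hS.right; omega
  closed s t hst h₁ h₂ :=
    ⟨hS.lt_of_chord hK hz hxz (by omega) hst h₁ h₂, (hS.closed s t hst (by omega) h₂).2⟩
  adj_first t ht := by
    rcases hS.adj_inner _ t (by omega) hzy ht with h | h | h
    · exact Or.inl (by omega)
    · exact Or.inr (Or.inl h)
    · exact Or.inr (Or.inr h)
  adj_last := hS.adj_last
  adj_inner s t h₁ h₂ := hS.adj_inner s t (by omega) h₂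

set_option maxHeartbeats 4000000 in
/-- A coloring given at the two ends of a segment, whose colors there are extendable, extends to the
whole segment without changing the cells outside it. -/
theorem exists_extension_segment (hK : IsChordMatching K) (l x y r : ℕ) (f : ℕ → ℕ → Fin 6)
    (hS : IsSegment R K l x y r) (hl : f l l ≠ f x x) (hr : f r r ≠ f y y)
    (hf : Extendable (f l x) (f x l) (f x x) (f y y) (f y r) (f r y)) :
    ∃ g : ℕ → ℕ → Fin 6, (∀ s t, OutsideCell x y s t → g s t = f s t) ∧
      ∀ u, x ≤ u → u ≤ y → IsProperAt R g u := by
  induction hn : y - x using Nat.strong_induction_on generalizing l x y r f with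
  | _ n ih =>
  subst hn
  have hxy := hS.lt
  have hleft := hS.left
  have hright := hS.right
  have hcc : f x x ≠ f y y := hf.2.2.1
  by_cases hch : ∃ z, K x z
  · obtain ⟨z, hz⟩ := hch
    have hxz := hK.ne x z hz
    have hzc := hS.closed x z hz le_rfl hxy.le
    have hxz' : x < z := by omega
    rcases hzc.2.lt_or_eq with hzy | rfl
    · rcases (Nat.succ_le_of_lt hzy).lt_or_eq with hlt | rfl
      · obtain ⟨d, m, n, h₁, e, h₂, h₃⟩ := hf.exists_split
        obtain ⟨f₁, e₁, e₂, e₃, e₄, e₀⟩ : ∃ f₁ : ℕ → ℕ → Fin 6, f₁ z z = d ∧ f₁ z (z + 1) = m ∧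
            f₁ (z + 1) z = n ∧ f₁ (z + 1) (z + 1) = e ∧
            ∀ s t, OutsideCell x y s t → f₁ s t = f s t := by
          refine ⟨fun s t => if s = z ∧ t = z then d else if s = z ∧ t = z + 1 then m else
            if s = z + 1 ∧ t = z then n else if s = z + 1 ∧ t = z + 1 then e else f s t,
            by simp, by simp, by simp, by simp, fun s t h => ?_⟩
          unfold OutsideCell at h
          dsimp only
          split_ifs <;> first | rfl | (exfalso; omega)
        obtain ⟨g₁, hg₁, hp₁⟩ := ih (z - x) (by omega) l x z (z + 1) f₁
          (hS.under hK hz hxz' hzy)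
          (by rw [e₀ l l (by unfold OutsideCell; omega), e₀ x x (by unfold OutsideCell; omega)]
              exact hl)
          (by rw [e₁, e₄]; exact h₂.2.2.1.symm)
          (by rw [e₁, e₂, e₃, e₀ l x (by unfold OutsideCell; omega),
                e₀ x l (by unfold OutsideCell; omega), e₀ x x (by unfold OutsideCell; omega)]
              exact h₁) rfl
        have g₁_eq (s t : ℕ) (hs : s < x ∨ y ≤ s) (ht : t < x ∨ y ≤ t) : g₁ s t = f s t := by
          rw [hg₁ s t (by unfold OutsideCell; omega), e₀ s t (by unfold OutsideCell; omega)]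
        obtain ⟨g₂, hg₂, hp₂⟩ := ih (y - (z + 1)) (by omega) z (z + 1) y r g₁
          (hS.after hK hz hxz' hlt)
          (by rw [hg₁ z z (by unfold OutsideCell; omega),
                hg₁ (z + 1) (z + 1) (by unfold OutsideCell; omega), e₁, e₄]
              exact h₂.2.2.1)
          (by rw [g₁_eq r r (by omega) (by omega), g₁_eq y y (by omega) (by omega)]
              exact hr)
          (by rw [hg₁ z (z + 1) (by unfold OutsideCell; omega),
                hg₁ (z + 1) z (by unfold OutsideCell; omega),
                hg₁ (z + 1) (z + 1) (by unfold OutsideCell; omega), e₂, e₃, e₄,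
                g₁_eq y y (by omega) (by omega), g₁_eq y r (by omega) (by omega),
                g₁_eq r y (by omega) (by omega)]
              exact h₃) rfl
        refine ⟨g₂, fun s t h => ?_, fun u hu hu' => ?_⟩
        · unfold OutsideCell at h
          rw [hg₂ s t (by unfold OutsideCell; omega), hg₁ s t (by unfold OutsideCell; omega),
            e₀ s t h]
        · rcases le_or_gt u z with huz | huz
          · refine (hp₁ u hu huz).congr (hg₂ u u (by unfold OutsideCell; omega)) fun v hv => ?_
            have hv' : v ≤ z + 1 ∨ y < v := by
              have hU := hS.under hK hz hxz' hzy
              rcases hu.lt_or_eq with hu | rfl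
              · rcases huz.lt_or_eq with huz | rfl
                · rcases hU.adj_inner u v hu huz hv with h | h | h
                  · omega
                  · omega
                  · have := hU.closed u v h hu.le huz.le
                    omega
                · rcases hU.adj_last v hv with h | h | h
                  · omega
                  · omega
                  · have := hU.closed u v h hu.le le_rfl
                    omega
              · rcases hU.adj_first v hv with h | h | h
                · omega
                · omega
                · have := hU.closed x v h le_rfl huz
                  omega
            exact ⟨hg₂ v v (by unfold OutsideCell; omega), hg₂ u v (by unfold OutsideCell; omega),
              hg₂ v u (by unfold OutsideCell; omega)⟩
          · exact hp₂ u huz hu'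
      · obtain ⟨d, m, n, h₁, h₂, h₃, h₄⟩ := hf.exists_split_last
        obtain ⟨f₁, e₁, e₂, e₃, e₀⟩ : ∃ f₁ : ℕ → ℕ → Fin 6, f₁ z z = d ∧ f₁ z (z + 1) = m ∧
            f₁ (z + 1) z = n ∧ ∀ s t, OutsideCell x (z + 1) s t → f₁ s t = f s t := by
          refine ⟨fun s t => if s = z ∧ t = z then d else if s = z ∧ t = z + 1 then m else
            if s = z + 1 ∧ t = z then n else f s t,
            by simp, by simp, by simp, fun s t h => ?_⟩
          unfold OutsideCell at h
          dsimp only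
          split_ifs <;> first | rfl | (exfalso; omega)
        obtain ⟨g, hg, hp⟩ := ih (z - x) (by omega) l x z (z + 1) f₁
          (hS.under hK hz hxz' hzy)
          (by rw [e₀ l l (by unfold OutsideCell; omega), e₀ x x (by unfold OutsideCell; omega)]
              exact hl)
          (by rw [e₁, e₀ (z + 1) (z + 1) (by unfold OutsideCell; omega)]; exact h₂.2.2.1.symm)
          (by rw [e₁, e₂, e₃, e₀ l x (by unfold OutsideCell; omega),
                e₀ x l (by unfold OutsideCell; omega), e₀ x x (by unfold OutsideCell; omega)]
              exact h₁) rfl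
        have g_eq (s t : ℕ) (h : OutsideCell x (z + 1) s t) : g s t = f s t := by
          rw [← e₀ s t h]
          unfold OutsideCell at h
          exact hg s t (by unfold OutsideCell; omega)
        have g₁ : g z z = d := by rw [hg z z (by unfold OutsideCell; omega), e₁]
        have g₂ : g z (z + 1) = m := by rw [hg z (z + 1) (by unfold OutsideCell; omega), e₂]
        have g₃ : g (z + 1) z = n := by rw [hg (z + 1) z (by unfold OutsideCell; omega), e₃]
        have g₄ := g_eq (z + 1) (z + 1) (by unfold OutsideCell; omega)
        have g₅ := g_eq (z + 1) r (by unfold OutsideCell; omega)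
        have g₆ := g_eq r (z + 1) (by unfold OutsideCell; omega)
        have g₇ := g_eq r r (by unfold OutsideCell; omega)
        refine ⟨g, g_eq, fun u hu hu' => ?_⟩
        rcases hu'.lt_or_eq with hlt | rfl
        · exact hp u hu (by omega)
        · have hlast : ∀ t, R (z + 1) t → t = z ∨ t = r := by
            intro t ht
            rcases hS.adj_last t ht with h | h | h
            · exact Or.inr h
            · exact Or.inl (by omega)
            · have := hS.lt_of_chord hK hz hxz' hzy h (by omega) le_rfl
              have := hS.closed _ _ h hu le_rfl
              have := (hK.ne _ _ h).1
              omega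
          apply isProperAt_of_two hlast
          · rw [g₄, g₁]; exact h₂.2.2.1.symm
          · rw [g₄, g₇]; exact hr.symm
          · rw [g₂, g₃, g₄, g₅]; exact h₃
          · rw [g₃, g₄, g₅, g₆]; exact h₄
    · have hfirst : ∀ t, R x t → t = l ∨ t = z ∨ t = x + 1 := by
        intro t ht
        rcases hS.adj_first t ht with h | h | h
        · exact Or.inl h
        · exact Or.inr (Or.inr h)
        · exact Or.inr (Or.inl (hK.unique _ _ _ h hz))
      have hlast : ∀ t, R z t → t = r ∨ t = x ∨ t = z - 1 := by
        intro t ht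
        rcases hS.adj_last t ht with h | h | h
        · exact Or.inl h
        · exact Or.inr (Or.inr (by omega))
        · exact Or.inr (Or.inl (hK.unique _ _ _ h (hK.symm _ _ hz)))
      have hinner : x + 2 ≤ z := by omega
      rcases hinner.lt_or_eq with hlt | rfl
      · obtain ⟨m, -, -, n, a, i, h₁, a', i', h₂, d, h₃, d', h₄, h₅⟩ := hf.exists_chord
        obtain ⟨f₁, e₁, e₂, e₃, e₄, e₅, e₆, e₇, e₈, e₀⟩ : ∃ f₁ : ℕ → ℕ → Fin 6,
            f₁ x z = m ∧ f₁ z x = n ∧ f₁ x (x + 1) = a ∧ f₁ (x + 1) x = i ∧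
            f₁ (x + 1) (x + 1) = d ∧ f₁ z (z - 1) = a' ∧ f₁ (z - 1) z = i' ∧
            f₁ (z - 1) (z - 1) = d' ∧ ∀ s t, OutsideCell x z s t → f₁ s t = f s t := by
          refine ⟨fun s t => if s = x ∧ t = z then m else if s = z ∧ t = x then n else
            if s = x ∧ t = x + 1 then a else if s = x + 1 ∧ t = x then i else
            if s = x + 1 ∧ t = x + 1 then d else if s = z ∧ t = z - 1 then a' else
            if s = z - 1 ∧ t = z then i' else if s = z - 1 ∧ t = z - 1 then d' else f s t,
            ?_, ?_, ?_, ?_, ?_, ?_, ?_, ?_, fun s t h => ?_⟩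
          any_goals unfold OutsideCell at h
          all_goals dsimp only
          all_goals split_ifs <;> first | rfl | (exfalso; omega)
        obtain ⟨g, hg, hp⟩ := ih (z - 1 - (x + 1)) (by omega) x (x + 1) (z - 1) z f₁
          (hS.inner hK hz (by omega))
          (by rw [e₅, e₀ x x (by unfold OutsideCell; omega)]; exact h₃.2.2.1)
          (by rw [e₈, e₀ z z (by unfold OutsideCell; omega)]; exact h₄.2.2.1.symm)
          (by rw [e₃, e₄, e₅, e₆, e₇, e₈]; exact h₅) rfl
        have g_eq (s t : ℕ) (h : OutsideCell x z s t) : g s t = f s t := by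
          rw [← e₀ s t h]
          unfold OutsideCell at h
          exact hg s t (by unfold OutsideCell; omega)
        have g₁ := (hg x z (by unfold OutsideCell; omega)).trans e₁
        have g₂ := (hg z x (by unfold OutsideCell; omega)).trans e₂
        have g₃ := (hg x (x + 1) (by unfold OutsideCell; omega)).trans e₃
        have g₄ := (hg (x + 1) x (by unfold OutsideCell; omega)).trans e₄
        have g₅ := (hg (x + 1) (x + 1) (by unfold OutsideCell; omega)).trans e₅
        have g₆ := (hg z (z - 1) (by unfold OutsideCell; omega)).trans e₆
        have g₇ := (hg (z - 1) z (by unfold OutsideCell; omega)).trans e₇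
        have g₈ := (hg (z - 1) (z - 1) (by unfold OutsideCell; omega)).trans e₈
        have b₁ := g_eq x x (by unfold OutsideCell; omega)
        have b₂ := g_eq z z (by unfold OutsideCell; omega)
        refine ⟨g, g_eq, fun u hu hu' => ?_⟩
        rcases hu.lt_or_eq with hu | rfl
        · rcases hu'.lt_or_eq with hu' | rfl
          · exact hp u (by omega) (by omega)
          · apply isProperAt_of_three hlast
            · rw [b₂, g_eq r r (by unfold OutsideCell; omega)]; exact hr.symm
            · rw [b₁, b₂]; exact hcc.symm
            · rw [b₂, g₈]; exact h₄.2.2.1.symm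
            · rw [b₂, g₁, g₂, g₆, g₇, g_eq u r (by unfold OutsideCell; omega),
                g_eq r u (by unfold OutsideCell; omega)]
              exact h₂
        · apply isProperAt_of_three hfirst
          · rw [b₁, g_eq l l (by unfold OutsideCell; omega)]; exact hl.symm
          · rw [b₁, b₂]; exact hcc
          · rw [b₁, g₅]; exact h₃.2.2.1
          · rw [b₁, g₁, g₂, g₃, g₄, g_eq x l (by unfold OutsideCell; omega),
              g_eq l x (by unfold OutsideCell; omega)]
            exact h₁
      · obtain ⟨m, -, -, n, a, i, h₁, a', i', h₂, d, h₃, h₄, h₅, h₆⟩ :=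
          hf.exists_triangle
        obtain ⟨g, g₁, g₂, g₃, g₄, g₅, g₆, g₇, g_eq⟩ : ∃ f₁ : ℕ → ℕ → Fin 6,
            f₁ x (x + 2) = m ∧ f₁ (x + 2) x = n ∧ f₁ x (x + 1) = a ∧ f₁ (x + 1) x = i ∧
            f₁ (x + 1) (x + 1) = d ∧ f₁ (x + 2) (x + 1) = a' ∧ f₁ (x + 1) (x + 2) = i' ∧
            ∀ s t, OutsideCell x (x + 2) s t → f₁ s t = f s t := by
          refine ⟨fun s t => if s = x ∧ t = x + 2 then m else if s = x + 2 ∧ t = x then n else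
            if s = x ∧ t = x + 1 then a else if s = x + 1 ∧ t = x then i else
            if s = x + 1 ∧ t = x + 1 then d else if s = x + 2 ∧ t = x + 1 then a' else
            if s = x + 1 ∧ t = x + 2 then i' else f s t,
            ?_, ?_, ?_, ?_, ?_, ?_, ?_, fun s t h => ?_⟩
          any_goals unfold OutsideCell at h
          all_goals dsimp only
          all_goals split_ifs <;> first | rfl | (exfalso; omega)
        have b₁ := g_eq x x (by unfold OutsideCell; omega)
        have b₂ := g_eq (x + 2) (x + 2) (by unfold OutsideCell; omega)
        have hmid : ∀ t, R (x + 1) t → t = x ∨ t = x + 2 := by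
          intro t ht
          rcases hS.adj_inner _ t (by omega) (by omega) ht with h | h | h
          · omega
          · omega
          · have := hS.closed _ _ h (by omega) (by omega)
            have := hK.ne _ _ h
            omega
        refine ⟨g, g_eq, fun u hu hu' => ?_⟩
        obtain rfl | rfl | rfl : u = x ∨ u = x + 1 ∨ u = x + 2 := by omega
        · apply isProperAt_of_three hfirst
          · rw [b₁, g_eq l l (by unfold OutsideCell; omega)]; exact hl.symm
          · rw [b₁, b₂]; exact hcc
          · rw [b₁, g₅]; exact h₃.2.2.1
          · rw [b₁, g₁, g₂, g₃, g₄, g_eq u l (by unfold OutsideCell; omega),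
              g_eq l u (by unfold OutsideCell; omega)]
            exact h₁
        · apply isProperAt_of_two hmid
          · rw [b₁, g₅]; exact h₃.2.2.1.symm
          · rw [b₂, g₅]; exact h₆.2.2.1
          · rw [g₃, g₄, g₅, g₇]; exact h₄
          · rw [g₄, g₅, g₆, g₇]; exact h₅
        · apply isProperAt_of_three hlast
          · rw [b₂, g_eq r r (by unfold OutsideCell; omega)]; exact hr.symm
          · rw [b₁, b₂]; exact hcc.symm
          · rw [b₂, show x + 2 - 1 = x + 1 from rfl, g₅]; exact h₆.2.2.1.symm
          · rw [show x + 2 - 1 = x + 1 from rfl, b₂, g₁, g₂, g₆, g₇,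
              g_eq (x + 2) r (by unfold OutsideCell; omega),
              g_eq r (x + 2) (by unfold OutsideCell; omega)]
            exact h₂
  · have hfirst : ∀ t, R x t → t = l ∨ t = x + 1 := by
      intro t ht
      rcases hS.adj_first t ht with h | h | h
      · exact Or.inl h
      · exact Or.inr h
      · exact absurd ⟨t, h⟩ hch
    rcases (Nat.succ_le_of_lt hxy).lt_or_eq with hlt | rfl
    · obtain ⟨m, h₁, n, h₂, d, h₃, h₄⟩ := hf.exists_step
      obtain ⟨f₁, e₁, e₂, e₃, e₀⟩ : ∃ f₁ : ℕ → ℕ → Fin 6, f₁ x (x + 1) = m ∧ f₁ (x + 1) x = n ∧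
          f₁ (x + 1) (x + 1) = d ∧ ∀ s t, OutsideCell x y s t → f₁ s t = f s t := by
        refine ⟨fun s t => if s = x ∧ t = x + 1 then m else if s = x + 1 ∧ t = x then n else
          if s = x + 1 ∧ t = x + 1 then d else f s t, by simp, by simp, by simp, fun s t h => ?_⟩
        unfold OutsideCell at h
        dsimp only
        split_ifs <;> first | rfl | (exfalso; omega)
      obtain ⟨g, hg, hp⟩ := ih (y - (x + 1)) (by omega) x (x + 1) y r f₁
        (hS.tail hK (fun z hz => hch ⟨z, hz⟩) hlt)
        (by rw [e₃, e₀ x x (by unfold OutsideCell; omega)]; exact h₃.2.2.1)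
        (by rw [e₀ r r (by unfold OutsideCell; omega), e₀ y y (by unfold OutsideCell; omega)]
            exact hr)
        (by rw [e₁, e₂, e₃, e₀ y y (by unfold OutsideCell; omega),
              e₀ y r (by unfold OutsideCell; omega), e₀ r y (by unfold OutsideCell; omega)]
            exact h₄) rfl
      have g_eq (s t : ℕ) (h : OutsideCell x y s t) : g s t = f s t := by
        rw [← e₀ s t h]
        unfold OutsideCell at h
        exact hg s t (by unfold OutsideCell; omega)
      have g₁ := (hg x (x + 1) (by unfold OutsideCell; omega)).trans e₁
      have g₂ := (hg (x + 1) x (by unfold OutsideCell; omega)).trans e₂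
      have g₃ := (hg (x + 1) (x + 1) (by unfold OutsideCell; omega)).trans e₃
      have g₄ := g_eq x x (by unfold OutsideCell; omega)
      have g₅ := g_eq x l (by unfold OutsideCell; omega)
      refine ⟨g, g_eq, fun u hu hu' => ?_⟩
      rcases hu.lt_or_eq with h | rfl
      · exact hp u h hu'
      · apply isProperAt_of_two hfirst
        · rw [g₄, g_eq l l (by unfold OutsideCell; omega)]; exact hl.symm
        · rw [g₃, g₄]; exact h₃.2.2.1
        · rw [g₁, g₄, g₅, g_eq l x (by unfold OutsideCell; omega)]; exact h₁
        · rw [g₁, g₂, g₄, g₅]; exact h₂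
    · obtain ⟨m, h₁, -, n, h₂, h₃, h₄, h₅⟩ := hf.exists_edge
      obtain ⟨g, g₁, g₂, g_eq⟩ : ∃ f₁ : ℕ → ℕ → Fin 6, f₁ x (x + 1) = m ∧ f₁ (x + 1) x = n ∧
          ∀ s t, OutsideCell x (x + 1) s t → f₁ s t = f s t := by
        refine ⟨fun s t => if s = x ∧ t = x + 1 then m else if s = x + 1 ∧ t = x then n else f s t,
          by simp, by simp, fun s t h => ?_⟩
        unfold OutsideCell at h
        dsimp only
        split_ifs <;> first | rfl | (exfalso; omega)
      have b₁ := g_eq x x (by unfold OutsideCell; omega)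
      have b₂ := g_eq (x + 1) (x + 1) (by unfold OutsideCell; omega)
      have hlast : ∀ t, R (x + 1) t → t = x ∨ t = r := by
        intro t ht
        rcases hS.adj_last t ht with h | h | h
        · exact Or.inr h
        · exact Or.inl (by omega)
        · have := hS.closed _ _ h (by omega) (by omega)
          have := hK.ne _ _ h
          omega
      refine ⟨g, g_eq, fun u hu hu' => ?_⟩
      obtain rfl | rfl : u = x ∨ u = x + 1 := by omega
      · apply isProperAt_of_two hfirst
        · rw [b₁, g_eq l l (by unfold OutsideCell; omega)]; exact hl.symm
        · rw [b₁, b₂]; exact hcc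
        · rw [b₁, g₁, g_eq l u (by unfold OutsideCell; omega),
            g_eq u l (by unfold OutsideCell; omega)]
          exact h₁
        · rw [b₁, g₁, g₂, g_eq u l (by unfold OutsideCell; omega)]; exact h₂
      · apply isProperAt_of_two hlast
        · rw [b₁, b₂]; exact hcc.symm
        · rw [b₂, g_eq r r (by unfold OutsideCell; omega)]; exact hr.symm
        · rw [b₂, g₁, g₂, g_eq (x + 1) r (by unfold OutsideCell; omega)]; exact h₄
        · rw [b₂, g₂, g_eq (x + 1) r (by unfold OutsideCell; omega),
            g_eq r (x + 1) (by unfold OutsideCell; omega)]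
          exact h₅

end Segment

theorem IsProperAt.comap {α β : Type*} {R : α → α → Prop} {B : β → β → Prop} {f : α → α → Fin 6}
    {g : β → β → Fin 6} {a : α} {u : β} (h : IsProperAt R f a) (φ : β → α)
    (hφ : ∀ v w, B u v → B u w → φ v = φ w → v = w) (hu : g u u = f a a)
    (hB : ∀ v, B u v → R a (φ v) ∧ g v v = f (φ v) (φ v) ∧ g u v = f a (φ v) ∧
      g v u = f (φ v) a) : IsProperAt B g u where
  vertex_ne v hv := by rw [hu, (hB v hv).2.1]; exact h.vertex_ne _ (hB v hv).1
  vertex_ne_inc v hv := by rw [hu, (hB v hv).2.2.1]; exact h.vertex_ne_inc _ (hB v hv).1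
  inc_ne_inc v w hv hw hvw := by
    rw [(hB v hv).2.2.1, (hB w hw).2.2.1]
    exact h.inc_ne_inc _ _ (hB v hv).1 (hB w hw).1 fun e => hvw (hφ v w hv hw e)
  second_ne_vertex v hv := by rw [hu, (hB v hv).2.2.2]; exact h.second_ne_vertex _ (hB v hv).1
  second_ne_inc v w hv hw := by
    rw [(hB v hv).2.2.2, (hB w hw).2.2.1]
    exact h.second_ne_inc _ _ (hB v hv).1 (hB w hw).1

/-- `B` is the adjacency relation of a 2-connected graph of maximum degree at most 3 on the
vertices `0, …, n - 1`, drawn on a circle in this order without crossing edges. -/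
structure IsCircularDrawing (n : ℕ) (B : ℕ → ℕ → Prop) : Prop where
  three_le : 3 ≤ n
  symm : ∀ s t, B s t → B t s
  ne : ∀ s t, B s t → s ≠ t
  lt : ∀ s t, B s t → s < n
  noncrossing : ∀ a b c d, B a b → B c d → ¬ (a < c ∧ c < b ∧ b < d)
  degree_le : ∀ u a b c d, B u a → B u b → B u c → B u d →
    a = b ∨ a = c ∨ a = d ∨ b = c ∨ b = d ∨ c = d
  cut : ∀ m s t, ∀ S : ℕ → Prop, m < n → s < n → t < n → s ≠ m → t ≠ m → S s → ¬ S t →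
    ∃ a b, a ≠ m ∧ b ≠ m ∧ S a ∧ ¬ S b ∧ B a b

theorem exists_greatest_of_lt {P : ℕ → Prop} {n : ℕ} (h : ∃ m, P m) (hn : ∀ m, P m → m < n) :
    ∃ m, P m ∧ ∀ k, P k → k ≤ m := by
  have hb : BddAbove {m | P m} := ⟨n, fun m hm => (hn m hm).le⟩
  exact ⟨sSup {m | P m}, Nat.sSup_mem h hb, fun k hk => le_csSup hb hk⟩

namespace IsCircularDrawing

variable {n : ℕ} {B : ℕ → ℕ → Prop}

theorem eq_zero_of_forall_le (h : IsCircularDrawing n B) {j : ℕ} (hj : j < n)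
    (hs : ∀ t, B j t → j ≤ t) : j = 0 ∧ B 0 (n - 1) := by
  have hn := h.three_le
  obtain ⟨m, hm, hmax⟩ : ∃ m, B j m ∧ ∀ k, B j k → k ≤ m := by
    apply exists_greatest_of_lt (n := n) _ fun m hm => h.lt _ _ (h.symm _ _ hm)
    obtain ⟨t, m, ht, hm, htj, hmj, htm⟩ :
        ∃ t m, t < n ∧ m < n ∧ t ≠ j ∧ m ≠ j ∧ t ≠ m := by
      rcases j with _ | _ | j
      · exact ⟨1, 2, by omega, by omega, by omega, by omega, by omega⟩
      · exact ⟨0, 2, by omega, by omega, by omega, by omega, by omega⟩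
      · exact ⟨0, 1, by omega, by omega, by omega, by omega, by omega⟩
    obtain ⟨a, b, -, -, rfl, -, hab⟩ :=
      h.cut m j t (fun a => a = j) hm hj ht hmj.symm htm rfl htj
    exact ⟨b, hab⟩
  have hmn := h.lt _ _ (h.symm _ _ hm)
  have hjm := hs m hm
  have hne := h.ne _ _ hm
  have key : ∀ t < n, j ≤ t ∧ t ≤ m := by
    by_contra! hc
    obtain ⟨t, ht, htm⟩ := hc
    obtain ⟨a, b, -, hb, ha, hbS, hab⟩ := h.cut m j t (fun a => j ≤ a ∧ a < m) hmn hj ht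
      (by omega) (by omega) ⟨le_rfl, by omega⟩ (by omega)
    rcases ha.1.lt_or_eq with hja | rfl
    · have h₁ := h.noncrossing _ _ _ _ hm hab
      have h₂ := h.noncrossing _ _ _ _ (h.symm _ _ hab) hm
      omega
    · have h₁ := hs b hab
      have h₂ := hmax b hab
      omega
  have h₀ := key 0 (by omega)
  have h₁ := key (n - 1) (by omega)
  obtain rfl : j = 0 := by omega
  obtain rfl : m = n - 1 := by omega
  exact ⟨rfl, hm⟩

theorem adj_zero_last (h : IsCircularDrawing n B) : B 0 (n - 1) :=
  have := h.three_le
  (h.eq_zero_of_forall_le (by omega : 0 < n) fun _ _ => Nat.zero_le _).2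

theorem adj_succ (h : IsCircularDrawing n B) {i : ℕ} (hi : i + 1 < n) : B i (i + 1) := by
  obtain ⟨m, ⟨hm, hmi⟩, hmax⟩ : ∃ m, (B (i + 1) m ∧ m < i + 1) ∧
      ∀ k, B (i + 1) k ∧ k < i + 1 → k ≤ m := by
    apply exists_greatest_of_lt (n := i + 1) _ fun m hm => hm.2
    by_contra! hc
    have := (h.eq_zero_of_forall_le hi hc).1
    omega
  rcases (Nat.le_of_lt_succ hmi).lt_or_eq with hlt | rfl
  · obtain ⟨a, b, -, hb, ha, hbS, hab⟩ := h.cut m i (i + 1) (fun a => m < a ∧ a ≤ i)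
      (by omega) (by omega) (by omega) (by omega) (by omega) ⟨hlt, le_rfl⟩ (by omega)
    have h₁ := h.noncrossing _ _ _ _ (h.symm _ _ hm) hab
    have h₂ := h.noncrossing _ _ _ _ (h.symm _ _ hab) (h.symm _ _ hm)
    obtain rfl : b = i + 1 := by omega
    have := hmax a ⟨h.symm _ _ hab, by omega⟩
    omega
  · exact h.symm _ _ hm

/-- The edges of a drawing that are not sides of the outer cycle. -/
def Chord (n : ℕ) (B : ℕ → ℕ → Prop) (s t : ℕ) : Prop :=
  B s t ∧ s + 1 ≠ t ∧ t + 1 ≠ s ∧ ¬ (s = 0 ∧ t = n - 1) ∧ ¬ (s = n - 1 ∧ t = 0)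

theorem isChordMatching (h : IsCircularDrawing n B) : IsChordMatching (Chord n B) where
  symm := by
    rintro s t ⟨h₁, h₂⟩
    exact ⟨h.symm _ _ h₁, by omega⟩
  ne := by
    rintro s t ⟨h₁, h₂, h₃, -⟩
    exact ⟨h.ne _ _ h₁, h₂, h₃⟩
  unique := by
    rintro s t t' ⟨h₁, h₂⟩ ⟨h₁', h₂'⟩
    have hn := h.three_le
    have hs := h.lt _ _ h₁
    have hlast := h.adj_zero_last
    rcases s with _ | s
    · have := h.degree_le _ _ _ _ _ hlast (h.adj_succ (i := 0) (by omega)) h₁ h₁'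
      omega
    · have hpred := h.symm _ _ (h.adj_succ hs)
      by_cases hsn : s + 1 = n - 1
      · rw [← hsn] at hlast
        have := h.degree_le _ _ _ _ _ hpred (h.symm _ _ hlast) h₁ h₁'
        omega
      · have := h.degree_le _ _ _ _ _ hpred (h.adj_succ (i := s + 1) (by omega)) h₁ h₁'
        omega
  noncrossing a b c d hab hcd := h.noncrossing a b c d hab.1 hcd.1

/-- The graph of a drawing with its edge from `0` to `n - 1` replaced by pendant edges from `0` to
`n` and from `n - 1` to `n + 1`. -/
def Opened (n : ℕ) (B : ℕ → ℕ → Prop) (s t : ℕ) : Prop :=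
  (s < n ∧ t < n ∧ (t = s + 1 ∨ s = t + 1 ∨ Chord n B s t)) ∨ (s = 0 ∧ t = n) ∨
    (s = n - 1 ∧ t = n + 1)

theorem isSegment_opened (h : IsCircularDrawing n B) :
    IsSegment (Opened n B) (Chord n B) n 0 (n - 1) (n + 1) where
  lt := by have := h.three_le; omega
  left := by have := h.three_le; omega
  right := by omega
  closed s t hst _ _ := by
    have := h.lt _ _ (h.symm _ _ hst.1)
    omega
  adj_first t ht := by
    have := h.three_le
    rcases ht with ⟨-, -, h | h | h⟩ | h | h
    · omega
    · omega
    · exact Or.inr (Or.inr h)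
    · omega
    · omega
  adj_last t ht := by
    have := h.three_le
    rcases ht with ⟨-, hlt, h | h | h⟩ | h | h
    · omega
    · exact Or.inr (Or.inl h.symm)
    · exact Or.inr (Or.inr h)
    · omega
    · exact Or.inl h.2
  adj_inner s t _ _ ht := by
    rcases ht with ⟨-, -, h | h | h⟩ | h | h
    · omega
    · omega
    · exact Or.inr (Or.inr h)
    · omega
    · omega

theorem opened_of_adj (h : IsCircularDrawing n B) {s t : ℕ} (hst : B s t)
    (h₁ : ¬ (s = 0 ∧ t = n - 1)) (h₂ : ¬ (s = n - 1 ∧ t = 0)) : Opened n B s t := by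
  refine Or.inl ⟨h.lt _ _ hst, h.lt _ _ (h.symm _ _ hst), ?_⟩
  by_cases h₃ : t = s + 1
  · exact Or.inl h₃
  · by_cases h₄ : s = t + 1
    · exact Or.inr (Or.inl h₄)
    · exact Or.inr (Or.inr ⟨hst, by omega, by omega, h₁, h₂⟩)

theorem exists_isProperAt (h : IsCircularDrawing n B) :
    ∃ g : ℕ → ℕ → Fin 6, ∀ u < n, IsProperAt B g u := by
  have hn := h.three_le
  obtain ⟨f, f₁, f₂, f₃, f₄, f₅, f₆, f₇, f₈⟩ : ∃ f : ℕ → ℕ → Fin 6,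
      f n 0 = 0 ∧ f 0 n = 1 ∧ f 0 0 = 2 ∧ f (n - 1) (n - 1) = 3 ∧ f (n - 1) (n + 1) = 0 ∧
      f (n + 1) (n - 1) = 1 ∧ f n n = 3 ∧ f (n + 1) (n + 1) = 2 := by
    refine ⟨fun s t => if s = t then if s = 0 ∨ s = n + 1 then 2 else 3 else
      if s = n ∨ t = n + 1 then 0 else 1, ?_, ?_, ?_, ?_, ?_, ?_, ?_, ?_⟩
    all_goals dsimp only
    all_goals split_ifs <;> first | rfl | omega
  obtain ⟨g, hg, hp⟩ := exists_extension_segment h.isChordMatching n 0 (n - 1) (n + 1) f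
    h.isSegment_opened (by rw [f₃, f₇]; decide) (by rw [f₄, f₈]; decide)
    (by rw [f₁, f₂, f₃, f₄, f₅, f₆]; unfold Extendable; decide)
  have g₁ := (hg n 0 (by unfold OutsideCell; omega)).trans f₁
  have g₂ := (hg 0 n (by unfold OutsideCell; omega)).trans f₂
  have g₃ := (hg 0 0 (by unfold OutsideCell; omega)).trans f₃
  have g₄ := (hg (n - 1) (n - 1) (by unfold OutsideCell; omega)).trans f₄
  have g₅ := (hg (n - 1) (n + 1) (by unfold OutsideCell; omega)).trans f₅
  have g₆ := (hg (n + 1) (n - 1) (by unfold OutsideCell; omega)).trans f₆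
  have g₇ := (hg n n (by unfold OutsideCell; omega)).trans f₇
  have g₈ := (hg (n + 1) (n + 1) (by unfold OutsideCell; omega)).trans f₈
  obtain ⟨c, c₁, c₂, hc⟩ : ∃ c : ℕ → ℕ → Fin 6, c 0 (n - 1) = 1 ∧ c (n - 1) 0 = 0 ∧
      ∀ s t, ¬ (s = 0 ∧ t = n - 1) → ¬ (s = n - 1 ∧ t = 0) → c s t = g s t := by
    refine ⟨fun s t => if s = 0 ∧ t = n - 1 then 1 else if s = n - 1 ∧ t = 0 then 0 else g s t,
      ?_, ?_, fun s t h₁ h₂ => ?_⟩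
    all_goals dsimp only
    all_goals split_ifs <;> first | rfl | omega
  refine ⟨c, fun u hu => ?_⟩
  have hcu := hc u u (by omega) (by omega)
  by_cases hu₀ : u = 0
  · subst hu₀
    refine (hp 0 le_rfl (by omega)).comap (fun v => if v = n - 1 then n else v) ?_ hcu ?_
    · intro v w hv hw hvw
      have := h.lt _ _ (h.symm _ _ hv)
      have := h.lt _ _ (h.symm _ _ hw)
      split_ifs at hvw <;> omega
    · intro v hv
      split_ifs with hvn
      · subst hvn
        refine ⟨Or.inr (Or.inl ⟨rfl, rfl⟩), ?_, ?_, ?_⟩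
        · rw [hc _ _ (by omega) (by omega), g₄, g₇]
        · rw [c₁, g₂]
        · rw [c₂, g₁]
      · exact ⟨h.opened_of_adj hv (by omega) (by omega), hc _ _ (by omega) (by omega),
          hc _ _ (by omega) (by omega), hc _ _ (by omega) (by omega)⟩
  · by_cases hun : u = n - 1
    · subst hun
      refine (hp (n - 1) (by omega) le_rfl).comap (fun v => if v = 0 then n + 1 else v) ?_ hcu ?_
      · intro v w hv hw hvw
        have := h.lt _ _ (h.symm _ _ hv)
        have := h.lt _ _ (h.symm _ _ hw)
        split_ifs at hvw <;> omega
      · intro v hv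
        split_ifs with hvn
        · subst hvn
          refine ⟨Or.inr (Or.inr ⟨rfl, rfl⟩), ?_, ?_, ?_⟩
          · rw [hc _ _ (by omega) (by omega), g₃, g₈]
          · rw [c₂, g₅]
          · rw [c₁, g₆]
        · exact ⟨h.opened_of_adj hv (by omega) (by omega), hc _ _ (by omega) (by omega),
            hc _ _ (by omega) (by omega), hc _ _ (by omega) (by omega)⟩
    · refine (hp u (by omega) (by omega)).comap id (fun _ _ _ _ e => e) hcu fun v hv => ?_
      exact ⟨h.opened_of_adj hv (by omega) (by omega), hc _ _ (by omega) (by omega),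
        hc _ _ (by omega) (by omega), hc _ _ (by omega) (by omega)⟩

end IsCircularDrawing

section Transport

variable [Fintype V] {G : SimpleGraph V}

theorem ncard_neighborSet_le_maxDeg (u : V) : (G.neighborSet u).ncard ≤ G.maxDeg :=
  Finset.le_sup (f := fun v => (G.neighborSet v).ncard) (Finset.mem_univ u)

theorem eq_of_adj_of_maxDeg_le (hΔ : G.maxDeg ≤ 3) {u a b c d : V} (ha : G.Adj u a)
    (hb : G.Adj u b) (hc : G.Adj u c) (hd : G.Adj u d) :
    a = b ∨ a = c ∨ a = d ∨ b = c ∨ b = d ∨ c = d := by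
  classical
  by_contra! h
  obtain ⟨h₁, h₂, h₃, h₄, h₅, h₆⟩ := h
  have hcard : (({a, b, c, d} : Finset V) : Set V).ncard = 4 := by
    rw [Set.ncard_coe_finset]
    simp [h₁, h₂, h₃, h₄, h₅, h₆]
  have hsub : (({a, b, c, d} : Finset V) : Set V) ⊆ G.neighborSet u := by
    intro v hv
    simp only [Finset.coe_insert, Finset.coe_singleton, Set.mem_insert_iff,
      Set.mem_singleton_iff] at hv
    rcases hv with rfl | rfl | rfl | rfl <;> assumption
  have := Set.ncard_le_ncard hsub (Set.toFinite _)
  have := ncard_neighborSet_le_maxDeg (G := G) u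
  omega

theorem exists_adj_of_cut (h2 : G.TwoConnected) {m s t : V} (hs : s ≠ m) (ht : t ≠ m)
    {S : Set V} (hsS : s ∈ S) (htS : t ∉ S) : ∃ a b, a ≠ m ∧ b ≠ m ∧ a ∈ S ∧ b ∉ S ∧ G.Adj a b := by
  obtain ⟨p⟩ := (h2.2.2 m).preconnected ⟨s, by simpa using hs⟩ ⟨t, by simpa using ht⟩
  obtain ⟨d, -, h₁, h₂⟩ := p.exists_boundary_dart {x | (x : V) ∈ S} hsS htS
  refine ⟨d.fst, d.snd, ?_, ?_, h₁, h₂, ?_⟩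
  · simpa using d.fst.2
  · simpa using d.snd.2
  · exact Subgraph.coe_adj_sub _ _ _ d.adj

theorem exists_isProperAt_adj (hG : G.Outerplanar) (h2 : G.TwoConnected) (hΔ : G.maxDeg ≤ 3) :
    ∃ f : V → V → Fin 6, ∀ u, IsProperAt G.Adj f u := by
  obtain ⟨r, hr⟩ := hG
  obtain ⟨φ, hφ, hlt, hn, hsurj⟩ : ∃ φ : V → ℕ, Function.Injective φ ∧
      (∀ u v, φ u < φ v → r.lt u v) ∧ (∀ u, φ u < Fintype.card V) ∧
      ∀ s < Fintype.card V, ∃ u, φ u = s := by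
    let := r
    let e := Fintype.orderIsoFinOfCardEq V rfl
    exact ⟨fun v => (e.symm v : ℕ), fun u v h => e.symm.injective (Fin.ext h),
      fun u v h => e.symm.lt_iff_lt.1 h, fun u => (e.symm u).2, fun s hs => ⟨e ⟨s, hs⟩, by simp⟩⟩
  have h : IsCircularDrawing (Fintype.card V) fun s t => ∃ u v, φ u = s ∧ φ v = t ∧ G.Adj u v :=
    { three_le := h2.1
      symm := by
        rintro _ _ ⟨u, v, rfl, rfl, h⟩
        exact ⟨v, u, rfl, rfl, h.symm⟩
      ne := by
        rintro _ _ ⟨u, v, rfl, rfl, h⟩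
        exact hφ.ne h.ne
      lt := by
        rintro _ _ ⟨u, v, rfl, rfl, h⟩
        exact hn u
      noncrossing := by
        rintro _ _ _ _ ⟨a, b, rfl, rfl, h⟩ ⟨c, d, rfl, rfl, h'⟩ ⟨h₁, h₂, h₃⟩
        exact hr a b c d h h' ⟨hlt _ _ h₁, hlt _ _ h₂, hlt _ _ h₃⟩
      degree_le := by
        rintro _ _ _ _ _ ⟨u, a, rfl, rfl, ha⟩ ⟨u₁, b, hu₁, rfl, hb⟩ ⟨u₂, c, hu₂, rfl, hc⟩
          ⟨u₃, d, hu₃, rfl, hd⟩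
        obtain rfl := hφ hu₁
        obtain rfl := hφ hu₂
        obtain rfl := hφ hu₃
        simpa only [hφ.eq_iff] using eq_of_adj_of_maxDeg_le hΔ ha hb hc hd
      cut := by
        intro m s t S hm hs ht hsm htm hsS htS
        obtain ⟨m, rfl⟩ := hsurj m hm
        obtain ⟨s, rfl⟩ := hsurj s hs
        obtain ⟨t, rfl⟩ := hsurj t ht
        obtain ⟨a, b, h₁, h₂, h₃, h₄, h₅⟩ := exists_adj_of_cut h2 (S := {x | S (φ x)})
          (ne_of_apply_ne φ hsm) (ne_of_apply_ne φ htm) hsS htS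
        exact ⟨φ a, φ b, hφ.ne h₁, hφ.ne h₂, h₃, h₄, a, b, rfl, rfl, h₅⟩ }
  obtain ⟨g, hg⟩ := h.exists_isProperAt
  exact ⟨fun u v => g (φ u) (φ v), fun u => (hg (φ u) (hn u)).comap φ (fun _ _ _ _ e => hφ e) rfl
    fun v hv => ⟨⟨u, v, rfl, rfl, hv⟩, rfl, rfl, rfl⟩⟩

end Transport

section Coloring

variable {G : SimpleGraph V} {f : V → V → Fin 6}

open Classical in
/-- The incidence coloring giving the color `f v w` to the incidence `(v, vw)`. -/
noncomputable def incColoring (f : V → V → Fin 6) (v : V) (e : Sym2 V) : Fin 6 :=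
  if h : v ∈ e then f v (Sym2.Mem.other h) else 0

theorem incColoring_mk (f : V → V → Fin 6) (v w : V) : incColoring f v s(v, w) = f v w := by
  have h : v ∈ s(v, w) := Sym2.mem_mk_left v w
  rw [incColoring, dif_pos h, Sym2.congr_right.1 (Sym2.other_spec h)]

theorem isViColoring_of_isProperAt (hf : ∀ u, IsProperAt G.Adj f u) :
    G.IsViColoring 6 (fun v => f v v) (incColoring f) where
  adj_ne u v h := (hf u).vertex_ne v h
  vertex_inc_ne := by
    rintro u w _ ⟨he, ⟨x, rfl⟩⟩ hu
    rw [incColoring_mk]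
    rcases Sym2.mem_iff.1 hu with rfl | rfl
    · exact (hf _).vertex_ne_inc x he
    · exact ((hf _).second_ne_vertex w (Adj.symm he)).symm
  inc_ne := by
    rintro v _ w _ ⟨he, ⟨a, rfl⟩⟩ ⟨he', ⟨b, rfl⟩⟩ hne h
    rw [incColoring_mk, incColoring_mk]
    rw [mem_edgeSet] at he he'
    have aux {v w b : V} (h : G.Adj v w) (h' : G.Adj w b) : f v w ≠ f w b :=
      (hf w).second_ne_inc v b h.symm h'
    rcases h with rfl | h | h | h
    · exact (hf v).inc_ne_inc a b he he' fun hab => hne (by rw [hab])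
    · rcases Sym2.eq_iff.1 h with ⟨rfl, rfl⟩ | ⟨rfl, rfl⟩
      · exact absurd rfl hne
      · exact aux he he'
    · obtain rfl := Sym2.congr_right.1 h
      exact aux he he'
    · rw [Sym2.eq_swap] at h
      obtain rfl := Sym2.congr_right.1 h
      exact (aux he' he).symm

theorem ncard_secondIncColors_le [Finite V] (hf : ∀ u, IsProperAt G.Adj f u) {u : V}
    (hu : (G.neighborSet u).ncard ≤ 3) : (G.secondIncColors (incColoring f) u).ncard ≤ 2 := by
  have hsecond : G.secondIncColors (incColoring f) u = (fun v => f v u) '' G.neighborSet u := by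
    ext a
    simp only [secondIncColors, Set.mem_ofPred_eq, Set.mem_image, mem_neighborSet]
    refine exists_congr fun v => and_congr_right fun _ => ?_
    rw [Sym2.eq_swap, incColoring_mk]
  have hfirst : (f u '' G.neighborSet u).ncard = (G.neighborSet u).ncard :=
    Set.InjOn.ncard_image fun v hv w hw h =>
      by_contra fun hne => (hf u).inc_ne_inc v w hv hw hne h
  have hself : f u u ∉ f u '' G.neighborSet u := by
    rintro ⟨v, hv, h⟩
    exact (hf u).vertex_ne_inc v hv h.symm
  have hdisj : Disjoint ((fun v => f v u) '' G.neighborSet u)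
      (insert (f u u) (f u '' G.neighborSet u)) := by
    rw [Set.disjoint_left]
    rintro _ ⟨v, hv, rfl⟩ (h | ⟨w, hw, h⟩)
    · exact (hf u).second_ne_vertex v hv h
    · exact (hf u).second_ne_inc v w hv hw h.symm
  have h₁ := Set.ncard_union_eq hdisj
  rw [Set.ncard_insert_of_notMem hself, hfirst] at h₁
  have h₂ := Set.ncard_le_card ((fun v => f v u) '' G.neighborSet u ∪
    insert (f u u) (f u '' G.neighborSet u))
  rw [Nat.card_fin] at h₂
  have h₃ := Set.ncard_image_le (f := fun v => f v u) (G.neighborSet u).toFinite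
  rw [hsecond]
  omega

theorem exists_isViColoring_six [Fintype V] (hG : G.Outerplanar) (h2 : G.TwoConnected)
    (hΔ : G.maxDeg ≤ 3) : ∃ cV cI, G.IsViColoring 6 cV cI ∧
      ∀ u, (G.secondIncColors cI u).ncard ≤ 2 := by
  obtain ⟨f, hf⟩ := exists_isProperAt_adj hG h2 hΔ
  exact ⟨_, _, isViColoring_of_isProperAt hf, fun u =>
    ncard_secondIncColors_le hf ((ncard_neighborSet_le_maxDeg u).trans hΔ)⟩

end Coloring

section Diamond

/-- The complete graph on four vertices with one edge removed. -/
def diamond : SimpleGraph (Fin 4) where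
  Adj a b := a ≠ b ∧ ¬ (a = 1 ∧ b = 3) ∧ ¬ (a = 3 ∧ b = 1)
  symm := ⟨by decide⟩
  loopless := ⟨by decide⟩

instance : DecidableRel diamond.Adj := fun a b =>
  inferInstanceAs (Decidable (a ≠ b ∧ ¬ (a = 1 ∧ b = 3) ∧ ¬ (a = 3 ∧ b = 1)))

theorem diamond_outerplanar : diamond.Outerplanar :=
  ⟨inferInstance, by
    change ∀ a b c d : Fin 4, diamond.Adj a b → diamond.Adj c d → ¬ (a < c ∧ c < b ∧ b < d)
    decide⟩

theorem diamond_maxDeg : diamond.maxDeg = 3 := by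
  have h : ∀ v, (diamond.neighborSet v).ncard = diamond.degree v := fun v => by
    rw [← card_neighborSet_eq_degree, Set.ncard_eq_toFinset_card', Set.toFinset_card]
  simp only [maxDeg, h]
  decide

theorem exists_diamond_hub (v : Fin 4) :
    ∃ w, w ≠ v ∧ ∀ u, u ≠ v → u ≠ w → diamond.Adj w u := by
  revert v
  decide

theorem diamond_twoConnected : diamond.TwoConnected := by
  refine ⟨by simp, ?_, fun v => ?_⟩
  · rw [connected_iff_exists_forall_reachable]
    refine ⟨0, fun u => ?_⟩
    rcases eq_or_ne u 0 with rfl | hu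
    · rfl
    · have h : ∀ u : Fin 4, u ≠ 0 → diamond.Adj 0 u := by decide
      exact (h u hu).reachable
  · obtain ⟨w, hw, h⟩ := exists_diamond_hub v
    rw [connected_iff_exists_forall_reachable]
    refine ⟨⟨w, by simpa using hw⟩, fun ⟨u, hu⟩ => ?_⟩
    have huv : u ≠ v := by simpa using hu
    rcases eq_or_ne u w with rfl | huw
    · rfl
    · refine Adj.reachable ?_
      simpa [hw, huv] using h u huv huw

theorem six_le_of_isViColoring_diamond {k : ℕ} {cV : Fin 4 → Fin k}
    {cI : Fin 4 → Sym2 (Fin 4) → Fin k} (h : diamond.IsViColoring k cV cI) : 6 ≤ k := by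
  by_contra! hk
  have six (p q r s t u : Fin k) (h₁ : p ≠ q) (h₂ : p ≠ r) (h₃ : p ≠ s) (h₄ : p ≠ t) (h₅ : p ≠ u)
      (h₆ : q ≠ r) (h₇ : q ≠ s) (h₈ : q ≠ t) (h₉ : q ≠ u) (h₁₀ : r ≠ s) (h₁₁ : r ≠ t)
      (h₁₂ : r ≠ u) (h₁₃ : s ≠ t) (h₁₄ : s ≠ u) : t = u := by
    omega
  have hvv (u v) (huv : diamond.Adj u v) : cV u ≠ cV v := h.adj_ne huv
  have hself (u v) (huv : diamond.Adj u v) : cV u ≠ cI u s(u, v) :=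
    h.vertex_inc_ne ⟨huv, Sym2.mem_mk_left _ _⟩ (Sym2.mem_mk_left _ _)
  have hother (u v) (huv : diamond.Adj u v) : cV u ≠ cI v s(v, u) :=
    h.vertex_inc_ne ⟨huv.symm, Sym2.mem_mk_left _ _⟩ (Sym2.mem_mk_right _ _)
  have hfan (u v w) (huv : diamond.Adj u v) (huw : diamond.Adj u w) (hvw : v ≠ w) :
      cI u s(u, v) ≠ cI u s(u, w) :=
    h.inc_ne ⟨huv, Sym2.mem_mk_left _ _⟩ ⟨huw, Sym2.mem_mk_left _ _⟩
      (fun e => hvw (Sym2.congr_right.1 (Prod.ext_iff.1 e).2)) (Or.inl rfl)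
  have hpath (u v w) (huv : diamond.Adj u v) (hvw : diamond.Adj v w) :
      cI u s(u, v) ≠ cI v s(v, w) :=
    h.inc_ne ⟨huv, Sym2.mem_mk_left _ _⟩ ⟨hvw, Sym2.mem_mk_left _ _⟩
      (fun e => huv.ne (Prod.ext_iff.1 e).1) (Or.inr (Or.inr (Or.inl rfl)))
  have hsecond (a u v w : Fin 4) (hu : diamond.Adj a u) (hv : diamond.Adj a v)
      (hw : diamond.Adj a w) (huv : u ≠ v) (huw : u ≠ w) (hvw : v ≠ w) :
      cI u s(u, a) = cI v s(v, a) :=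
    six (cV a) (cI a s(a, u)) (cI a s(a, v)) (cI a s(a, w)) _ _ (hself a u hu) (hself a v hv)
      (hself a w hw) (hother a u hu) (hother a v hv) (hfan a u v hu hv huv)
      (hfan a u w hu hw huw) (hpath u a u hu.symm hu).symm (hpath v a u hv.symm hu).symm
      (hfan a v w hv hw hvw) (hpath u a v hu.symm hv).symm (hpath v a v hv.symm hv).symm
      (hpath u a w hu.symm hw).symm (hpath v a w hv.symm hw).symm
  have hvertex (a b u w : Fin 4) (hab : diamond.Adj a b) (hau : diamond.Adj a u)
      (haw : diamond.Adj a w) (hbu : diamond.Adj b u) (hbw : diamond.Adj b w) (huw : u ≠ w) :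
      cI a s(a, u) = cV b := by
    have ha := hsecond a u b w hau hab haw hbu.ne.symm huw hbw.ne
    have hb := hsecond b u a w hbu hab.symm hbw hau.ne.symm huw haw.ne
    refine six (cV a) (cV u) (cI u s(u, a)) (cI u s(u, b)) _ _ (hvv a u hau) (hother a u hau) ?_
      (hself a u hau) (hvv a b hab) (hself u a hau.symm) (hself u b hbu.symm)
      (hother u a hau.symm) (hvv u b hbu.symm) (hfan u a b hau.symm hbu.symm hab.ne)
      (hpath u a u hau.symm hau) ?_ ?_ (hother b u hbu).symm
    · rw [hb]
      exact hself a b hab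
    · rw [ha]
      exact (hself b a hab.symm).symm
    · rw [hb]
      exact hfan a b u hab hau hbu.ne
  refine hfan 0 1 3 (by decide) (by decide) (by decide) ?_
  rw [hvertex 0 2 1 3 (by decide) (by decide) (by decide) (by decide) (by decide) (by decide),
    hvertex 0 2 3 1 (by decide) (by decide) (by decide) (by decide) (by decide) (by decide)]

theorem chiVi_diamond : diamond.chiVi = 6 := by
  obtain ⟨cV, cI, h, -⟩ :=
    exists_isViColoring_six diamond_outerplanar diamond_twoConnected diamond_maxDeg.le
  have hmem : 6 ∈ {k | ∃ cV cI, diamond.IsViColoring k cV cI} := ⟨cV, cI, h⟩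
  refine le_antisymm (Nat.sInf_le hmem) (le_csInf ⟨6, hmem⟩ ?_)
  rintro k ⟨cV, cI, h⟩
  exact six_le_of_isViColoring_diamond h

end Diamond

end ViColoring

/-- If `G` is a finite 2-connected outerplanar graph with `Δ(G) = 3`, then `χ_{vi,2}(G) ≤ 6`;
moreover, the bound is tight: there is a 2-connected outerplanar graph of maximum degree 3
whose vi-simultaneous chromatic number equals 6. -/
theorem chiViS_two_le_six_of_twoConnected [Fintype V] (G : SimpleGraph V)
    (hG : G.Outerplanar) (h2 : G.TwoConnected) (hΔ : G.maxDeg = 3) :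
    G.chiViS 2 ≤ 6 ∧
    ∃ (n : ℕ) (H : SimpleGraph (Fin n)),
      H.Outerplanar ∧ H.TwoConnected ∧ H.maxDeg = 3 ∧ H.chiVi = 6 := by
  obtain ⟨cV, cI, h⟩ := ViColoring.exists_isViColoring_six hG h2 hΔ.le
  exact ⟨Nat.sInf_le ⟨cV, cI, h⟩, 4, ViColoring.diamond, ViColoring.diamond_outerplanar,
    ViColoring.diamond_twoConnected, ViColoring.diamond_maxDeg, ViColoring.chiVi_diamond⟩
end

section
/- If G is a finite outerplanar graph with Δ(G) = 3, then χ_{vi,2}(G) ≤ 6. -/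
open SimpleGraph

variable {V : Type*}

/-- `A` is a finite set of vertices of a non-crossing graph; then `A` contains a vertex with at most
one neighbour in `A`, or two adjacent vertices having at most one further neighbour each, or a
triangle one of whose vertices has no neighbour outside of it. -/
theorem exists_reducible_of_noncrossing {V : Type*} [LinearOrder V] {G : SimpleGraph V}
    (hG : ∀ a b c d : V, G.Adj a b → G.Adj c d → ¬(a < c ∧ c < b ∧ b < d))
    {A : Finset V} (hA : A.Nonempty) :
    (∃ x ∈ A, {w | w ∈ A ∧ G.Adj x w}.Subsingleton) ∨
    (∃ x ∈ A, ∃ y ∈ A, G.Adj x y ∧ {w | w ∈ A ∧ w ≠ y ∧ G.Adj x w}.Subsingleton ∧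
      {w | w ∈ A ∧ w ≠ x ∧ G.Adj y w}.Subsingleton) ∨
    (∃ x ∈ A, ∃ y ∈ A, ∃ z ∈ A, G.Adj x y ∧ G.Adj x z ∧ G.Adj y z ∧
      ∀ w ∈ A, G.Adj x w → w = y ∨ w = z) := by
  by_cases h : ∃ a ∈ A, ∃ b ∈ A, G.Adj a b ∧ ∃ v ∈ A, a < v ∧ v < b
  · classical
    let between (p : V × V) : Finset V := A.filter fun v => p.1 < v ∧ v < p.2
    let chords := (A ×ˢ A).filter fun p => G.Adj p.1 p.2 ∧ (between p).Nonempty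
    have hne : chords.Nonempty := by
      obtain ⟨a, ha, b, hb, hab, v, hv, hav, hvb⟩ := h
      exact ⟨(a, b), by simp only [chords, between, Finset.mem_filter, Finset.mem_product]
                        exact ⟨⟨ha, hb⟩, hab, v, by simp [hv, hav, hvb]⟩⟩
    obtain ⟨⟨a, b⟩, hmem, hmin⟩ := Finset.exists_min_image chords (fun p => (between p).card) hne
    simp only [chords, Finset.mem_filter, Finset.mem_product] at hmem
    obtain ⟨⟨ha, hb⟩, hab, hbet⟩ := hmem
    have short : ∀ v ∈ between (a, b), ∀ c ∈ A, ∀ d ∈ A, G.Adj c d → a ≤ c → d ≤ b →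
        (v ≤ c ∨ d ≤ v) → ∀ t ∈ A, c < t → t < d → False := by
      intro v hv c hc d hd hcd hac hdb hvcd t ht hct htd
      have hmin' := hmin (c, d) (by
        simp only [chords, Finset.mem_filter, Finset.mem_product]
        exact ⟨⟨hc, hd⟩, hcd, t, by simp [between, ht, hct, htd]⟩)
      refine absurd (Finset.card_lt_card ?_) (not_lt.mpr hmin')
      refine (Finset.ssubset_iff_of_subset ?_).mpr ⟨v, hv, ?_⟩
      · intro s
        simp only [between, Finset.mem_filter]
        exact fun ⟨hs, hcs, hsd⟩ => ⟨hs, hac.trans_lt hcs, hsd.trans_le hdb⟩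
      · simp only [between, Finset.mem_filter]
        grind
    have range : ∀ v ∈ between (a, b), ∀ w ∈ A, G.Adj v w → a ≤ w ∧ w ≤ b := by
      intro v hv w hw hvw
      simp only [between, Finset.mem_filter] at hv
      constructor
      · by_contra! hwa
        exact hG w v a b hvw.symm hab ⟨hwa, hv.2.1, hv.2.2⟩
      · by_contra! hbw
        exact hG a b v w hab hvw ⟨hv.2.1, hv.2.2, hbw⟩
    have up : ∀ v ∈ between (a, b), ∀ w ∈ A, G.Adj v w → v < w → ∀ t ∈ A, v < t → t < w → False :=
      fun v hv w hw hvw _ => short v hv v (Finset.mem_filter.mp hv).1 w hw hvw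
        (Finset.mem_filter.mp hv).2.1.le (range v hv w hw hvw).2 (Or.inl le_rfl)
    have down : ∀ v ∈ between (a, b), ∀ w ∈ A, G.Adj v w → w < v →
        ∀ t ∈ A, w < t → t < v → False :=
      fun v hv w hw hvw _ => short v hv w hw v (Finset.mem_filter.mp hv).1 hvw.symm
        (range v hv w hw hvw).1 (Finset.mem_filter.mp hv).2.2.le (Or.inr le_rfl)
    obtain ⟨x, hx, hxmin⟩ := (between (a, b)).exists_minimal hbet
    have hx' := Finset.mem_filter.mp hx
    have up_unique : ∀ v ∈ between (a, b), ∀ u ∈ A, ∀ w ∈ A, G.Adj v u → G.Adj v w →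
        v < u → v < w → u = w := by
      intro v hv u hu w hw hvu hvw hlu hlw
      rcases lt_trichotomy u w with huw | huw | huw
      · exact (up v hv w hw hvw hlw u hu hlu huw).elim
      · exact huw
      · exact (up v hv u hu hvu hlu w hw hlw huw).elim
    have down_unique : ∀ v ∈ between (a, b), ∀ u ∈ A, ∀ w ∈ A, G.Adj v u → G.Adj v w →
        u < v → w < v → u = w := by
      intro v hv u hu w hw hvu hvw hlu hlw
      rcases lt_trichotomy u w with huw | huw | huw
      · exact (down v hv u hu hvu hlu w hw huw hlw).elim
      · exact huw
      · exact (down v hv w hw hvw hlw u hu huw hlu).elim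
    have low : ∀ w ∈ A, G.Adj x w → w < x → w = a := by
      intro w hw hxw hwx
      by_contra hwa
      have haw := lt_of_le_of_ne (range x hx w hw hxw).1 (Ne.symm hwa)
      exact hwx.not_ge
        (hxmin (Finset.mem_filter.mpr ⟨hw, haw, hwx.trans hx'.2.2⟩) hwx.le)
    by_cases hxu : ∃ u ∈ A, G.Adj x u ∧ x < u
    · obtain ⟨u, hu, hxu, hlu⟩ := hxu
      have high : ∀ w ∈ A, G.Adj x w → x < w → w = u := fun w hw hxw hlw =>
        up_unique x hx w hw u hu hxw hxu hlw hlu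
      by_cases hub : u = b
      · subst hub
        by_cases hxa : G.Adj x a
        · refine Or.inr (Or.inr ⟨x, hx'.1, a, ha, u, hb, hxa, hxu, hab, fun w hw hxw => ?_⟩)
          exact (lt_or_gt_of_ne hxw.ne').imp (low w hw hxw) (high w hw hxw)
        · refine Or.inl ⟨x, hx'.1, ?_⟩
          rintro v ⟨hv, hxv⟩ w ⟨hw, hxw⟩
          have key : ∀ w ∈ A, G.Adj x w → w = u := fun w hw hxw =>
            (lt_or_gt_of_ne hxw.ne').elim
              (fun hlt => (hxa (low w hw hxw hlt ▸ hxw)).elim) (high w hw hxw)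
          rw [key v hv hxv, key w hw hxw]
      · have hub' := lt_of_le_of_ne (range x hx u hu hxu).2 hub
        have hubet : u ∈ between (a, b) :=
          Finset.mem_filter.mpr ⟨hu, hx'.2.1.trans hlu, hub'⟩
        refine Or.inr (Or.inl ⟨x, hx'.1, u, hu, hxu, ?_, ?_⟩)
        · rintro v ⟨hv, hvu, hxv⟩ w ⟨hw, hwu, hxw⟩
          have key : ∀ w ∈ A, w ≠ u → G.Adj x w → w = a := fun w hw hwu hxw =>
            (lt_or_gt_of_ne hxw.ne').elim (low w hw hxw) (fun hlt => (hwu (high w hw hxw hlt)).elim)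
          rw [key v hv hvu hxv, key w hw hwu hxw]
        · rintro v ⟨hv, hvx, huv⟩ w ⟨hw, hwx, huw⟩
          have key : ∀ w ∈ A, w ≠ x → G.Adj u w → u < w := fun w hw hwx huw =>
            (lt_or_gt_of_ne huw.ne').elim (fun hlt =>
              (hwx (down_unique u hubet w hw x hx'.1 huw hxu.symm hlt hlu)).elim) id
          exact up_unique u hubet v hv w hw huv huw (key v hv hvx huv) (key w hw hwx huw)
    · push Not at hxu
      refine Or.inl ⟨x, hx'.1, ?_⟩
      rintro v ⟨hv, hxv⟩ w ⟨hw, hxw⟩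
      have key : ∀ w ∈ A, G.Adj x w → w = a := fun w hw hxw =>
        low w hw hxw (lt_of_le_of_ne (hxu w hw hxw) hxw.ne')
      rw [key v hv hxv, key w hw hxw]
  · push Not at h
    refine Or.inl ⟨A.min' hA, A.min'_mem hA, ?_⟩
    rintro u ⟨hu, hxu⟩ w ⟨hw, hxw⟩
    have hu' := lt_of_le_of_ne (A.min'_le u hu) hxu.ne
    have hw' := lt_of_le_of_ne (A.min'_le w hw) hxw.ne
    rcases lt_trichotomy u w with huw | huw | huw
    · exact absurd huw (not_lt.mpr (h _ (A.min'_mem hA) w hw hxw u hu hu'))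
    · exact huw
    · exact absurd huw (not_lt.mpr (h _ (A.min'_mem hA) u hu hxu w hw hw'))

open Equiv

theorem exists_perm_of_nodup {c t₁ t₂ x y z : Fin 6} (h : [c, t₁, t₂, x, y, z].Nodup) :
    ∃ π : Perm (Fin 6), π 0 = c ∧ π 1 = t₁ ∧ π 2 = t₂ ∧ π 3 = x ∧ π 4 = y ∧ π 5 = z := by
  have hinj : Function.Injective ![c, t₁, t₂, x, y, z] := by
    rw [← List.nodup_ofFn]
    simpa using h
  exact ⟨Equiv.ofBijective _ (Finite.injective_iff_bijective.mp hinj), rfl, rfl, rfl, rfl, rfl, rfl⟩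

set_option synthInstance.maxSize 100000 in
set_option synthInstance.maxHeartbeats 0 in
theorem exists_completion : ∀ c p b x y : Fin 6, p ≠ c → b ≠ c → x ≠ c → x ≠ p → x ≠ b →
    y ≠ c → y ≠ p → y ≠ b → y ≠ x →
    ∃ t : Fin 6, (b = p ∨ b = t) ∧ t ≠ c ∧ t ≠ p ∧ t ≠ x ∧ t ≠ y ∧
    ∃ z : Fin 6, z ≠ c ∧ z ≠ p ∧ z ≠ t ∧ z ≠ x ∧ z ≠ y := by
  decide +kernel

theorem exists_perm_of_ne {c p b x y : Fin 6} (hpc : p ≠ c) (hbc : b ≠ c) (hxc : x ≠ c)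
    (hxp : x ≠ p) (hxb : x ≠ b) (hyc : y ≠ c) (hyp : y ≠ p) (hyb : y ≠ b) (hyx : y ≠ x) :
    ∃ π : Perm (Fin 6), π 0 = c ∧ π 3 = x ∧ π 4 = y ∧
      (p = π 1 ∨ p = π 2) ∧ (b = π 1 ∨ b = π 2) := by
  obtain ⟨t, hbt, htc, htp, htx, hty, z, hzc, hzp, hzt, hzx, hzy⟩ :=
    exists_completion c p b x y hpc hbc hxc hxp hxb hyc hyp hyb hyx
  obtain ⟨π, h0, h1, h2, h3, h4, -⟩ := exists_perm_of_nodup (c := c) (t₁ := p) (t₂ := t) (x := x)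
    (y := y) (z := z) (by simp; grind)
  exact ⟨π, h0, h3, h4, Or.inl h1.symm, by rwa [h1, h2]⟩

/-- A permutation `π` of `Fin 6` is the palette of a vertex `v`: `π 0` is the color of `v`, `π 1` and
`π 2` are the colors allowed on the second incidences of `v`, and `π 3`, `π 4`, `π 5` those allowed
on the incidences at `v`. Two palettes are compatible along an edge using the ports `i` and `j`
when they give a proper coloring there. -/
def PaletteCompat (π ρ : Perm (Fin 6)) (i j : Fin 6) : Prop :=
  π 0 ≠ ρ 0 ∧ (π i = ρ 1 ∨ π i = ρ 2) ∧ (ρ j = π 1 ∨ ρ j = π 2)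

theorem PaletteCompat.symm {π ρ : Perm (Fin 6)} {i j : Fin 6} (h : PaletteCompat π ρ i j) :
    PaletteCompat ρ π j i :=
  ⟨h.1.symm, h.2.2, h.2.1⟩

theorem PaletteCompat.mul_left {π ρ : Perm (Fin 6)} {i j : Fin 6} (h : PaletteCompat π ρ i j)
    (g : Perm (Fin 6)) : PaletteCompat (g * π) (g * ρ) i j := by
  simpa [PaletteCompat] using h

/-- A permutation of `Fin 6` which only permutes the ports `3`, `4`, `5`. -/
def IsPortPerm (a : Perm (Fin 6)) : Prop := a 0 = 0 ∧ a 1 = 1 ∧ a 2 = 2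

theorem PaletteCompat.mul_right {π ρ a b : Perm (Fin 6)} {i j i' j' : Fin 6}
    (h : PaletteCompat π ρ i' j') (ha : IsPortPerm a) (hb : IsPortPerm b) (hi : a i = i')
    (hj : b j = j') : PaletteCompat (π * a) (ρ * b) i j := by
  obtain ⟨ha0, ha1, ha2⟩ := ha
  obtain ⟨hb0, hb1, hb2⟩ := hb
  simpa [PaletteCompat, ha0, ha1, ha2, hb0, hb1, hb2, hi, hj] using h

theorem exists_portPerm {i j k : Fin 6} (hi : 3 ≤ i) (hj : 3 ≤ j) (hk : 3 ≤ k) (hij : i ≠ j)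
    (hik : i ≠ k) (hjk : j ≠ k) :
    ∃ a, IsPortPerm a ∧ a i = 3 ∧ a j = 4 ∧ a k = 5 := by
  obtain ⟨π, h0, h1, h2, h3, h4, h5⟩ := exists_perm_of_nodup (c := 0) (t₁ := 1) (t₂ := 2)
    (x := i) (y := j) (z := k) (by simp; grind)
  refine ⟨π⁻¹, ⟨?_, ?_, ?_⟩, ?_, ?_, ?_⟩ <;> rw [Perm.inv_eq_iff_eq, eq_comm] <;> assumption

theorem exists_port_ne : ∀ j k : Fin 6, ∃ i : Fin 6, 3 ≤ i ∧ i ≠ j ∧ i ≠ k := by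
  decide

theorem exists_portPerm_pair {i j : Fin 6} (hi : 3 ≤ i) (hj : 3 ≤ j) (hij : i ≠ j) :
    ∃ a, IsPortPerm a ∧ a i = 3 ∧ a j = 4 := by
  obtain ⟨k, hk, hki, hkj⟩ := exists_port_ne i j
  obtain ⟨a, ha, h3, h4, -⟩ := exists_portPerm hi hj hk hij hki.symm hkj.symm
  exact ⟨a, ha, h3, h4⟩

theorem exists_compat_one (σ : Perm (Fin 6)) : ∃ ξ, PaletteCompat ξ σ 3 3 := by
  obtain ⟨π, h0, h1, h2, h3, -, -⟩ := exists_perm_of_nodup (c := 2) (t₁ := 3) (t₂ := 0)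
    (x := 1) (y := 4) (z := 5) (by decide)
  refine ⟨σ * π, ?_⟩
  simp [PaletteCompat, h0, h1, h2, h3]

set_option synthInstance.maxSize 100000 in
set_option synthInstance.maxHeartbeats 0 in
theorem exists_path_values : ∀ r s f : Fin 6, s ≠ r → f ≠ r → f ≠ s →
    ∃ q : Fin 6, (q = 1 ∨ q = 2) ∧
    ∃ a : Fin 6, a ≠ q ∧ a ≠ 3 ∧ a ≠ s ∧
    ∃ b : Fin 6, b ≠ s ∧ b ≠ r ∧ b ≠ q ∧ b ≠ a ∧
    ∃ cx : Fin 6, cx ≠ 0 ∧ cx ≠ 3 ∧ cx ≠ q ∧ cx ≠ a ∧ cx ≠ b ∧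
    ∃ cy : Fin 6, cy ≠ f ∧ cy ≠ r ∧ cy ≠ s ∧ cy ≠ a ∧ cy ≠ b ∧ cy ≠ cx := by
  decide +kernel

theorem exists_compat_path (σ τ : Perm (Fin 6)) :
    ∃ ξ υ, PaletteCompat ξ σ 3 3 ∧ PaletteCompat υ τ 3 3 ∧ PaletteCompat ξ υ 4 4 := by
  suffices h : ∀ ρ, ∃ ξ υ, PaletteCompat ξ 1 3 3 ∧ PaletteCompat υ ρ 3 3 ∧
      PaletteCompat ξ υ 4 4 by
    obtain ⟨ξ, υ, h₁, h₂, h₃⟩ := h (σ⁻¹ * τ)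
    exact ⟨σ * ξ, σ * υ, by simpa using h₁.mul_left σ, by simpa using h₂.mul_left σ,
      h₃.mul_left σ⟩
  intro ρ
  obtain ⟨q, hq, a, haq, ha3, has, b, hbs, hbr, hbq, hba, cx, hcx0, hcx3, hcxq, hcxa, hcxb,
    cy, hcyf, hcyr, hcys, hcya, hcyb, hcyx⟩ := exists_path_values (ρ 3) (ρ 1) (ρ 0)
      (by simp) (by simp) (by simp)
  obtain ⟨ξ, hξ0, hξ3, hξ4, hξp, hξb⟩ := exists_perm_of_ne (c := cx) (p := 3) (b := b) (x := q)
    (y := a) hcx3.symm hcxb.symm hcxq.symm (by rcases hq with rfl | rfl <;> decide) hbq.symm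
    hcxa.symm ha3 hba.symm haq
  obtain ⟨υ, hυ0, hυ3, hυ4, hυp, hυa⟩ := exists_perm_of_ne (c := cy) (p := ρ 3) (b := a) (x := ρ 1)
    (y := b) hcyr.symm hcya.symm hcys.symm (by simp) has.symm hcyb.symm hbr hba hbs
  refine ⟨ξ, υ, ?_, ?_, ?_⟩
  · simp [PaletteCompat, *]
  · simp [PaletteCompat, *]
  · simp only [PaletteCompat, hξ0, hυ0, hξ4, hυ4]
    exact ⟨hcyx.symm, hυa, hξb⟩

set_option synthInstance.maxSize 100000 in
set_option synthInstance.maxHeartbeats 0 in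
theorem exists_triangle_values : ∀ r s f : Fin 6, s ≠ r → f ≠ r → f ≠ s →
    ∃ q : Fin 6, (q = 1 ∨ q = 2) ∧
    ∃ yx : Fin 6, yx ≠ 3 ∧ yx ≠ q ∧
    ∃ yz : Fin 6, yz ≠ 3 ∧ yz ≠ q ∧ yz ≠ yx ∧ yz ≠ s ∧
    ∃ cy : Fin 6, cy ≠ 3 ∧ cy ≠ q ∧ cy ≠ yx ∧ cy ≠ yz ∧ cy ≠ 0 ∧
    ∃ ty : Fin 6, ty ≠ 3 ∧ ty ≠ q ∧ ty ≠ yx ∧ ty ≠ yz ∧ ty ≠ cy ∧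
    ∃ zy : Fin 6, (zy = 3 ∨ zy = ty) ∧ zy ≠ r ∧ zy ≠ s ∧
    ∃ zx : Fin 6, zx ≠ r ∧ zx ≠ s ∧ zx ≠ zy ∧
    ∃ cz : Fin 6, cz ≠ r ∧ cz ≠ s ∧ cz ≠ zy ∧ cz ≠ zx ∧ cz ≠ f ∧ cz ≠ cy ∧
    ∃ tz : Fin 6, tz ≠ r ∧ tz ≠ s ∧ tz ≠ zy ∧ tz ≠ zx ∧ tz ≠ cz ∧ (yz = r ∨ yz = tz) ∧
    ∃ xy : Fin 6, (xy = 3 ∨ xy = ty) ∧ xy ≠ yx ∧ xy ≠ zx ∧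
    ∃ xz : Fin 6, (xz = r ∨ xz = tz) ∧ xz ≠ yx ∧ xz ≠ zx ∧ xz ≠ xy ∧
    ∃ cx : Fin 6, cx ≠ yx ∧ cx ≠ zx ∧ cx ≠ xy ∧ cx ≠ xz ∧ cx ≠ cy ∧ cx ≠ cz := by
  decide +kernel

theorem exists_compat_triangle (σ τ : Perm (Fin 6)) :
    ∃ ξ υ ζ, PaletteCompat υ σ 3 3 ∧ PaletteCompat ζ τ 3 3 ∧ PaletteCompat υ ζ 4 4 ∧
      PaletteCompat ξ υ 3 5 ∧ PaletteCompat ξ ζ 4 5 := by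
  suffices h : ∀ ρ, ∃ ξ υ ζ, PaletteCompat υ 1 3 3 ∧ PaletteCompat ζ ρ 3 3 ∧
      PaletteCompat υ ζ 4 4 ∧ PaletteCompat ξ υ 3 5 ∧ PaletteCompat ξ ζ 4 5 by
    obtain ⟨ξ, υ, ζ, h₁, h₂, h₃, h₄, h₅⟩ := h (σ⁻¹ * τ)
    exact ⟨σ * ξ, σ * υ, σ * ζ, by simpa using h₁.mul_left σ, by simpa using h₂.mul_left σ,
      h₃.mul_left σ, h₄.mul_left σ, h₅.mul_left σ⟩
  intro ρ
  have hsr : ρ 1 ≠ ρ 3 := by simp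
  obtain ⟨q, hq, yx, hyx3, hyxq, yz, hyz3, hyzq, hyzyx, hyzs, cy, hcy3, hcyq, hcyyx, hcyyz, hcy0,
    ty, hty3, htyq, htyyx, htyyz, htycy, zy, hzy, hzyr, hzys, zx, hzxr, hzxs, hzxzy,
    cz, hczr, hczs, hczzy, hczzx, hczf, hczcy, tz, htzr, htzs, htzzy, htzzx, htzcz, hyz,
    xy, hxy, hxyyx, hxyzx, xz, hxz, hxzyx, hxzzx, hxzxy, cx, hcxyx, hcxzx, hcxxy, hcxxz, hcxcy,
    hcxcz⟩ := exists_triangle_values (ρ 3) (ρ 1) (ρ 0) hsr (by simp) (by simp)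
  have hq3 : q ≠ 3 := by rcases hq with rfl | rfl <;> decide
  obtain ⟨υ, hυ0, hυ1, hυ2, hυ3, hυ4, hυ5⟩ := exists_perm_of_nodup (c := cy) (t₁ := 3) (t₂ := ty)
    (x := q) (y := yz) (z := yx) (by simp only [List.nodup_cons, List.mem_cons]; grind)
  obtain ⟨ζ, hζ0, hζ1, hζ2, hζ3, hζ4, hζ5⟩ := exists_perm_of_nodup (c := cz) (t₁ := ρ 3) (t₂ := tz)
    (x := ρ 1) (y := zy) (z := zx) (by simp only [List.nodup_cons, List.mem_cons]; grind)
  obtain ⟨ξ, hξ0, hξ3, hξ4, hξy, hξz⟩ := exists_perm_of_ne (c := cx) (p := yx) (b := zx) (x := xy)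
    (y := xz) hcxyx.symm hcxzx.symm hcxxy.symm hxyyx hxyzx hcxxz.symm hxzyx hxzzx hxzxy
  refine ⟨ξ, υ, ζ, ?_, ?_, ?_, ?_, ?_⟩ <;> simp only [PaletteCompat, hυ0, hυ1, hυ2, hυ3, hυ4, hυ5,
    hζ0, hζ1, hζ2, hζ3, hζ4, hζ5, hξ0, hξ3, hξ4, Perm.coe_one, id_eq]
  · exact ⟨hcy0, hq, Or.inl trivial⟩
  · exact ⟨hczf, Or.inl trivial, Or.inl trivial⟩
  · exact ⟨hczcy.symm, hyz, hzy⟩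
  · exact ⟨hcxcy, hxy, hξy⟩
  · exact ⟨hcxcz, hxz, hξz⟩

/-- `p u v` is the port of `u` used for the edge `uv`: the ports of a vertex are `3`, `4`, `5`, and
different edges at it use different ports. -/
structure IsPortMap (G : SimpleGraph V) (p : V → V → Fin 6) : Prop where
  three_le : ∀ ⦃u v⦄, G.Adj u v → 3 ≤ p u v
  inj : ∀ ⦃u v w⦄, G.Adj u v → G.Adj u w → p u v = p u w → v = w

theorem exists_isPortMap [Fintype V] {G : SimpleGraph V}
    (hG : ∀ v, (G.neighborSet v).ncard ≤ 3) : ∃ p, IsPortMap G p := by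
  have (v : V) : ∃ f : V → Fin 6, (∀ w, G.Adj v w → 3 ≤ f w) ∧
      ∀ u w, G.Adj v u → G.Adj v w → f u = f w → u = w := by
    have hfin := (G.neighborSet v).toFinite
    have hcard : (G.neighborSet v).encard ≤ (Set.Ici (3 : Fin 6)).encard := by
      rw [← hfin.cast_ncard_eq, ← (Set.Ici (3 : Fin 6)).toFinite.cast_ncard_eq,
        Set.ncard_eq_toFinset_card' (Set.Ici (3 : Fin 6))]
      exact_mod_cast hG v
    obtain ⟨f, hf, hinj⟩ := hfin.exists_injOn_of_encard_le hcard
    exact ⟨f, fun w hw => hf hw, fun u w hu hw h => hinj hu hw h⟩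
  choose p h₁ h₂ using this
  exact ⟨p, h₁, fun u v w => h₂ u v w⟩

/-- `π` assigns palettes to vertices which are compatible along the edges within `A`. -/
def IsPaletteColoring (G : SimpleGraph V) (p : V → V → Fin 6) (A : Set V)
    (π : V → Perm (Fin 6)) : Prop :=
  ∀ ⦃u⦄, u ∈ A → ∀ ⦃v⦄, v ∈ A → G.Adj u v → PaletteCompat (π u) (π v) (p u v) (p v u)

section Extension

variable {G : SimpleGraph V} {p : V → V → Fin 6} {A : Set V} {π : V → Perm (Fin 6)}

theorem IsPaletteColoring.mono {B : Set V} (h : IsPaletteColoring G p B π) (hAB : A ⊆ B) :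
    IsPaletteColoring G p A π :=
  fun _ hu _ hv huv => h (hAB hu) (hAB hv) huv

theorem IsPaletteColoring.insert [DecidableEq V] (h : IsPaletteColoring G p A π) {x : V}
    {ρ : Perm (Fin 6)} (hx : x ∉ A)
    (hρ : ∀ w ∈ A, G.Adj x w → PaletteCompat ρ (π w) (p x w) (p w x)) :
    IsPaletteColoring G p (insert x A) (Function.update π x ρ) := by
  rintro u (rfl | hu) v (rfl | hv) huv
  · exact (G.loopless.irrefl _ huv).elim
  · have hvu : v ≠ u := huv.ne'
    simpa [hvu] using hρ v hv huv
  · have hvu : u ≠ v := huv.ne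
    simpa [hvu] using (hρ u hu huv.symm).symm
  · have hux : u ≠ x := fun h => hx (h ▸ hu)
    have hvx : v ≠ x := fun h => hx (h ▸ hv)
    simpa [hux, hvx] using h hu hv huv

/-- If all edges from `y` to `A` use the same port, there is a single palette `σ` such that
compatibility with `σ` ensures compatibility along these edges. -/
theorem IsPortMap.exists_anchor (hp : IsPortMap G p) (π : V → Perm (Fin 6)) {y : V} {i : Fin 6}
    (hi : ∀ w ∈ A, G.Adj y w → p y w = i) :
    ∃ σ, ∀ ρ a, PaletteCompat ρ σ 3 3 → IsPortPerm a → a i = 3 →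
      ∀ w ∈ A, G.Adj y w → PaletteCompat (ρ * a) (π w) (p y w) (p w y) := by
  by_cases h : ∃ w ∈ A, G.Adj y w
  · obtain ⟨w, hw, hyw⟩ := h
    have h3 := hp.three_le hyw.symm
    have hswap : IsPortPerm (swap 3 (p w y)) := by
      refine ⟨?_, ?_, ?_⟩ <;> apply swap_apply_of_ne_of_ne <;> first | decide | grind
    refine ⟨π w * swap 3 (p w y), fun ρ a hρ ha hai w' hw' hyw' => ?_⟩
    obtain rfl := hp.inj hyw hyw' ((hi w hw hyw).trans (hi w' hw' hyw').symm)
    have := hρ.mul_right (i := p y w) (j := p w y) ha hswap (by rw [hi w hw hyw, hai]) (by simp)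
    rwa [mul_assoc, swap_mul_self, mul_one] at this
  · push Not at h
    exact ⟨1, fun _ _ _ _ _ w hw hyw => (h w hw hyw).elim⟩

theorem IsPortMap.exists_port (hp : IsPortMap G p) {y : V} (j k : Fin 6)
    (hA : {w | w ∈ A ∧ G.Adj y w}.Subsingleton)
    (hjk : ∀ w ∈ A, G.Adj y w → p y w ≠ j ∧ p y w ≠ k) :
    ∃ i, 3 ≤ i ∧ i ≠ j ∧ i ≠ k ∧ ∀ w ∈ A, G.Adj y w → p y w = i := by
  by_cases h : ∃ w ∈ A, G.Adj y w
  · obtain ⟨w, hw, hyw⟩ := h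
    refine ⟨p y w, hp.three_le hyw, (hjk w hw hyw).1, (hjk w hw hyw).2, fun w' hw' hyw' => ?_⟩
    rw [hA ⟨hw, hyw⟩ ⟨hw', hyw'⟩]
  · push Not at h
    obtain ⟨i, hi, hij, hik⟩ := exists_port_ne j k
    exact ⟨i, hi, hij, hik, fun w hw hyw => (h w hw hyw).elim⟩

theorem IsPortMap.extend_one (hp : IsPortMap G p) (h : IsPaletteColoring G p A π) {x : V}
    (hx : x ∉ A) (hxA : {w | w ∈ A ∧ G.Adj x w}.Subsingleton) :
    ∃ π', IsPaletteColoring G p (insert x A) π' := by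
  classical
  obtain ⟨i, hi, -, -, hiA⟩ := hp.exists_port 0 0 hxA
    (fun w _ hxw => by have := hp.three_le hxw; grind)
  obtain ⟨j, hj, hji, -⟩ := exists_port_ne i i
  obtain ⟨a, ha, hai, -⟩ := exists_portPerm_pair hi hj hji.symm
  obtain ⟨σ, hσ⟩ := hp.exists_anchor π hiA
  obtain ⟨ξ, hξ⟩ := exists_compat_one σ
  exact ⟨_, h.insert hx (hσ ξ a hξ ha hai)⟩

theorem IsPortMap.extend_path (hp : IsPortMap G p) (h : IsPaletteColoring G p A π) {x y : V}
    (hxy : G.Adj x y) (hx : x ∉ A) (hy : y ∉ A) (hxA : {w | w ∈ A ∧ G.Adj x w}.Subsingleton)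
    (hyA : {w | w ∈ A ∧ G.Adj y w}.Subsingleton) :
    ∃ π', IsPaletteColoring G p (insert x (insert y A)) π' := by
  classical
  obtain ⟨i, hi, hij, -, hiA⟩ := hp.exists_port (p x y) (p x y) hxA (fun w hw hxw =>
    and_self_iff.mpr fun he => hy (hp.inj hxw hxy he ▸ hw))
  obtain ⟨i', hi', hij', -, hiA'⟩ := hp.exists_port (p y x) (p y x) hyA (fun w hw hyw =>
    and_self_iff.mpr fun he => hx (hp.inj hyw hxy.symm he ▸ hw))
  obtain ⟨a, ha, hai, haj⟩ := exists_portPerm_pair hi (hp.three_le hxy) hij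
  obtain ⟨b, hb, hbi, hbj⟩ := exists_portPerm_pair hi' (hp.three_le hxy.symm) hij'
  obtain ⟨σ, hσ⟩ := hp.exists_anchor π hiA
  obtain ⟨τ, hτ⟩ := hp.exists_anchor π hiA'
  obtain ⟨ξ, υ, hξ, hυ, hξυ⟩ := exists_compat_path σ τ
  refine ⟨_, (h.insert hy (hτ υ b hυ hb hbi)).insert (x := x) (ρ := ξ * a) ?_ ?_⟩
  · rintro (rfl | hxA')
    · exact hxy.ne rfl
    · exact hx hxA'
  · rintro w (rfl | hw) hxw
    · simpa using hξυ.mul_right ha hb haj hbj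
    · have hwy : w ≠ y := fun he => hy (he ▸ hw)
      simpa [hwy] using hσ ξ a hξ ha hai w hw hxw

theorem IsPortMap.extend_triangle (hp : IsPortMap G p) (h : IsPaletteColoring G p A π) {x y z : V}
    (hxy : G.Adj x y) (hxz : G.Adj x z) (hyz : G.Adj y z) (hx : x ∉ A) (hy : y ∉ A) (hz : z ∉ A)
    (hxA : ∀ w ∈ A, ¬G.Adj x w) (hyA : {w | w ∈ A ∧ G.Adj y w}.Subsingleton)
    (hzA : {w | w ∈ A ∧ G.Adj z w}.Subsingleton) :
    ∃ π', IsPaletteColoring G p (insert x (insert y (insert z A))) π' := by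
  classical
  obtain ⟨i, hi, hiz, hix, hiA⟩ := hp.exists_port (p y z) (p y x) hyA (fun w hw hyw =>
    ⟨fun he => hz (hp.inj hyw hyz he ▸ hw), fun he => hx (hp.inj hyw hxy.symm he ▸ hw)⟩)
  obtain ⟨i', hi', hiy', hix', hiA'⟩ := hp.exists_port (p z y) (p z x) hzA (fun w hw hzw =>
    ⟨fun he => hy (hp.inj hzw hyz.symm he ▸ hw), fun he => hx (hp.inj hzw hxz.symm he ▸ hw)⟩)
  obtain ⟨a, ha, hay, haz⟩ := exists_portPerm_pair (hp.three_le hxy) (hp.three_le hxz)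
    (fun he => hyz.ne (hp.inj hxy hxz he))
  obtain ⟨b, hb, hbi, hbz, hbx⟩ := exists_portPerm hi (hp.three_le hyz) (hp.three_le hxy.symm)
    hiz hix (fun he => hxz.ne' (hp.inj hyz hxy.symm he))
  obtain ⟨c, hc, hci, hcy, hcx⟩ := exists_portPerm hi' (hp.three_le hyz.symm)
    (hp.three_le hxz.symm) hiy' hix' (fun he => hxy.ne' (hp.inj hyz.symm hxz.symm he))
  obtain ⟨σ, hσ⟩ := hp.exists_anchor π hiA
  obtain ⟨τ, hτ⟩ := hp.exists_anchor π hiA'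
  obtain ⟨ξ, υ, ζ, hυ, hζ, hυζ, hξυ, hξζ⟩ := exists_compat_triangle σ τ
  refine ⟨_, ((h.insert hz (hτ ζ c hζ hc hci)).insert (x := y) (ρ := υ * b) ?_ ?_).insert
    (x := x) (ρ := ξ * a) ?_ ?_⟩
  · rintro (rfl | hyA')
    · exact hyz.ne rfl
    · exact hy hyA'
  · rintro w (rfl | hw) hyw
    · simpa using hυζ.mul_right hb hc hbz hcy
    · have hwz : w ≠ z := fun he => hz (he ▸ hw)
      simpa [hwz] using hσ υ b hυ hb hbi w hw hyw
  · rintro (rfl | rfl | hxA')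
    · exact hxy.ne rfl
    · exact hxz.ne rfl
    · exact hx hxA'
  · rintro w (rfl | rfl | hw) hxw
    · simpa using hξυ.mul_right ha hb hay hbx
    · simpa [hyz.ne'] using hξζ.mul_right ha hc haz hcx
    · exact (hxA w hw hxw).elim

end Extension

theorem subsingleton_neighbors_of_ncard_le_three [Finite V] {G : SimpleGraph V} {x y z : V}
    (hdeg : (G.neighborSet y).ncard ≤ 3) (hyx : G.Adj y x) (hyz : G.Adj y z) (hxz : x ≠ z) :
    {w | w ≠ x ∧ w ≠ z ∧ G.Adj y w}.Subsingleton := by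
  classical
  rintro u ⟨hux, huz, hyu⟩ w ⟨hwx, hwz, hyw⟩
  by_contra huw
  have hsub : (({x, z, u, w} : Finset V) : Set V) ⊆ G.neighborSet y := by
    intro t
    simp only [Finset.coe_insert, Finset.coe_singleton, mem_neighborSet]
    rintro (rfl | rfl | rfl | rfl) <;> assumption
  have hle := (Set.ncard_le_ncard hsub).trans hdeg
  rw [Set.ncard_coe_finset, Finset.card_insert_of_notMem (by simp [hxz, hux.symm, hwx.symm]),
    Finset.card_insert_of_notMem (by simp [huz.symm, hwz.symm]), Finset.card_pair huw] at hle
  omega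

theorem exists_isPaletteColoring [Fintype V] {G : SimpleGraph V} (hG : G.Outerplanar)
    (hdeg : ∀ v, (G.neighborSet v).ncard ≤ 3) {p : V → V → Fin 6} (hp : IsPortMap G p)
    (A : Finset V) : ∃ π, IsPaletteColoring G p A π := by
  classical
  obtain ⟨r, hr⟩ := hG
  induction A using Finset.strongInduction with
  | H A ih =>
    rcases A.eq_empty_or_nonempty with rfl | hA
    · exact ⟨1, fun u hu => by simp at hu⟩
    rcases @exists_reducible_of_noncrossing V r G hr A hA with
      ⟨x, hx, hxA⟩ | ⟨x, hx, y, hy, hxy, hxA, hyA⟩ | ⟨x, hx, y, hy, z, hz, hxy, hxz, hyz, hxA⟩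
    · obtain ⟨π, hπ⟩ := ih (A \ {x}) (Finset.sdiff_ssubset (by simpa) (by simp))
      obtain ⟨π', hπ'⟩ := hp.extend_one hπ (x := x) (by simp)
        (hxA.anti fun w => by simp +contextual)
      exact ⟨π', hπ'.mono fun w => by simp; tauto⟩
    · obtain ⟨π, hπ⟩ := ih (A \ {x, y})
        (Finset.sdiff_ssubset (by simp [Finset.insert_subset_iff, *]) (by simp))
      obtain ⟨π', hπ'⟩ := hp.extend_path hπ hxy (by simp) (by simp)
        (hxA.anti fun w => by simp +contextual) (hyA.anti fun w => by simp +contextual)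
      exact ⟨π', hπ'.mono fun w => by simp; tauto⟩
    · obtain ⟨π, hπ⟩ := ih (A \ {x, y, z})
        (Finset.sdiff_ssubset (by simp [Finset.insert_subset_iff, *]) (by simp))
      obtain ⟨π', hπ'⟩ := hp.extend_triangle hπ hxy hxz hyz (by simp) (by simp) (by simp)
        (fun w hw hxw => by have := hxA w; simp at hw; tauto)
        ((subsingleton_neighbors_of_ncard_le_three (hdeg y) hxy.symm hyz hxz.ne).anti
          fun w => by simp +contextual)
        ((subsingleton_neighbors_of_ncard_le_three (hdeg z) hxz.symm hyz.symm hxy.ne).anti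
          fun w => by simp +contextual)
      exact ⟨π', hπ'.mono fun w => by simp; tauto⟩

theorem IsPaletteColoring.chiViS_two_le {G : SimpleGraph V} {p : V → V → Fin 6}
    {π : V → Perm (Fin 6)} (hp : IsPortMap G p) (h : IsPaletteColoring G p Set.univ π) :
    G.chiViS 2 ≤ 6 := by
  classical
  let cI (v : V) (e : Sym2 V) : Fin 6 :=
    if hv : v ∈ e then π v (p v (Sym2.Mem.other hv)) else 0
  have hcI (v w : V) : cI v s(v, w) = π v (p v w) := by
    have hv : v ∈ s(v, w) := Sym2.mem_mk_left v w
    have : Sym2.Mem.other hv = w := Sym2.congr_right.mp (Sym2.other_spec hv)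
    simp only [cI, dif_pos hv, this]
  have compat {u v : V} (huv : G.Adj u v) := h (Set.mem_univ u) (Set.mem_univ v) huv
  have inc {v : V} {e : Sym2 V} (he : G.IsIncidence v e) : ∃ w, e = s(v, w) ∧ G.Adj v w := by
    obtain ⟨w, rfl⟩ := he.2
    exact ⟨w, rfl, he.1⟩
  have port_ne {u v : V} (huv : G.Adj u v) : p u v ≠ 0 ∧ p u v ≠ 1 ∧ p u v ≠ 2 := by
    have := hp.three_le huv
    refine ⟨?_, ?_, ?_⟩ <;> rintro he <;> rw [he] at this <;> revert this <;> decide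
  have out_ne_in {u v w : V} (huv : G.Adj u v) (huw : G.Adj u w) :
      π v (p v u) ≠ π u (p u w) := by
    obtain ⟨-, h1, h2⟩ := port_ne huw
    rcases (compat huv).2.2 with he | he <;> rw [he] <;> intro he'
    · exact h1 ((π u).injective he').symm
    · exact h2 ((π u).injective he').symm
  refine Nat.sInf_le ⟨fun v => π v 0, cI, ⟨fun u v huv => (compat huv).1, ?_, ?_⟩, fun u => ?_⟩
  · intro u w f hf hu
    obtain ⟨v, rfl, hwv⟩ := inc hf
    rw [hcI]
    rcases Sym2.mem_iff.mp hu with rfl | rfl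
    · exact fun he => (port_ne hwv).1 ((π u).injective he).symm
    · rcases (compat hwv).2.1 with he | he <;> rw [he] <;> simp
  · intro v e w f he hf hne hvw
    obtain ⟨a, rfl, hva⟩ := inc he
    obtain ⟨b, rfl, hwb⟩ := inc hf
    rw [hcI, hcI]
    by_cases hvw' : v = w
    · subst hvw'
      intro he'
      exact hne (by rw [hp.inj hva hwb ((π v).injective he')])
    · have : a = w ∨ b = v := by
        simp only [Sym2.eq_iff] at hvw
        grind
      rcases this with rfl | rfl
      · exact out_ne_in hva.symm hwb
      · exact (out_ne_in hwb.symm hva).symm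
  · have hsub : G.secondIncColors cI u ⊆ ({π u 1, π u 2} : Finset (Fin 6)) := by
      rintro _ ⟨v, huv, rfl⟩
      rw [Sym2.eq_swap, hcI]
      simpa using (compat huv).2.2
    refine (Set.ncard_le_ncard hsub (Finset.finite_toSet _)).trans ?_
    rw [Set.ncard_coe_finset]
    exact Finset.card_le_two

/-- If `G` is a finite outerplanar graph with `Δ(G) = 3`, then `χ_{vi,2}(G) ≤ 6`. -/
theorem chiViS_two_le_six [Fintype V] (G : SimpleGraph V) (hG : G.Outerplanar)
    (hΔ : G.maxDeg = 3) :
    G.chiViS 2 ≤ 6 := by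
  have hdeg (v : V) : (G.neighborSet v).ncard ≤ 3 :=
    (Finset.le_sup (f := fun v => (G.neighborSet v).ncard) (Finset.mem_univ v)).trans hΔ.le
  obtain ⟨p, hp⟩ := exists_isPortMap hdeg
  obtain ⟨π, hπ⟩ := exists_isPaletteColoring hG hdeg hp Finset.univ
  exact (hπ.mono (by simp)).chiViS_two_le hp
end

section
/- For every finite outerplanar graph G, the vi-simultaneous chromatic number satisfies χ_vi(G) ≤ Δ(G) + 3. -/
open SimpleGraph

variable {V : Type*}

/-- The sequence `p, s, b, ?, ?, ?, ?, a, t, q` can be filled so that entries at distance at most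
three differ, given that this holds for `p, s, b` and for `a, t, q`. -/
def Bridge {k : ℕ} (p s b q t a : Fin k) : Prop :=
  ∃ X, (X ≠ p ∧ X ≠ s ∧ X ≠ b) ∧ ∃ Y, (Y ≠ q ∧ Y ≠ t ∧ Y ≠ a ∧ Y ≠ X) ∧
    ∃ μ, (μ ≠ s ∧ μ ≠ b ∧ μ ≠ X ∧ μ ≠ Y ∧ μ ≠ a) ∧
      ∃ β, β ≠ b ∧ β ≠ X ∧ β ≠ Y ∧ β ≠ μ ∧ β ≠ a ∧ β ≠ t

/-- For distinct `p, i, n` and distinct `q, j, m`, colours `s`, `b` and `t`, `a` that can be joined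
by a bridge from `p` to `q` exist, where `b` and `a` come from palettes `{n, s'}` and `{m, t'}`. -/
def Bridgeable {k : ℕ} (p i n q j m : Fin k) : Prop :=
  ∃ s, (s ≠ p ∧ s ≠ i ∧ s ≠ n) ∧ ∃ s', (s' ≠ p ∧ s' ≠ i ∧ s' ≠ n ∧ s' ≠ s) ∧
    ∃ t, (t ≠ q ∧ t ≠ j ∧ t ≠ m) ∧ ∃ t', (t' ≠ q ∧ t' ≠ j ∧ t' ≠ m ∧ t' ≠ t) ∧
      ∃ b, (b = n ∨ b = s') ∧ ∃ a, (a = m ∨ a = t') ∧ Bridge p s b q t a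

instance {k : ℕ} (p s b q t a : Fin k) : Decidable (Bridge p s b q t a) := by
  unfold Bridge; infer_instance

instance {k : ℕ} (p i n q j m : Fin k) : Decidable (Bridgeable p i n q j m) := by
  unfold Bridgeable; infer_instance

theorem Bridgeable.of_perm {k : ℕ} (σ : Equiv.Perm (Fin k)) {p i n q j m : Fin k}
    (h : Bridgeable (σ p) (σ i) (σ n) (σ q) (σ j) (σ m)) : Bridgeable p i n q j m := by
  obtain ⟨s, hs, s', hs', t, ht, t', ht', b, hb, a, ha, X, hX, Y, hY, μ, hμ, β, hβ⟩ := h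
  obtain ⟨s, rfl⟩ := σ.surjective s
  obtain ⟨s', rfl⟩ := σ.surjective s'
  obtain ⟨t, rfl⟩ := σ.surjective t
  obtain ⟨t', rfl⟩ := σ.surjective t'
  obtain ⟨b, rfl⟩ := σ.surjective b
  obtain ⟨a, rfl⟩ := σ.surjective a
  obtain ⟨X, rfl⟩ := σ.surjective X
  obtain ⟨Y, rfl⟩ := σ.surjective Y
  obtain ⟨μ, rfl⟩ := σ.surjective μ
  obtain ⟨β, rfl⟩ := σ.surjective β
  simp only [ne_eq, σ.injective.eq_iff] at hs hs' ht ht' hb ha hX hY hμ hβ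
  exact ⟨s, hs, s', hs', t, ht, t', ht', b, hb, a, ha, X, hX, Y, hY, μ, hμ, β, hβ⟩

theorem bridgeable_zero_one_two : ∀ q j : Fin 5, q ≠ j → ∀ m, q ≠ m ∧ j ≠ m →
    ¬(q = 2 ∧ j = 1 ∧ m = 0) → Bridgeable 0 1 2 q j m := by
  decide +kernel

theorem bridgeable_of_ne {p i n q j m : Fin 5} (hpi : p ≠ i) (hpn : p ≠ n) (hin : i ≠ n)
    (hqj : q ≠ j) (hqm : q ≠ m) (hjm : j ≠ m) (h : ¬(q = n ∧ j = i ∧ m = p)) :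
    Bridgeable p i n q j m := by
  have hinj : Function.Injective ![p, i, n] := by
    intro a b; fin_cases a <;> fin_cases b <;> simp_all [eq_comm]
  have hinj' : Function.Injective ![(0 : Fin 5), 1, 2] := by decide
  have := Equiv.Perm.isMultiplyPretransitive (Fin 5) 3
  obtain ⟨σ, hσ⟩ := MulAction.exists_smul_eq (Equiv.Perm (Fin 5))
    (⟨_, hinj⟩ : Fin 3 ↪ Fin 5) ⟨_, hinj'⟩
  have h0 : σ p = 0 := by simpa using DFunLike.congr_fun hσ 0
  have h1 : σ i = 1 := by simpa using DFunLike.congr_fun hσ 1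
  have h2 : σ n = 2 := by simpa using DFunLike.congr_fun hσ 2
  refine .of_perm σ ?_
  rw [h0, h1, h2]
  refine bridgeable_zero_one_two _ _ (σ.injective.ne hqj) _
    ⟨σ.injective.ne hqm, σ.injective.ne hjm⟩ ?_
  rw [← h0, ← h1, ← h2]
  simpa only [σ.injective.eq_iff] using h

theorem exists_notMem_list {k : ℕ} (l : List (Fin k)) (h : l.length < k) : ∃ a, a ∉ l := by
  classical
  by_contra! hl
  have h1 : (Finset.univ : Finset (Fin k)) ⊆ l.toFinset := fun a _ => by simpa using hl a
  have h2 := (Finset.card_le_card h1).trans l.toFinset_card_le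
  simp at h2
  omega

theorem bridge_of_six_le {k : ℕ} (hk : 6 ≤ k) {p s q t : Fin k} {N M : Finset (Fin k)}
    (hN : N.card = 2) (hM : M.card = 2) (hps : s ≠ p) (hqt : t ≠ q) (hp : p ∉ N) (hs : s ∉ N)
    (hq : q ∉ M) (ht : t ∉ M) : ∃ b ∈ N, ∃ a ∈ M, Bridge p s b q t a := by
  -- it suffices to choose `X` and `Y` so that a colour is repeated among `b, X, Y, a`
  have key : ∀ b a X Y : Fin k, X ≠ p → X ≠ s → X ≠ b → Y ≠ q → Y ≠ t → Y ≠ a → Y ≠ X →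
      (X = a ∨ Y = b ∨ b = a) → Bridge p s b q t a := by
    intro b a X Y hXp hXs hXb hYq hYt hYa hYX h
    obtain ⟨u, hu⟩ : ∃ u, ∀ z, z ∉ [u, X, Y] → z ≠ b ∧ z ≠ X ∧ z ≠ Y ∧ z ≠ a := by
      rcases h with rfl | rfl | rfl
      · exact ⟨b, by simp; tauto⟩
      · exact ⟨a, by simp; tauto⟩
      · exact ⟨b, by simp; tauto⟩
    obtain ⟨μ, hμ⟩ := exists_notMem_list [s, u, X, Y] (by simp; omega)
    obtain ⟨β, hβ⟩ := exists_notMem_list [t, μ, u, X, Y] (by simp; omega)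
    have h1 := hu μ (by simp at hμ ⊢; tauto)
    have h2 := hu β (by simp at hβ ⊢; tauto)
    simp only [List.mem_cons, List.not_mem_nil, or_false, not_or] at hμ hβ
    exact ⟨X, ⟨hXp, hXs, hXb⟩, Y, ⟨hYq, hYt, hYa, hYX⟩, μ,
      ⟨hμ.1, h1.1, h1.2.1, h1.2.2.1, h1.2.2.2⟩, β, h2.1, h2.2.1, h2.2.2.1, hβ.2.1, h2.2.2.2, hβ.1⟩
  obtain ⟨b₀, hb₀⟩ : N.Nonempty := Finset.card_pos.1 (by omega)
  obtain ⟨a₀, ha₀⟩ : M.Nonempty := Finset.card_pos.1 (by omega)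
  by_cases h1 : ∃ a ∈ N, a ∈ M
  · obtain ⟨a, haN, haM⟩ := h1
    obtain ⟨X, hX⟩ := exists_notMem_list [p, s, a] (by simp; omega)
    obtain ⟨Y, hY⟩ := exists_notMem_list [q, t, a, X] (by simp; omega)
    simp only [List.mem_cons, List.not_mem_nil, or_false, not_or] at hX hY
    exact ⟨a, haN, a, haM, key a a X Y hX.1 hX.2.1 hX.2.2 hY.1 hY.2.1 hY.2.2.1 hY.2.2.2 (by simp)⟩
  push Not at h1
  by_cases h2 : ∃ a ∈ M, a ≠ p ∧ a ≠ s
  · obtain ⟨a, haM, hap, has⟩ := h2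
    obtain ⟨Y, hY⟩ := exists_notMem_list [q, t, a] (by simp; omega)
    simp only [List.mem_cons, List.not_mem_nil, or_false, not_or] at hY
    exact ⟨b₀, hb₀, a, haM, key b₀ a a Y hap has (fun h => h1 _ hb₀ (h ▸ haM)) hY.1 hY.2.1
      hY.2.2 hY.2.2 (by simp)⟩
  by_cases h3 : ∃ b ∈ N, b ≠ q ∧ b ≠ t
  · obtain ⟨b, hbN, hbq, hbt⟩ := h3
    obtain ⟨X, hX⟩ := exists_notMem_list [p, s, b] (by simp; omega)
    simp only [List.mem_cons, List.not_mem_nil, or_false, not_or] at hX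
    exact ⟨b, hbN, a₀, ha₀, key b a₀ X b hX.1 hX.2.1 hX.2.2 hbq hbt (fun h => h1 _ hbN (h ▸ ha₀))
      (Ne.symm hX.2.2) (by simp)⟩
  have hM' : M = {p, s} := Finset.eq_of_subset_of_card_le (fun a ha => by
    simp only [Finset.mem_insert, Finset.mem_singleton]; by_contra! h; exact h2 ⟨a, ha, h⟩)
    (by rw [hM]; exact Finset.card_le_two)
  have hN' : N = {q, t} := Finset.eq_of_subset_of_card_le (fun a ha => by
    simp only [Finset.mem_insert, Finset.mem_singleton]; by_contra! h; exact h3 ⟨a, ha, h⟩)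
    (by rw [hN]; exact Finset.card_le_two)
  subst hM' hN'
  simp only [Finset.mem_insert, Finset.mem_singleton, not_or] at hp hs hq ht
  obtain ⟨X, hX⟩ := exists_notMem_list [p, s, q, t] (by simp; omega)
  obtain ⟨β, hβ⟩ := exists_notMem_list [q, X, s, t, p] (by simp; omega)
  simp only [List.mem_cons, List.not_mem_nil, or_false, not_or] at hX hβ
  refine ⟨q, by simp, p, by simp, X, ?_, s, ?_, t, ?_, β, ?_⟩ <;> grind

namespace SimpleGraph

variable {G : SimpleGraph V} {k : ℕ} {S : Set V} {c : V → Fin k} {f : V → V → Fin k}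
  {v x y z : V} {N : Finset (Fin k)} {α : Fin k}

/-- `N` is a set of two colours containing all colours `f u v` of the second incidences of `v`
in `G[S]`, and avoiding the colours of `v` and of its first incidences. -/
structure IsPalette (G : SimpleGraph V) (S : Set V) (c : V → Fin k) (f : V → V → Fin k) (v : V)
    (N : Finset (Fin k)) : Prop where
  card : N.card = 2
  self : c v ∉ N
  first : ∀ u ∈ S, G.Adj v u → f v u ∉ N
  second : ∀ u ∈ S, G.Adj v u → f u v ∈ N

/-- The colour `α` may be given to a new first incidence of `v`. -/
structure IsFreeColor (G : SimpleGraph V) (S : Set V) (c : V → Fin k) (f : V → V → Fin k) (v : V)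
    (N : Finset (Fin k)) (α : Fin k) : Prop where
  notMem : α ∉ N
  ne_self : α ≠ c v
  ne_first : ∀ u ∈ S, G.Adj v u → f v u ≠ α

/-- A vi-simultaneous coloring of `G[S]`, with `f v u` the colour of the incidence `(v, vu)`,
in which second incidences of each vertex have at most two colours. -/
structure IsPaletteColoring (G : SimpleGraph V) (S : Set V) (c : V → Fin k) (f : V → V → Fin k) :
    Prop where
  palette : ∀ v ∈ S, ∃ N, G.IsPalette S c f v N
  vert : ∀ v ∈ S, ∀ u ∈ S, G.Adj v u → c v ≠ c u
  inc : ∀ v ∈ S, ∀ u ∈ S, G.Adj v u → f v u ≠ c v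
  inj : ∀ v ∈ S, ∀ u ∈ S, ∀ u' ∈ S, G.Adj v u → G.Adj v u' → u ≠ u' → f v u ≠ f v u'

open Classical in
/-- Extend the vertex colouring `c` by giving `x` the colour `a`. -/
noncomputable def extendVert (c : V → Fin k) (x : V) (a : Fin k) : V → Fin k :=
  fun v => if v = x then a else c v

open Classical in
/-- Extend the incidence colouring `f` by `g u` on `(u, ux)` and `h u` on `(x, xu)`. -/
noncomputable def extendInc (f : V → V → Fin k) (x : V) (g h : V → Fin k) : V → V → Fin k :=
  fun v w => if v = x then h w else if w = x then g v else f v w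

theorem IsPalette.insert_of_not_adj (hN : G.IsPalette S c f v N) (hv : v ≠ x) (h : ¬ G.Adj v x)
    (a : Fin k) (g h' : V → Fin k) :
    G.IsPalette (insert x S) (extendVert c x a) (extendInc f x g h') v N := by
  obtain ⟨h1, h2, h3, h4⟩ := hN
  constructor <;> grind [extendVert, extendInc]

theorem IsPalette.insert_of_mem {a : Fin k} {g h : V → Fin k} (hN : G.IsPalette S c f v N)
    (hv : v ≠ x) (hg : g v ∉ N) (hh : h v ∈ N) :
    G.IsPalette (insert x S) (extendVert c x a) (extendInc f x g h) v N := by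
  obtain ⟨h1, h2, h3, h4⟩ := hN
  constructor <;> grind [extendVert, extendInc]

theorem IsFreeColor.insert_of_not_adj (hα : G.IsFreeColor S c f v N α) (hv : v ≠ x)
    (h : ¬ G.Adj v x) (a : Fin k) (g h' : V → Fin k) :
    G.IsFreeColor (insert x S) (extendVert c x a) (extendInc f x g h') v N α := by
  obtain ⟨h1, h2, h3⟩ := hα
  constructor <;> grind [extendVert, extendInc]

theorem IsFreeColor.insert_of_ne {a : Fin k} {g h : V → Fin k} (hα : G.IsFreeColor S c f v N α)
    (hv : v ≠ x) (hg : g v ≠ α) :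
    G.IsFreeColor (insert x S) (extendVert c x a) (extendInc f x g h) v N α := by
  obtain ⟨h1, h2, h3⟩ := hα
  constructor <;> grind [extendVert, extendInc]

theorem IsPalette.insert_self {a : Fin k} {g h : V → Fin k} (hN : N.card = 2)
    (ha : a ∉ N) (hg : ∀ u ∈ S, G.Adj x u → g u ∈ N) (hh : ∀ u ∈ S, G.Adj x u → h u ∉ N) :
    G.IsPalette (insert x S) (extendVert c x a) (extendInc f x g h) x N := by
  constructor <;> grind [extendVert, extendInc, SimpleGraph.irrefl]

theorem IsPaletteColoring.insert {a : Fin k} {g h : V → Fin k} (hf : G.IsPaletteColoring S c f)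
    (hx : x ∉ S) (hN : N.card = 2) (haN : a ∉ N) (hg : ∀ u ∈ S, G.Adj x u → g u ∈ N)
    (hh : ∀ u ∈ S, G.Adj x u → h u ∉ N) (hha : ∀ u ∈ S, G.Adj x u → h u ≠ a)
    (hac : ∀ u ∈ S, G.Adj x u → a ≠ c u)
    (hinj : ∀ u ∈ S, ∀ u' ∈ S, G.Adj x u → G.Adj x u' → u ≠ u' → h u ≠ h u')
    (hM : ∀ u ∈ S, G.Adj x u → ∃ M, G.IsPalette S c f u M ∧ G.IsFreeColor S c f u M (g u) ∧
      h u ∈ M) :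
    G.IsPaletteColoring (insert x S) (extendVert c x a) (extendInc f x g h) := by
  obtain ⟨h1, h2, h3, h4⟩ := hf
  constructor
  · rintro v (rfl | hv)
    · exact ⟨N, .insert_self hN haN hg hh⟩
    · have hvx : v ≠ x := fun h => hx (h ▸ hv)
      by_cases hvx' : G.Adj x v
      · obtain ⟨M, hM1, hM2, hM3⟩ := hM v hv hvx'
        exact ⟨M, hM1.insert_of_mem hvx hM2.notMem hM3⟩
      · obtain ⟨M, hM⟩ := h1 v hv
        exact ⟨M, hM.insert_of_not_adj hvx (fun h => hvx' h.symm) _ _ _⟩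
  · intro v hv u hu hvu
    have := hvu.ne
    have := hvu.symm
    grind [extendVert]
  · intro v hv u hu hvu
    have := hvu.ne
    have := hvu.symm
    have h5 : ∀ u ∈ S, G.Adj x u → g u ≠ c u := fun u hu h => by
      obtain ⟨M, -, hM, -⟩ := hM u hu h
      exact hM.ne_self
    grind [extendVert, extendInc]
  · intro v hv u hu u' hu' hvu hvu' hne
    have := hvu.ne
    have := hvu.symm
    have := hvu'.ne
    have := hvu'.symm
    have h5 : ∀ u ∈ S, G.Adj x u → ∀ w ∈ S, G.Adj u w → f u w ≠ g u := fun u hu h => by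
      obtain ⟨M, -, hM, -⟩ := hM u hu h
      exact hM.ne_first
    grind [extendVert, extendInc]

theorem exists_palette {k : ℕ} (hk : 5 ≤ k) {α β a μ ν : Fin k} (h1 : a ≠ α) (h2 : a ≠ β)
    (h3 : μ ≠ α) (h4 : μ ≠ β) (h5 : ν ≠ α) (h6 : ν ≠ β) :
    ∃ N : Finset (Fin k), N.card = 2 ∧ α ∈ N ∧ β ∈ N ∧ a ∉ N ∧ μ ∉ N ∧ ν ∉ N := by
  classical
  by_cases h : α = β
  · obtain ⟨b, hb⟩ := exists_notMem_list [α, a, μ, ν] (by simp; omega)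
    simp only [List.mem_cons, List.not_mem_nil, or_false, not_or] at hb
    refine ⟨{α, b}, Finset.card_pair (Ne.symm hb.1), ?_⟩
    simp; grind
  · refine ⟨{α, β}, Finset.card_pair h, ?_⟩
    simp; grind

/-- Adding a vertex `x` with two neighbours `y` and `z`. -/
theorem IsPaletteColoring.exists_insert_two (hf : G.IsPaletteColoring S c f) (hk : 5 ≤ k)
    (hx : x ∉ S) (hyz : y ≠ z) (hxS : ∀ u ∈ S, G.Adj x u → u = y ∨ u = z)
    {N M : Finset (Fin k)} {α β μ ν a : Fin k}
    (hN : G.IsPalette S c f y N) (hM : G.IsPalette S c f z M) (hα : G.IsFreeColor S c f y N α)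
    (hβ : G.IsFreeColor S c f z M β) (hμ : μ ∈ N) (hν : ν ∈ M) (hμν : μ ≠ ν) (hμβ : μ ≠ β)
    (hνα : ν ≠ α) (hay : a ≠ c y) (haz : a ≠ c z) (haα : a ≠ α) (haβ : a ≠ β) (haμ : a ≠ μ)
    (haν : a ≠ ν) :
    ∃ (c' : V → Fin k) (f' : V → V → Fin k), G.IsPaletteColoring (Insert.insert x S) c' f' := by
  classical
  have hμα : μ ≠ α := fun h => hα.notMem (h ▸ hμ)
  have hνβ : ν ≠ β := fun h => hβ.notMem (h ▸ hν)
  obtain ⟨P, hP, hαP, hβP, haP, hμP, hνP⟩ := exists_palette hk haα haβ hμα hμβ hνα hνβ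
  refine ⟨_, _, hf.insert (a := a) (g := fun u => if u = y then α else β)
    (h := fun u => if u = y then μ else ν) hx hP haP ?_ ?_ ?_ ?_ ?_ ?_⟩
  · intro u hu hxu
    split_ifs <;> assumption
  · intro u hu hxu
    split_ifs <;> assumption
  · intro u hu hxu
    split_ifs <;> grind
  · intro u hu hxu
    obtain rfl | rfl := hxS u hu hxu <;> assumption
  · intro u hu u' hu' hxu hxu' hne
    obtain rfl | rfl := hxS u hu hxu <;> obtain rfl | rfl := hxS u' hu' hxu' <;> grind
  · intro u hu hxu
    obtain rfl | rfl := hxS u hu hxu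
    · exact ⟨N, hN, by simpa using hα, by simpa using hμ⟩
    · exact ⟨M, hM, by simpa [hyz.symm] using hβ, by simpa [hyz.symm] using hν⟩

theorem IsPalette.exists_isFreeColor [Finite V] (hN : G.IsPalette S c f v N) (hx : x ∉ S)
    (hvx : G.Adj v x) (hdeg : ∀ T : Finset V, (∀ u ∈ T, G.Adj v u) → T.card + 3 ≤ k) :
    ∃ α, G.IsFreeColor S c f v N α := by
  classical
  have := Fintype.ofFinite V
  set T : Finset V := Finset.univ.filter fun u => u ∈ S ∧ G.Adj v u with hT
  have h1 := hdeg (Insert.insert x T) (by simp [hT, hvx])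
  rw [Finset.card_insert_of_notMem (by simp [hT, hx])] at h1
  obtain ⟨α, hα⟩ := exists_notMem_list (c v :: (N.toList ++ T.toList.map (f v)))
    (by simp [hN.card]; omega)
  simp only [List.mem_cons, List.mem_append, Finset.mem_toList, List.mem_map, not_or, not_exists,
    not_and] at hα
  exact ⟨α, hα.2.1, hα.1, fun u hu hvu => hα.2.2 u (by simp [hT, hu, hvu])⟩

/-- Adding a vertex of degree at most one. -/
theorem IsPaletteColoring.exists_insert_leaf [Finite V] (hf : G.IsPaletteColoring S c f)
    (hk : 3 ≤ k) (hx : x ∉ S) (hxS : ∀ u ∈ S, ∀ u' ∈ S, G.Adj x u → G.Adj x u' → u = u')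
    (hdeg : ∀ v, ∀ T : Finset V, (∀ u ∈ T, G.Adj v u) → T.card + 3 ≤ k) :
    ∃ (c' : V → Fin k) (f' : V → V → Fin k), G.IsPaletteColoring (Insert.insert x S) c' f' := by
  classical
  by_cases h : ∃ y ∈ S, G.Adj x y
  · obtain ⟨y, hy, hxy⟩ := h
    have hk4 : 4 ≤ k := by simpa using hdeg x {y} (by simpa using hxy)
    obtain ⟨N, hN⟩ := hf.palette y hy
    obtain ⟨α, hα⟩ := hN.exists_isFreeColor hx hxy.symm (hdeg y)
    obtain ⟨μ, hμ⟩ : N.Nonempty := Finset.card_pos.1 (by simp [hN.card])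
    have hμα : μ ≠ α := fun h => hα.notMem (h ▸ hμ)
    obtain ⟨a, ha⟩ := exists_notMem_list [c y, α, μ] (by simp; omega)
    obtain ⟨b, hb⟩ := exists_notMem_list [α, a, μ] (by simp; omega)
    simp only [List.mem_cons, List.not_mem_nil, or_false, not_or] at ha hb
    have huy : ∀ u ∈ S, G.Adj x u → u = y := fun u hu hxu => hxS u hu y hy hxu hxy
    refine ⟨_, _, hf.insert (a := a) (g := fun _ => α) (h := fun _ => μ) (N := {α, b}) hx
      (Finset.card_pair (Ne.symm hb.1)) (by simp; grind) (by simp) (by simp; grind)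
      (by grind) (by grind) (by grind) ?_⟩
    intro u hu hxu
    obtain rfl := huy u hu hxu
    exact ⟨N, hN, hα, hμ⟩
  · push Not at h
    obtain ⟨a, -⟩ := exists_notMem_list (k := k) [] (by simp; omega)
    obtain ⟨b, hb⟩ := exists_notMem_list [a] (by simp; omega)
    obtain ⟨b', hb'⟩ := exists_notMem_list [a, b] (by simp; omega)
    simp only [List.mem_cons, List.not_mem_nil, or_false, not_or] at hb hb'
    exact ⟨_, _, hf.insert (a := a) (g := fun _ => a) (h := fun _ => a) (N := {b, b'}) hx
      (Finset.card_pair (Ne.symm hb'.2)) (by simp; grind) (by grind) (by grind)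
      (by grind) (by grind) (by grind) (by grind)⟩

/-- Adding two adjacent vertices of degree two. -/
theorem IsPaletteColoring.exists_insert_bridge {w : V} (hf : G.IsPaletteColoring S c f) (hk : 5 ≤ k)
    (hy : y ∉ S) (hxS : x ∉ S) (hz : z ∈ S) (hw : w ∈ S) (hwz : w ≠ z)
    (hyz : G.Adj y z) (hyS : ∀ u ∈ S, G.Adj y u → u = z) (hxy : x ≠ y)
    (hxu : ∀ u ∈ S, G.Adj x u → u = w)
    {N M : Finset (Fin k)} {s b t a : Fin k} (hN : G.IsPalette S c f w N)
    (hM : G.IsPalette S c f z M) (hs : G.IsFreeColor S c f w N s) (ht : G.IsFreeColor S c f z M t)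
    (hb : b ∈ N) (ha : a ∈ M) (h : Bridge (c w) s b (c z) t a) :
    ∃ (c' : V → Fin k) (f' : V → V → Fin k),
      G.IsPaletteColoring (Insert.insert x (Insert.insert y S)) c' f' := by
  obtain ⟨X, hX, Y, hY, μ, hμ, β, hβ⟩ := h
  have hta : t ≠ a := fun h => ht.notMem (h ▸ ha)
  have hwy : w ≠ y := fun h => hy (h ▸ hw)
  have hwy' : ¬ G.Adj w y := fun h => hwz (hyS w hw h.symm)
  obtain ⟨P, hP, hμP, htP, hYP, haP, hβP⟩ := exists_palette hk (α := μ) (β := t) (a := Y)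
    (μ := a) (ν := β) (by grind) (by grind) (by grind) (by grind) (by grind) (by grind)
  have hf' := hf.insert (a := Y) (g := fun _ => t) (h := fun _ => a) hy hP hYP
    (fun _ _ _ => htP) (fun _ _ _ => haP) (by grind) (by grind) (by grind)
    (fun u hu hyu => by obtain rfl := hyS u hu hyu; exact ⟨M, hM, ht, ha⟩)
  refine hf'.exists_insert_two (x := x) (y := y) (z := w) (a := X) (μ := μ) (ν := b) hk
    (by simp [hxS, hxy]) hwy.symm ?_ (IsPalette.insert_self hP hYP ?_ ?_)
    (hN.insert_of_not_adj hwy hwy' _ _ _) (α := β) ?_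
    (hs.insert_of_not_adj hwy hwy' _ _ _) hμP hb ?_ ?_ ?_ ?_ ?_ ?_ ?_ ?_ ?_
  · grind
  · exact fun _ _ _ => htP
  · exact fun _ _ _ => haP
  · refine ⟨hβP, ?_, ?_⟩
    · simp only [extendVert]; grind
    · simp only [extendInc]; grind
  all_goals first | grind | (simp only [extendVert]; grind)

theorem IsPaletteColoring.exists_insert_pair_of_six_le [Finite V] {w : V}
    (hf : G.IsPaletteColoring S c f) (hk : 6 ≤ k)
    (hy : y ∉ S) (hxS : x ∉ S) (hz : z ∈ S) (hw : w ∈ S) (hwz : w ≠ z)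
    (hyz : G.Adj y z) (hxw : G.Adj x w) (hyS : ∀ u ∈ S, G.Adj y u → u = z) (hxy : x ≠ y)
    (hxu : ∀ u ∈ S, G.Adj x u → u = w)
    (hdeg : ∀ v, ∀ T : Finset V, (∀ u ∈ T, G.Adj v u) → T.card + 3 ≤ k) :
    ∃ (c' : V → Fin k) (f' : V → V → Fin k),
      G.IsPaletteColoring (Insert.insert x (Insert.insert y S)) c' f' := by
  obtain ⟨N, hN⟩ := hf.palette w hw
  obtain ⟨M, hM⟩ := hf.palette z hz
  obtain ⟨s, hs⟩ := hN.exists_isFreeColor hxS hxw.symm (hdeg w)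
  obtain ⟨t, ht⟩ := hM.exists_isFreeColor hy hyz.symm (hdeg z)
  obtain ⟨b, hb, a, ha, h⟩ := bridge_of_six_le hk hN.card hM.card hs.ne_self ht.ne_self hN.self
    hs.notMem hM.self ht.notMem
  exact hf.exists_insert_bridge (by omega) hy hxS hz hw hwz hyz hyS hxy hxu hN hM hs ht hb ha h

theorem IsPaletteColoring.exists_colors_of_five {c : V → Fin 5} {f : V → V → Fin 5}
    (hf : G.IsPaletteColoring S c f) (hv : v ∈ S)
    (huniq : ∀ u ∈ S, ∀ u' ∈ S, G.Adj v u → G.Adj v u' → u = u') :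
    ∃ i n d, c v ≠ i ∧ c v ≠ n ∧ i ≠ n ∧ d ≠ c v ∧ d ≠ i ∧ d ≠ n ∧
      (∀ c' : V → Fin 5, c' v ≠ i → c' v ≠ n →
        ∀ s s', s ≠ c' v → s ≠ i → s ≠ n → s' ≠ c' v → s' ≠ i → s' ≠ n → s' ≠ s →
        G.IsPalette S c' f v {n, s'} ∧ G.IsFreeColor S c' f v {n, s'} s) ∧
      G.IsPaletteColoring S (extendVert c v d) f := by
  obtain ⟨i, n, d, h1, h2, h3, h4, h5, h6, h7⟩ : ∃ i n d : Fin 5, c v ≠ i ∧ c v ≠ n ∧ i ≠ n ∧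
      d ≠ c v ∧ d ≠ i ∧ d ≠ n ∧
      ∀ u ∈ S, G.Adj v u → (f v u = i ∧ f u v = n) ∧ d ≠ c u := by
    by_cases h : ∃ u ∈ S, G.Adj v u
    · obtain ⟨u, hu, hvu⟩ := h
      obtain ⟨d, hd⟩ := exists_notMem_list [c v, f v u, f u v, c u] (by simp)
      simp only [List.mem_cons, List.not_mem_nil, or_false, not_or] at hd
      obtain ⟨N, hN⟩ := hf.palette v hv
      refine ⟨f v u, f u v, d, (hf.inc v hv u hu hvu).symm, ?_, ?_, hd.1, hd.2.1, hd.2.2.1, ?_⟩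
      · exact fun h => hN.self (h ▸ hN.second u hu hvu)
      · exact fun h => hN.first u hu hvu (h ▸ hN.second u hu hvu)
      · intro u' hu' hvu'
        obtain rfl := huniq u hu u' hu' hvu hvu'
        exact ⟨⟨rfl, rfl⟩, hd.2.2.2⟩
    · push Not at h
      obtain ⟨i, hi⟩ := exists_notMem_list [c v] (by simp)
      obtain ⟨n, hn⟩ := exists_notMem_list [c v, i] (by simp)
      obtain ⟨d, hd⟩ := exists_notMem_list [c v, i, n] (by simp)
      simp only [List.mem_cons, List.not_mem_nil, or_false, not_or] at hi hn hd
      exact ⟨i, n, d, by grind, by grind, by grind, by grind, by grind, by grind, by grind⟩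
  have key : ∀ c' : V → Fin 5, c' v ≠ i → c' v ≠ n →
      ∀ s s', s ≠ c' v → s ≠ i → s ≠ n → s' ≠ c' v → s' ≠ i → s' ≠ n → s' ≠ s →
      G.IsPalette S c' f v {n, s'} ∧ G.IsFreeColor S c' f v {n, s'} s := by
    intro c' hi hn s s' _ _ _ _ _ _ _
    refine ⟨⟨Finset.card_pair (by grind), by simp; grind, ?_, ?_⟩, ⟨by simp; grind, by grind, ?_⟩⟩
    · intro u hu hvu
      simp [(h7 u hu hvu).1.1]; grind
    · intro u hu hvu
      simp [(h7 u hu hvu).1.2]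
    · intro u hu hvu
      simp [(h7 u hu hvu).1.1]; grind
  have hd : extendVert c v d v = d := by simp [extendVert]
  refine ⟨i, n, d, h1, h2, h3, h4, h5, h6, key, ?_, ?_, ?_, hf.inj⟩
  · intro u hu
    by_cases huv : u = v
    · subst huv
      obtain ⟨s, hs⟩ := exists_notMem_list [d, i, n] (by simp)
      obtain ⟨s', hs'⟩ := exists_notMem_list [d, i, n, s] (by simp)
      simp only [List.mem_cons, List.not_mem_nil, or_false, not_or] at hs hs'
      exact ⟨_, (key (extendVert c u d) (by rwa [hd]) (by rwa [hd]) s s' (by rw [hd]; tauto)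
        (by tauto) (by tauto) (by rw [hd]; tauto) (by tauto) (by tauto) (by tauto)).1⟩
    · obtain ⟨N, hN⟩ := hf.palette u hu
      exact ⟨N, hN.card, by simpa [extendVert, huv] using hN.self, hN.first, hN.second⟩
  · intro u hu u' hu' huu'
    have := hf.vert u hu u' hu' huu'
    have := huu'.ne
    have := huu'.symm
    grind [extendVert]
  · intro u hu u' hu' huu'
    have := hf.inc u hu u' hu' huu'
    grind [extendVert]

theorem IsPaletteColoring.exists_insert_pair_of_five {w : V} {c : V → Fin 5} {f : V → V → Fin 5}
    (hf : G.IsPaletteColoring S c f)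
    (hy : y ∉ S) (hxS : x ∉ S) (hz : z ∈ S) (hw : w ∈ S) (hwz : w ≠ z)
    (hyz : G.Adj y z) (hxw : G.Adj x w) (hyS : ∀ u ∈ S, G.Adj y u → u = z) (hxy : x ≠ y)
    (hxu : ∀ u ∈ S, G.Adj x u → u = w)
    (hdeg : ∀ v, ∀ T : Finset V, (∀ u ∈ T, G.Adj v u) → T.card + 3 ≤ 5) :
    ∃ (c' : V → Fin 5) (f' : V → V → Fin 5),
      G.IsPaletteColoring (Insert.insert x (Insert.insert y S)) c' f' := by
  classical
  have huniq : ∀ p q, p ∉ S → G.Adj q p → ∀ u ∈ S, ∀ u' ∈ S, G.Adj q u → G.Adj q u' → u = u' := by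
    intro p q hp hqp u hu u' hu' hqu hqu'
    by_contra hne
    have h1 := hdeg q {p, u, u'} (by simp [hqp, hqu, hqu'])
    rw [Finset.card_eq_three.2 ⟨p, u, u', by grind, by grind, hne, rfl⟩] at h1
    omega
  obtain ⟨i, n, d, h1, h2, h3, h4, h5, h6, hN, hd⟩ :=
    hf.exists_colors_of_five hw (huniq x w hxS hxw.symm)
  obtain ⟨j, m, -, k1, k2, k3, -, -, -, hM, -⟩ :=
    hf.exists_colors_of_five hz (huniq y z hy hyz.symm)
  obtain ⟨c', hc', hc'z, hi, hn, hbad⟩ : ∃ c' : V → Fin 5, G.IsPaletteColoring S c' f ∧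
      c' z = c z ∧ c' w ≠ i ∧ c' w ≠ n ∧ ¬ (c' z = n ∧ j = i ∧ m = c' w) := by
    by_cases hbad : c z = n ∧ j = i ∧ m = c w
    · refine ⟨_, hd, ?_, ?_⟩
      · simp [extendVert, hwz.symm]
      · simp [extendVert]; grind
    · exact ⟨c, hf, rfl, h1, h2, hbad⟩
  rw [← hc'z] at k1 k2
  obtain ⟨s, hs, s', hs', t, ht, t', ht', b, hb, a, ha, h⟩ :=
    bridgeable_of_ne hi hn h3 k1 k2 k3 hbad
  obtain ⟨hN1, hN2⟩ := hN c' hi hn s s' hs.1 hs.2.1 hs.2.2 hs'.1 hs'.2.1 hs'.2.2.1 hs'.2.2.2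
  obtain ⟨hM1, hM2⟩ := hM c' k1 k2 t t' ht.1 ht.2.1 ht.2.2 ht'.1 ht'.2.1 ht'.2.2.1 ht'.2.2.2
  exact hc'.exists_insert_bridge le_rfl hy hxS hz hw hwz hyz hyS hxy hxu hN1 hM1 hN2 hM2
    (by simpa using hb) (by simpa using ha) h

/-- Adding a triangle which is a connected component. -/
theorem IsPaletteColoring.exists_insert_triangle {c : V → Fin 5} {f : V → V → Fin 5}
    (hf : G.IsPaletteColoring S c f) (hx : x ∉ S) (hy : y ∉ S) (hz : z ∉ S) (hxy : x ≠ y)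
    (hxz : x ≠ z) (hyz : y ≠ z) (hxS : ∀ u ∈ S, ¬ G.Adj x u) (hyS : ∀ u ∈ S, ¬ G.Adj y u)
    (hzS : ∀ u ∈ S, ¬ G.Adj z u) :
    ∃ (c' : V → Fin 5) (f' : V → V → Fin 5),
      G.IsPaletteColoring (Insert.insert x (Insert.insert z (Insert.insert y S))) c' f' := by
  have hy1 : ∀ N, N.card = 2 → 4 ∉ N → G.IsPalette (Insert.insert y S) (extendVert c y 4)
      (extendInc f y (fun _ => 0) (fun _ => 0)) y N := fun N hN h4 =>
    IsPalette.insert_self hN h4 (fun u hu h => (hyS u hu h).elim) (fun u hu h => (hyS u hu h).elim)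
  have hf1 := hf.insert (a := 4) (g := fun _ => 0) (h := fun _ => 0) (N := {1, 2}) hy (by decide)
    (by decide) (by grind) (by grind) (by grind) (by grind) (by grind) (by grind)
  have hfree : ∀ α : Fin 5, α ∉ ({1, 2} : Finset (Fin 5)) → α ≠ 4 →
      G.IsFreeColor (Insert.insert y S) (extendVert c y 4)
      (extendInc f y (fun _ => 0) (fun _ => 0)) y {1, 2} α := fun α hα h4 => by
    refine ⟨hα, by simpa [extendVert] using h4, ?_⟩
    rintro u (rfl | hu) h
    · exact (G.irrefl h).elim
    · exact (hyS u hu h).elim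
  have hzy : z ∉ Insert.insert y S := by simp [hyz.symm, hz]
  have hg : ∀ u ∈ Insert.insert y S, G.Adj z u → u = y := by grind
  have hf2 := hf1.insert (a := 2) (g := fun _ => 0) (h := fun _ => 1) (N := {0, 4})
    hzy (by decide) (by decide) (by simp) (by simp) (by simp)
    (fun u hu h => by obtain rfl := hg u hu h; simp [extendVert]) (by grind)
    (fun u hu h => by
      obtain rfl := hg u hu h
      exact ⟨_, hy1 {1, 2} (by decide) (by decide), hfree 0 (by decide) (by decide), by simp⟩)
  refine hf2.exists_insert_two (x := x) (y := y) (z := z) (N := {1, 2}) (M := {0, 4}) (α := 3)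
    (β := 3) (μ := 2) (ν := 4) (a := 1) le_rfl (by grind) hyz (by grind) ?_ ?_ ?_ ?_ (by decide)
    (by decide) (by decide) (by decide) (by decide) ?_ ?_ (by decide) (by decide) (by decide)
    (by decide)
  · exact (hy1 _ (by decide) (by decide)).insert_of_mem hyz (by decide) (by decide)
  · exact IsPalette.insert_self (by decide) (by decide) (by simp) (by simp)
  · exact (hfree 3 (by decide) (by decide)).insert_of_ne hyz (by decide)
  · refine ⟨by decide, by simp [extendVert], ?_⟩
    rintro u (rfl | hu) h
    · exact (G.irrefl h).elim
    · simp [extendInc]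
  · simp [extendVert, hyz]
  · simp [extendVert]

theorem nodup_of_forall_mem {k : ℕ} {l : List (Fin k)} (hl : l.length ≤ k) (h : ∀ a, a ∈ l) :
    l.Nodup := by
  classical
  have h1 : l.toFinset = Finset.univ := by ext; simp [h]
  have h2 : l.toFinset.card = l.length :=
    le_antisymm l.toFinset_card_le (by rw [h1]; simpa using hl)
  exact Multiset.toFinset_card_eq_card_iff_nodup.1 h2

open Classical in
/-- Recolour the two incidences of the edge `yz`. -/
noncomputable def recolorEdge (f : V → V → Fin k) (y z : V) (α β : Fin k) : V → V → Fin k :=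
  fun v w => if v = y ∧ w = z then α else if v = z ∧ w = y then β else f v w

set_option maxHeartbeats 1600000 in
/-- Adding a vertex of degree two whose neighbours are adjacent. -/
theorem IsPaletteColoring.exists_insert_ear [Finite V] (hf : G.IsPaletteColoring S c f)
    (hk : 6 ≤ k) (hx : x ∉ S) (hy : y ∈ S) (hz : z ∈ S) (hxy : G.Adj x y) (hxz : G.Adj x z)
    (hyz : G.Adj y z) (hxS : ∀ u ∈ S, G.Adj x u → u = y ∨ u = z)
    (hdeg : ∀ v, ∀ T : Finset V, (∀ u ∈ T, G.Adj v u) → T.card + 3 ≤ k) :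
    ∃ (c' : V → Fin k) (f' : V → V → Fin k), G.IsPaletteColoring (Insert.insert x S) c' f' := by
  classical
  obtain ⟨N, hN⟩ := hf.palette y hy
  obtain ⟨M, hM⟩ := hf.palette z hz
  obtain ⟨α, hα⟩ := hN.exists_isFreeColor hx hxy.symm (hdeg y)
  obtain ⟨β, hβ⟩ := hM.exists_isFreeColor hx hxz.symm (hdeg z)
  set A := f y z with hA
  set B := f z y with hB
  have hAM : A ∈ M := hM.second y hy hyz.symm
  have hBN : B ∈ N := hN.second z hz hyz
  have hAN : A ∉ N := hN.first z hz hyz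
  have hBM : B ∉ M := hM.first y hy hyz.symm
  have hαA : α ≠ A := (hα.ne_first z hz hyz).symm
  have hβB : β ≠ B := (hβ.ne_first y hy hyz.symm).symm
  have hAB : A ≠ B := fun h => hAN (h ▸ hBN)
  have hcN := hN.self
  have hcM := hM.self
  have hαN := hα.notMem
  have hβM := hβ.notMem
  by_cases hfresh : ∃ a, a ∉ [c y, c z, α, β, A, B]
  · obtain ⟨a, ha⟩ := hfresh
    simp only [List.mem_cons, List.not_mem_nil, or_false, not_or] at ha
    exact hf.exists_insert_two (a := a) (by omega) hx hyz.ne hxS hN hM hα hβ hBN hAM hAB.symm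
      hβB.symm hαA.symm (by grind) (by grind) (by grind) (by grind) (by grind) (by grind)
  push Not at hfresh
  have hnd := nodup_of_forall_mem (by simpa using hk) hfresh
  have hk6 : k = 6 := by
    have := Fintype.card_le_of_surjective (fun i : Fin 6 => [c y, c z, α, β, A, B].get i)
      (fun a => List.get_of_mem (hfresh a))
    simp at this
    omega
  simp only [List.nodup_cons, List.mem_cons, List.not_mem_nil, or_false, not_or] at hnd hfresh
  -- either palette containing the colour of the opposite vertex is enough
  by_cases hczN : c z ∈ N
  · exact hf.exists_insert_two (a := B) (μ := c z) (by omega) hx hyz.ne hxS hN hM hα hβ hczN hAM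
      (by grind) (by grind) (by grind) (by grind) (by grind) (by grind) (by grind) (by grind)
      (by grind)
  by_cases hcyM : c y ∈ M
  · exact hf.exists_insert_two (a := A) (ν := c y) (by omega) hx hyz.ne hxS hN hM hα hβ hBN hcyM
      (by grind) (by grind) (by grind) (by grind) (by grind) (by grind) (by grind) (by grind)
      (by grind)
  have hNeq : N = {B, β} := Finset.eq_of_subset_of_card_le (fun a ha => by
    have := hfresh a; simp only [Finset.mem_insert, Finset.mem_singleton]; grind)
    (by rw [hN.card]; exact Finset.card_le_two)
  have hMeq : M = {A, α} := Finset.eq_of_subset_of_card_le (fun a ha => by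
    have := hfresh a; simp only [Finset.mem_insert, Finset.mem_singleton]; grind)
    (by rw [hM.card]; exact Finset.card_le_two)
  have huniq : ∀ p q, G.Adj p x → G.Adj p q → q ∈ S → ∀ u ∈ S, ∀ u' ∈ S, G.Adj p u → G.Adj p u' →
      u ≠ q → u' ≠ q → u = u' := by
    intro p q hpx hpq hq u hu u' hu' hpu hpu' hne hne'
    by_contra h
    have h1 := hdeg p {x, q, u, u'} (by simp [*])
    have h2 : ({x, q, u, u'} : Finset V).card = 4 := by
      rw [Finset.card_insert_of_notMem, Finset.card_insert_of_notMem, Finset.card_pair h] <;>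
        simp only [Finset.mem_insert, Finset.mem_singleton] <;> grind
    omega
  have huy := huniq y z hxy.symm hyz hz
  have huz := huniq z y hxz.symm hyz.symm hy
  subst hNeq hMeq
  by_cases hy' : ∃ u ∈ S, G.Adj y u ∧ u ≠ z ∧ f u y = B
  · -- the only other neighbour of `y` uses `B`, so that `β` can leave the palette of `y`
    obtain ⟨u, hu, hyu, huz', huB⟩ := hy'
    have hN' : G.IsPalette S c f y {B, α} := by
      refine ⟨Finset.card_pair (by grind), by simp; grind, ?_, ?_⟩
      · intro v hv hyv
        have := hN.first v hv hyv
        have := hα.ne_first v hv hyv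
        simp at *; grind
      · intro v hv hyv
        by_cases hvz : v = z
        · subst hvz; simp [hB]
        · rw [huy v hv u hu hyv hyu hvz huz']; simp [huB]
    have hβ' : G.IsFreeColor S c f y {B, α} β := by
      refine ⟨by simp; grind, by grind, fun v hv hyv h => ?_⟩
      exact hN.first v hv hyv (by simp [h])
    exact hf.exists_insert_two (a := α) (μ := B) (by omega) hx hyz.ne hxS hN' hM hβ' hβ (by simp)
      hAM (by grind) (by grind) (by grind) (by grind) (by grind) (by grind) (by grind) (by grind)
      (by grind)
  by_cases hz' : ∃ u ∈ S, G.Adj z u ∧ u ≠ y ∧ f u z = A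
  · obtain ⟨u, hu, hzu, huy', huA⟩ := hz'
    have hM' : G.IsPalette S c f z {A, β} := by
      refine ⟨Finset.card_pair (by grind), by simp; grind, ?_, ?_⟩
      · intro v hv hzv
        have := hM.first v hv hzv
        have := hβ.ne_first v hv hzv
        simp at *; grind
      · intro v hv hzv
        by_cases hvy : v = y
        · subst hvy; simp [hA]
        · rw [huz v hv u hu hzv hzu hvy huy']; simp [huA]
    have hα' : G.IsFreeColor S c f z {A, β} α := by
      refine ⟨by simp; grind, by grind, fun v hv hzv h => ?_⟩
      exact hM.first v hv hzv (by simp [h])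
    exact hf.exists_insert_two (a := β) (ν := A) (by omega) hx hyz.ne hxS hN hM' hα hα' hBN
      (by simp) (by grind) (by grind) (by grind) (by grind) (by grind) (by grind) (by grind)
      (by grind) (by grind)
  -- otherwise the edge `yz` takes the colours `α` and `β`
  push Not at hz'
  have hzα : ∀ u ∈ S, G.Adj z u → u ≠ y → f u z = α := by
    intro u hu hzu hne
    have h1 := hM.second u hu hzu
    have h2 := hz' u hu hzu hne
    simp only [Finset.mem_insert, Finset.mem_singleton] at h1
    tauto
  have hM1 : ∀ u ∈ S, G.Adj z u → f z u ≠ A ∧ f z u ≠ α := by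
    intro u hu hzu
    simpa using hM.first u hu hzu
  have hN1 : G.IsPalette S c (recolorEdge f y z α β) y {B, β} := by
    refine ⟨hN.card, hcN, ?_, ?_⟩
    · intro u hu hyu
      have := hN.first u hu hyu
      have := hyz.ne
      grind [recolorEdge]
    · intro u hu hyu
      have := hN.second u hu hyu
      have := hyz.ne
      grind [recolorEdge]
  have hM2 : G.IsPalette S c (recolorEdge f y z α β) z {α, B} := by
    refine ⟨Finset.card_pair (by grind), by simp; grind, ?_, ?_⟩
    · intro u hu hzu
      have := hM1 u hu hzu
      have := hf.inj z hz u hu y hy hzu hyz.symm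
      have := hyz.ne
      grind [recolorEdge]
    · intro u hu hzu
      have := hzα u hu hzu
      have := hyz.ne
      grind [recolorEdge]
  have hf' : G.IsPaletteColoring S c (recolorEdge f y z α β) := by
    refine ⟨fun v hv => ?_, hf.vert, ?_, ?_⟩
    · by_cases hvy : v = y
      · exact ⟨{B, β}, by rw [hvy]; exact hN1⟩
      by_cases hvz : v = z
      · exact ⟨{α, B}, by rw [hvz]; exact hM2⟩
      obtain ⟨P, hP⟩ := hf.palette v hv
      exact ⟨P, hP.card, hP.self, by simpa [recolorEdge, hvy, hvz] using hP.first,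
        by simpa [recolorEdge, hvy, hvz] using hP.second⟩
    · intro v hv u hu hvu
      have := hf.inc v hv u hu hvu
      grind [recolorEdge]
    · intro v hv u hu u' hu' hvu hvu' hne
      have := hf.inj v hv u hu u' hu' hvu hvu' hne
      have := hα.ne_first
      have := hβ.ne_first
      have := hyz.ne
      grind [recolorEdge]
  have hA1 : G.IsFreeColor S c (recolorEdge f y z α β) y {B, β} A := by
    refine ⟨hAN, by grind, fun u hu hyu => ?_⟩
    have := hf.inj y hy u hu z hz hyu hyz
    have := hyz.ne
    grind [recolorEdge]
  have hA2 : G.IsFreeColor S c (recolorEdge f y z α β) z {α, B} A := by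
    refine ⟨by simp; grind, by grind, fun u hu hzu => ?_⟩
    have := hM1 u hu hzu
    have := hyz.ne
    grind [recolorEdge]
  exact hf'.exists_insert_two (a := B) (μ := β) (ν := α) (by omega) hx hyz.ne hxS hN1 hM2 hA1 hA2
    (by simp) (by simp) (by grind) (by grind) (by grind) (by grind) (by grind) (by grind)
    (by grind) (by grind) (by grind)

/-- Every finite outerplanar graph has a vertex of degree at most one, a vertex of degree two in
a triangle, or two adjacent vertices of degree two with distinct further neighbours. -/
theorem Outerplanar.exists_reducible [Finite V] (hG : G.Outerplanar) (hS : S.Nonempty) :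
    (∃ x ∈ S, ∀ u ∈ S, ∀ u' ∈ S, G.Adj x u → G.Adj x u' → u = u') ∨
    (∃ x ∈ S, ∃ y ∈ S, ∃ z ∈ S, G.Adj x y ∧ G.Adj x z ∧ G.Adj y z ∧
      ∀ u ∈ S, G.Adj x u → u = y ∨ u = z) ∨
    (∃ x ∈ S, ∃ y ∈ S, ∃ w ∈ S, ∃ z ∈ S, w ≠ z ∧ w ≠ y ∧ z ≠ x ∧ G.Adj x y ∧ G.Adj x w ∧ G.Adj y z ∧
      (∀ u ∈ S, G.Adj x u → u = y ∨ u = w) ∧ ∀ u ∈ S, G.Adj y u → u = x ∨ u = z) := by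
  classical
  have := Fintype.ofFinite V
  obtain ⟨r, hr⟩ := hG
  let _ : LinearOrder V := r
  replace hr : ∀ a b d e : V, G.Adj a b → G.Adj d e → ¬ (a < d ∧ d < b ∧ b < e) := hr
  let T : Finset (V × V) := Finset.univ.filter fun p =>
    p.1 ∈ S ∧ p.2 ∈ S ∧ G.Adj p.1 p.2 ∧ ∃ v ∈ S, p.1 < v ∧ v < p.2
  have hT : ∀ a b, (a, b) ∈ T ↔ a ∈ S ∧ b ∈ S ∧ G.Adj a b ∧ ∃ v ∈ S, a < v ∧ v < b := by
    simp [T]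
  have hleft : ∀ s : Set V, s.Nonempty → ∃ m ∈ s, ∀ v ∈ s, m ≤ v := fun s hs =>
    Set.exists_min_image s id s.toFinite hs
  by_cases hTe : T.Nonempty
  swap
  · obtain ⟨x, hx, hmin⟩ := hleft S hS
    refine .inl ⟨x, hx, ?_⟩
    rw [Finset.not_nonempty_iff_eq_empty] at hTe
    have hno : ∀ u ∈ S, ∀ u' ∈ S, G.Adj x u → G.Adj x u' → ¬ u < u' := by
      intro u hu u' hu' hxu hxu' hlt
      have : (x, u') ∈ T := (hT _ _).2 ⟨hx, hu', hxu', u, hu, lt_of_le_of_ne (hmin u hu) hxu.ne, hlt⟩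
      simp [hTe] at this
    intro u hu u' hu' hxu hxu'
    exact le_antisymm (not_lt.1 (hno u' hu' u hu hxu' hxu)) (not_lt.1 (hno u hu u' hu' hxu hxu'))
  obtain ⟨⟨a, b⟩, habT, hmin⟩ := T.exists_min_image
    (fun p => (Finset.univ.filter fun v => v ∈ S ∧ p.1 < v ∧ v < p.2).card) hTe
  obtain ⟨haS, hbS, hab, v₀, hv₀, hav₀, hv₀b⟩ := (hT _ _).1 habT
  -- edges strictly inside `(a, b)` join consecutive vertices of `S`
  have hinner : ∀ p ∈ S, ∀ q ∈ S, G.Adj p q → a ≤ p → q ≤ b → (a < p ∨ q < b) →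
      ∀ v ∈ S, ¬ (p < v ∧ v < q) := by
    intro p hp q hq hpq hap hqb hne v hv hpvq
    refine (hmin (p, q) ((hT _ _).2 ⟨hp, hq, hpq, v, hv, hpvq⟩)).not_gt (Finset.card_lt_card ?_)
    rw [Finset.ssubset_iff_of_subset]
    · rcases hne with h | h
      · exact ⟨p, by simp [hp, h, (hpvq.1.trans hpvq.2).trans_le hqb], by simp⟩
      · exact ⟨q, by simp [hq, h, hap.trans_lt (hpvq.1.trans hpvq.2)], by simp⟩
    · intro w
      simp only [Finset.mem_filter, Finset.mem_univ, true_and]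
      exact fun ⟨h1, h2, h3⟩ => ⟨h1, hap.trans_lt h2, h3.trans_le hqb⟩
  have hrange : ∀ p, a < p → p < b → ∀ u, G.Adj p u → a ≤ u ∧ u ≤ b := by
    intro p hap hpb u hpu
    refine ⟨not_lt.1 fun h => hr u p a b hpu.symm hab ⟨h, hap, hpb⟩,
      not_lt.1 fun h => hr a b p u hab hpu ⟨hap, hpb, h⟩⟩
  have hup : ∀ p ∈ S, a < p → p < b → ∀ u ∈ S, ∀ u' ∈ S, G.Adj p u → G.Adj p u' → p < u → p < u' →
      u = u' := by
    have : ∀ p ∈ S, a < p → p < b → ∀ u ∈ S, ∀ u' ∈ S, G.Adj p u → G.Adj p u' → p < u → p < u' →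
        u ≤ u' := fun p hp hap hpb u hu u' hu' hpu hpu' hlt hlt' => not_lt.1 fun h =>
      hinner p hp u hu hpu hap.le (hrange p hap hpb u hpu).2 (.inl hap) u' hu' ⟨hlt', h⟩
    intro p hp hap hpb u hu u' hu' hpu hpu' hlt hlt'
    exact le_antisymm (this p hp hap hpb u hu u' hu' hpu hpu' hlt hlt')
      (this p hp hap hpb u' hu' u hu hpu' hpu hlt' hlt)
  obtain ⟨x, ⟨hxS, hax, hxb⟩, hxmin⟩ := hleft {v | v ∈ S ∧ a < v ∧ v < b} ⟨v₀, hv₀, hav₀, hv₀b⟩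
  have hxdown : ∀ u ∈ S, G.Adj x u → u < x → u = a := by
    intro u hu hxu hlt
    refine le_antisymm (not_lt.1 fun h => ?_) (hrange x hax hxb u hxu).1
    exact (hxmin u ⟨hu, h, hlt.trans hxb⟩).not_gt hlt
  by_cases hleaf : ∀ u ∈ S, ∀ u' ∈ S, G.Adj x u → G.Adj x u' → u = u'
  · exact .inl ⟨x, hxS, hleaf⟩
  obtain ⟨y, hyS, hxy, hlt, hxa⟩ : ∃ y ∈ S, G.Adj x y ∧ x < y ∧ G.Adj x a := by
    push Not at hleaf
    obtain ⟨u, hu, u', hu', hxu, hxu', hne⟩ := hleaf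
    rcases lt_or_gt_of_ne hxu.ne with h | h <;> rcases lt_or_gt_of_ne hxu'.ne with h' | h'
    · exact (hne (hup x hxS hax hxb u hu u' hu' hxu hxu' h h')).elim
    · exact ⟨u, hu, hxu, h, hxdown u' hu' hxu' h' ▸ hxu'⟩
    · exact ⟨u', hu', hxu', h', hxdown u hu hxu h ▸ hxu⟩
    · exact (hne ((hxdown u hu hxu h).trans (hxdown u' hu' hxu' h').symm)).elim
  have hxnb : ∀ u ∈ S, G.Adj x u → u = y ∨ u = a := by
    intro u hu hxu
    rcases lt_or_gt_of_ne hxu.ne with h | h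
    · exact .inl (hup x hxS hax hxb u hu y hyS hxu hxy h hlt)
    · exact .inr (hxdown u hu hxu h)
  have hyb := (hrange x hax hxb y hxy).2
  rcases hyb.eq_or_lt with rfl | hyb
  · exact .inr (.inl ⟨x, hxS, y, hyS, a, haS, hxy, hxa, hab.symm, hxnb⟩)
  have hay := hax.trans hlt
  have hydown : ∀ u ∈ S, G.Adj y u → u < y → u = x := by
    intro u hu hyu huy
    rcases lt_trichotomy u x with h | h | h
    · exact (hinner u hu y hyS hyu.symm (hrange y hay hyb u hyu).1 hyb.le (.inr hyb) x hxS
        ⟨h, hlt⟩).elim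
    · exact h
    · exact (hinner x hxS y hyS hxy hax.le hyb.le (.inr hyb) u hu ⟨h, huy⟩).elim
  by_cases hyleaf : ∃ z ∈ S, G.Adj y z ∧ y < z
  · obtain ⟨z, hzS, hyz, hyz'⟩ := hyleaf
    refine .inr (.inr ⟨x, hxS, y, hyS, a, haS, z, hzS, (hay.trans hyz').ne, hay.ne,
      (hlt.trans hyz').ne', hxy, hxa, hyz, hxnb, fun u hu hyu => ?_⟩)
    rcases lt_or_gt_of_ne hyu.ne with h | h
    · exact .inr (hup y hyS hay hyb u hu z hzS hyu hyz h hyz')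
    · exact .inl (hydown u hu hyu h)
  · push Not at hyleaf
    refine .inl ⟨y, hyS, fun u hu u' hu' hyu hyu' => ?_⟩
    rw [hydown u hu hyu (lt_of_le_of_ne (hyleaf u hu hyu) hyu.ne'),
      hydown u' hu' hyu' (lt_of_le_of_ne (hyleaf u' hu' hyu') hyu'.ne')]

theorem Outerplanar.exists_isPaletteColoring [Finite V] (hG : G.Outerplanar) (hk : 3 ≤ k)
    (hdeg : ∀ v, ∀ T : Finset V, (∀ u ∈ T, G.Adj v u) → T.card + 3 ≤ k) (S : Set V) :
    ∃ (c : V → Fin k) (f : V → V → Fin k), G.IsPaletteColoring S c f := by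
  classical
  induction hn : S.ncard using Nat.strong_induction_on generalizing S with
  | _ n ih =>
  subst hn
  replace ih : ∀ S', S' ⊂ S → ∃ (c : V → Fin k) (f : V → V → Fin k),
      G.IsPaletteColoring S' c f := fun S' h => ih _ (Set.ncard_lt_ncard h S.toFinite) S' rfl
  rcases S.eq_empty_or_nonempty with rfl | hS
  · exact ⟨fun _ => ⟨0, by omega⟩, fun _ _ => ⟨0, by omega⟩, by simp, by simp, by simp, by simp⟩
  have hsub : ∀ x ∈ S, ∀ A : Set V, x ∈ A → S \ A ⊂ S := fun x hx A hA =>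
    Set.ssubset_iff_of_subset Set.sdiff_subset |>.2 ⟨x, hx, by simp [hA]⟩
  rcases hG.exists_reducible hS with ⟨x, hx, hxS⟩ | ⟨x, hx, y, hy, z, hz, hxy, hxz, hyz, hxS⟩ |
    ⟨x, hx, y, hy, w, hw, z, hz, hwz, hwy, hzx, hxy, hxw, hyz, hxS, hyS⟩
  · obtain ⟨c, f, hf⟩ := ih (S \ {x}) (hsub x hx _ rfl)
    have := hf.exists_insert_leaf hk (x := x) (by simp) (by grind) hdeg
    rwa [Set.insert_sdiff_singleton, Set.insert_eq_of_mem hx] at this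
  · have hk5 : 5 ≤ k := by
      have := hdeg x {y, z} (by simp [hxy, hxz])
      rwa [Finset.card_pair hyz.ne] at this
    rcases hk5.eq_or_lt with rfl | hk6
    · have htri : ∀ p q r, G.Adj p q → G.Adj p r → G.Adj q r → ∀ u, G.Adj p u → u = q ∨ u = r := by
        intro p q r hpq hpr hqr u hpu
        by_contra! h
        have h1 := hdeg p {q, r, u} (by simp [*])
        rw [Finset.card_eq_three.2 ⟨q, r, u, hqr.ne, h.1.symm, h.2.symm, rfl⟩] at h1
        omega
      have h1 := htri x y z hxy hxz hyz
      have h2 := htri y x z hxy.symm hyz hxz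
      have h3 := htri z x y hxz.symm hyz.symm hxy
      obtain ⟨c, f, hf⟩ := ih (S \ {x, y, z}) (hsub x hx _ (by simp))
      have := hf.exists_insert_triangle (x := x) (y := y) (z := z) (by simp) (by simp) (by simp)
        hxy.ne hxz.ne hyz.ne (by grind) (by grind) (by grind)
      rwa [show Insert.insert x (Insert.insert z (Insert.insert y (S \ {x, y, z}))) = S by
        ext; simp; grind] at this
    · obtain ⟨c, f, hf⟩ := ih (S \ {x}) (hsub x hx _ rfl)
      have := hf.exists_insert_ear (x := x) (y := y) (z := z) hk6 (by simp) ⟨hy, hxy.ne'⟩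
        ⟨hz, hxz.ne'⟩ hxy hxz hyz (by grind) hdeg
      rwa [Set.insert_sdiff_singleton, Set.insert_eq_of_mem hx] at this
  · have hk5 : 5 ≤ k := by
      have := hdeg x {y, w} (by simp [hxy, hxw])
      rwa [Finset.card_pair hwy.symm] at this
    obtain ⟨c, f, hf⟩ := ih (S \ {x, y}) (hsub x hx _ (by simp))
    have hzS : z ∈ S \ {x, y} := ⟨hz, by simp [hzx, hyz.ne']⟩
    have hwS : w ∈ S \ {x, y} := ⟨hw, by simp [hwy, hxw.ne']⟩
    have hins : Insert.insert x (Insert.insert y (S \ {x, y})) = S := by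
      ext; simp; grind
    rw [← hins]
    rcases hk5.eq_or_lt with rfl | hk6
    · exact hf.exists_insert_pair_of_five (by simp) (by simp) hzS hwS hwz hyz hxw (by grind)
        hxy.ne (by grind) hdeg
    · exact hf.exists_insert_pair_of_six_le hk6 (by simp) (by simp) hzS hwS hwz hyz hxw (by grind)
        hxy.ne (by grind) hdeg

theorem IsPaletteColoring.exists_isViColoring (hf : G.IsPaletteColoring Set.univ c f) :
    ∃ cV cI, G.IsViColoring k cV cI := by
  classical
  let cI : V → Sym2 V → Fin k := fun v e => if h : v ∈ e then f v (Sym2.Mem.other h) else c v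
  have hcI : ∀ v w, cI v s(v, w) = f v w := by
    intro v w
    have h : v ∈ s(v, w) := Sym2.mem_mk_left v w
    simp only [cI, h, dif_pos]
    rw [Sym2.congr_right.1 (Sym2.other_spec h)]
  have hpal : ∀ v p q, G.Adj v p → G.Adj v q → f v p ≠ f q v := by
    intro v p q hvp hvq h
    obtain ⟨N, hN⟩ := hf.palette v trivial
    exact hN.first p trivial hvp (h ▸ hN.second q trivial hvq)
  refine ⟨c, cI, fun u v huv => hf.vert u trivial v trivial huv, ?_, ?_⟩
  · rintro u w e ⟨he, hwe⟩ hu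
    obtain ⟨t, rfl⟩ := Sym2.mem_iff_exists.1 hwe
    have hwt : G.Adj w t := he
    rw [hcI]
    rcases Sym2.mem_iff.1 hu with rfl | rfl
    · exact (hf.inc u trivial t trivial hwt).symm
    · obtain ⟨N, hN⟩ := hf.palette u trivial
      exact fun h => hN.self (h ▸ hN.second w trivial hwt.symm)
  · rintro v e w e' ⟨he, hve⟩ ⟨he', hwe'⟩ hne h
    obtain ⟨p, rfl⟩ := Sym2.mem_iff_exists.1 hve
    obtain ⟨q, rfl⟩ := Sym2.mem_iff_exists.1 hwe'
    have hvp : G.Adj v p := he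
    have hwq : G.Adj w q := he'
    rw [hcI, hcI]
    by_cases hvw : v = w
    · subst hvw
      exact hf.inj v trivial p trivial q trivial hvp hwq fun h => hne (by rw [h])
    rcases h with h | h | h | h
    · exact (hvw h).elim
    · rcases Sym2.eq_iff.1 h with ⟨h, -⟩ | ⟨rfl, rfl⟩
      · exact (hvw h).elim
      · exact hpal _ _ _ hvp hvp
    · obtain rfl := Sym2.congr_right.1 h
      exact (hpal w q v hwq hvp.symm).symm
    · obtain rfl : v = q := Sym2.congr_right.1 (Sym2.eq_swap.trans h)
      exact hpal v p w hvp hwq.symm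

theorem card_le_maxDeg [Fintype V] (G : SimpleGraph V) (v : V) (T : Finset V)
    (hT : ∀ u ∈ T, G.Adj v u) : T.card ≤ G.maxDeg := by
  refine le_trans ?_ (Finset.le_sup (f := fun v => (G.neighborSet v).ncard) (Finset.mem_univ v))
  rw [← Set.ncard_coe_finset]
  exact Set.ncard_le_ncard (fun u hu => hT u hu) (Set.toFinite _)

end SimpleGraph

/-- For every finite outerplanar graph `G`, `χ_vi(G) ≤ Δ(G) + 3`. -/
theorem chiVi_le_of_outerplanar [Fintype V] (G : SimpleGraph V) (hG : G.Outerplanar) :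
    G.chiVi ≤ G.maxDeg + 3 := by
  obtain ⟨c, f, hf⟩ := hG.exists_isPaletteColoring (k := G.maxDeg + 3) (by omega)
    (fun v T hT => Nat.add_le_add_right (G.card_le_maxDeg v T hT) 3) Set.univ
  exact Nat.sInf_le hf.exists_isViColoring
end
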